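/- Hybrid digital/analog inner bound (matched bandwidth): a tuple (1,D,Δ) ∈ ℝ₊³ is achievable whenever there exist finite sets 𝒰, 𝒱 and random variables U, V, X with joint distribution p(u,v,a,b,e,x,y,z) = p(u|v)·p(v,x|a)·p(a,b,e)·p(y,z|x), in which X = x(V,A) is a deterministic function of (V,A), together with a function Â : 𝒱×ℬ×𝒴 → 𝒜, such that: (i) I(U;A) ≤ I(U;B,Y); (ii) I(V;A|U) ≤ I(V;B,Y|U); (iii) D ≥ E[d(A, Â(V,B,Y))]; and (iv) Δ ≤ H(A|U,E) − I(V;A|U) − I(X;Z|U,E) + min{ I(V;B,Y|U) , I(V;A,Z|U) }. -/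

import Mathlib

open Finset

namespace SecureSC

/-- Shannon entropy (base 2) of a finitely supported distribution `q`. -/
noncomputable def entropy {γ : Type} [Fintype γ] (q : γ → ℝ) : ℝ :=
  -∑ c, q c * Real.logb 2 (q c)

open Classical in
/-- Pushforward of a distribution along a map. -/
noncomputable def pushf {γ α : Type} [Fintype γ] (q : γ → ℝ) (f : γ → α) : α → ℝ :=
  fun a => ∑ c, if f c = a then q c else 0

/-- Entropy `H(f)` of the random variable `f` under the joint distribution `q`. -/
noncomputable def Hof {γ α : Type} [Fintype γ] [Fintype α] (q : γ → ℝ) (f : γ → α) : ℝ :=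
  entropy (pushf q f)

/-- Conditional entropy `H(f | g)` under the joint distribution `q`. -/
noncomputable def condH {γ α β : Type} [Fintype γ] [Fintype α] [Fintype β]
    (q : γ → ℝ) (f : γ → α) (g : γ → β) : ℝ :=
  Hof q (fun c => (f c, g c)) - Hof q g

/-- Mutual information `I(f ; g)` under the joint distribution `q`. -/
noncomputable def mutInf {γ α β : Type} [Fintype γ] [Fintype α] [Fintype β]
    (q : γ → ℝ) (f : γ → α) (g : γ → β) : ℝ :=
  Hof q f + Hof q g - Hof q (fun c => (f c, g c))

/-- Conditional mutual information `I(f ; g | h)` under the joint distribution `q`. -/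
noncomputable def condMutInf {γ α β δ : Type} [Fintype γ] [Fintype α] [Fintype β] [Fintype δ]
    (q : γ → ℝ) (f : γ → α) (g : γ → β) (h : γ → δ) : ℝ :=
  condH q f h - condH q f (fun c => (g c, h c))

/-- Expectation of `φ` under the distribution `q`. -/
noncomputable def expVal {γ : Type} [Fintype γ] (q : γ → ℝ) (φ : γ → ℝ) : ℝ :=
  ∑ c, q c * φ c

/-- `q` is a probability mass function. -/
def IsPMF {γ : Type} [Fintype γ] (q : γ → ℝ) : Prop :=
  (∀ c, 0 ≤ q c) ∧ ∑ c, q c = 1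

/-- `W` is a transition probability (stochastic kernel). -/
def IsKernel {α β : Type} [Fintype β] (W : α → β → ℝ) : Prop :=
  ∀ a, IsPMF (W a)

variable {A B E X Y Z : Type} [Fintype A] [Fintype B] [Fintype E]
  [Fintype X] [Fintype Y] [Fintype Z]

/-- Component-wise mean distortion on sequences. -/
noncomputable def seqDist (d : A → A → ℝ) {n : ℕ} (a a' : Fin n → A) : ℝ :=
  (n : ℝ)⁻¹ * ∑ i, d (a i) (a' i)

/-- Joint distribution of `(Aⁿ, Bⁿ, Eⁿ, Xᵐ, Yᵐ, Zᵐ)` induced by the i.i.d. source `pS`,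
the stochastic encoder `F` and the memoryless channel `Wch`. -/
noncomputable def codeJoint (pS : A × B × E → ℝ) (Wch : X → Y × Z → ℝ) {n m : ℕ}
    (F : (Fin n → A) → (Fin m → X) → ℝ) :
    (Fin n → A) × (Fin n → B) × (Fin n → E) × (Fin m → X) × (Fin m → Y) × (Fin m → Z) → ℝ :=
  fun w =>
    (∏ i, pS (w.1 i, w.2.1 i, w.2.2.1 i)) * F w.1 w.2.2.2.1 *
      ∏ j, Wch (w.2.2.2.1 j) (w.2.2.2.2.1 j, w.2.2.2.2.2 j)

/-- A tuple `(k, D, Δ)` is achievable for the secure joint source-channel coding problem. -/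
def Achievable (pS : A × B × E → ℝ) (Wch : X → Y × Z → ℝ) (d : A → A → ℝ)
    (k D Δ : ℝ) : Prop :=
  ∀ ε : ℝ, 0 < ε →
    ∃ (n m : ℕ), 0 < n ∧
      ∃ (F : (Fin n → A) → (Fin m → X) → ℝ)
        (g : (Fin n → B) → (Fin m → Y) → Fin n → A),
        IsKernel F ∧
        (m : ℝ) / n ≤ k + ε ∧
        expVal (codeJoint pS Wch F)
          (fun w => seqDist d w.1 (g w.2.1 w.2.2.2.2.1)) ≤ D + ε ∧
        Δ - ε ≤ (n : ℝ)⁻¹ *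
          condH (codeJoint pS Wch F) (fun w => w.1)
            (fun w => (w.2.2.1, w.2.2.2.2.2))

/-- Joint distribution of `(U, V, A, B, E, X, Y, Z)` with factorization
`p(u|v) p(v,x|a) p(a,b,e) p(y,z|x)` (hybrid digital/analog scheme). -/
noncomputable def hybridJoint {𝒰 𝒱 : Type} [Fintype 𝒰] [Fintype 𝒱]
    (pS : A × B × E → ℝ) (Wch : X → Y × Z → ℝ)
    (pU : 𝒱 → 𝒰 → ℝ) (pVX : A → 𝒱 × X → ℝ) :
    𝒰 × 𝒱 × A × B × E × X × Y × Z → ℝ :=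
  fun w => pU w.2.1 w.1 * pVX w.2.2.1 (w.2.1, w.2.2.2.2.2.1) *
    pS (w.2.2.1, w.2.2.2.1, w.2.2.2.2.1) *
    Wch w.2.2.2.2.2.1 (w.2.2.2.2.2.2.1, w.2.2.2.2.2.2.2)

/-- The single-letter conditions of the hybrid digital/analog inner bound (Theorem 3),
for given auxiliary finite alphabets `𝒰, 𝒱`. -/
def HybridCond (𝒰 𝒱 : Type) [Fintype 𝒰] [Fintype 𝒱]
    (pS : A × B × E → ℝ) (Wch : X → Y × Z → ℝ) (d : A → A → ℝ)
    (D Δ : ℝ) : Prop :=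
  ∃ (pU : 𝒱 → 𝒰 → ℝ) (pVX : A → 𝒱 × X → ℝ) (xfun : 𝒱 → A → X)
    (Ahat : 𝒱 → B → Y → A),
    IsKernel pU ∧ IsKernel pVX ∧
    -- X = x(V,A) is a deterministic function of (V,A)
    (∀ a v x, pVX a (v, x) ≠ 0 → x = xfun v a) ∧
    -- (i)  I(U;A) ≤ I(U;B,Y)
    mutInf (hybridJoint pS Wch pU pVX) (fun w => w.1) (fun w => w.2.2.1)
      ≤ mutInf (hybridJoint pS Wch pU pVX) (fun w => w.1)
          (fun w => (w.2.2.2.1, w.2.2.2.2.2.2.1)) ∧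
    -- (ii)  I(V;A|U) ≤ I(V;B,Y|U)
    condMutInf (hybridJoint pS Wch pU pVX)
        (fun w => w.2.1) (fun w => w.2.2.1) (fun w => w.1)
      ≤ condMutInf (hybridJoint pS Wch pU pVX)
        (fun w => w.2.1) (fun w => (w.2.2.2.1, w.2.2.2.2.2.2.1)) (fun w => w.1) ∧
    -- (iii)  D ≥ E[d(A, Â(V,B,Y))]
    expVal (hybridJoint pS Wch pU pVX)
        (fun w => d w.2.2.1 (Ahat w.2.1 w.2.2.2.1 w.2.2.2.2.2.2.1)) ≤ D ∧
    -- (iv)  Δ ≤ H(A|U,E) − I(V;A|U) − I(X;Z|U,E) + min{ I(V;B,Y|U) , I(V;A,Z|U) }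
    Δ ≤ condH (hybridJoint pS Wch pU pVX)
          (fun w => w.2.2.1) (fun w => (w.1, w.2.2.2.2.1))
        - condMutInf (hybridJoint pS Wch pU pVX)
            (fun w => w.2.1) (fun w => w.2.2.1) (fun w => w.1)
        - condMutInf (hybridJoint pS Wch pU pVX)
            (fun w => w.2.2.2.2.2.1) (fun w => w.2.2.2.2.2.2.2)
            (fun w => (w.1, w.2.2.2.2.1))
        + min
            (condMutInf (hybridJoint pS Wch pU pVX)
              (fun w => w.2.1) (fun w => (w.2.2.2.1, w.2.2.2.2.2.2.1)) (fun w => w.1))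
            (condMutInf (hybridJoint pS Wch pU pVX)
              (fun w => w.2.1) (fun w => (w.2.2.1, w.2.2.2.2.2.2.2)) (fun w => w.1))


set_option linter.unusedSectionVars false

/-! ### Basic facts on pushforwards and entropies -/

section Basics

variable {γ α β δ : Type} [Fintype γ] [Fintype α] [Fintype β] [Fintype δ]

lemma sum_pushf_mul (q : γ → ℝ) (f : γ → α) (φ : α → ℝ) :
    ∑ a, pushf q f a * φ a = ∑ c, q c * φ (f c) := by
  classical
  unfold pushf
  simp only [Finset.sum_mul]
  rw [Finset.sum_comm]
  refine Finset.sum_congr rfl fun c _ => ?_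
  simp [ite_mul]

lemma sum_pushf (q : γ → ℝ) (f : γ → α) : ∑ a, pushf q f a = ∑ c, q c := by
  simpa using sum_pushf_mul q f (fun _ => 1)

lemma pushf_nonneg {q : γ → ℝ} (hq : ∀ c, 0 ≤ q c) (f : γ → α) (a : α) : 0 ≤ pushf q f a := by
  unfold pushf
  refine Finset.sum_nonneg fun c _ => ?_
  split_ifs
  · exact hq c
  · exact le_rfl

lemma le_pushf {q : γ → ℝ} (hq : ∀ c, 0 ≤ q c) (f : γ → α) (c : γ) : q c ≤ pushf q f (f c) := by
  classical
  unfold pushf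
  have := Finset.single_le_sum (f := fun c' => if f c' = f c then q c' else 0)
    (fun c' _ => by split_ifs; exacts [hq c', le_rfl]) (Finset.mem_univ c)
  simpa using this

lemma pushf_isPMF {q : γ → ℝ} (hq : IsPMF q) (f : γ → α) : IsPMF (pushf q f) :=
  ⟨pushf_nonneg hq.1 f, by rw [sum_pushf, hq.2]⟩

lemma pushf_pushf (q : γ → ℝ) (f : γ → α) (g : α → β) :
    pushf (pushf q f) g = pushf q (fun c => g (f c)) := by
  classical
  funext b
  have := sum_pushf_mul q f (fun a => if g a = b then 1 else 0)
  simpa [pushf] using this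

/-- marginalising the second component -/
lemma sum_pushf_pair (q : γ → ℝ) (f : γ → α) (g : γ → β) (a : α) :
    ∑ b, pushf q (fun c => (f c, g c)) (a, b) = pushf q f a := by
  classical
  unfold pushf
  rw [Finset.sum_comm]
  refine Finset.sum_congr rfl fun c _ => ?_
  by_cases h : f c = a <;> simp [h, Prod.ext_iff]

lemma sum_pushf_pair_left (q : γ → ℝ) (f : γ → α) (g : γ → β) (b : β) :
    ∑ a, pushf q (fun c => (f c, g c)) (a, b) = pushf q g b := by
  classical
  unfold pushf
  rw [Finset.sum_comm]
  refine Finset.sum_congr rfl fun c _ => ?_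
  by_cases h : g c = b <;> simp [h, Prod.ext_iff]

lemma pushf_inj (q : γ → ℝ) (f : γ → α) (j : α → β) (hj : Function.Injective j) (a : α) :
    pushf q (fun c => j (f c)) (j a) = pushf q f a := by
  classical
  unfold pushf
  refine Finset.sum_congr rfl fun c _ => ?_
  simp [hj.eq_iff]

/-- Entropy in nats. -/
noncomputable def Hn (q : γ → ℝ) (f : γ → α) : ℝ := ∑ a, Real.negMulLog (pushf q f a)

lemma Hof_eq (q : γ → ℝ) (f : γ → α) : Hof q f = Hn q f / Real.log 2 := by
  unfold Hof entropy Hn Real.negMulLog Real.logb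
  rw [Finset.sum_div, ← Finset.sum_neg_distrib]
  refine Finset.sum_congr rfl fun c _ => ?_
  ring

lemma Hn_eq (q : γ → ℝ) (f : γ → α) :
    Hn q f = - ∑ c, q c * Real.log (pushf q f (f c)) := by
  rw [← sum_pushf_mul q f (fun a => Real.log (pushf q f a)), ← Finset.sum_neg_distrib]
  unfold Hn Real.negMulLog
  refine Finset.sum_congr rfl fun c _ => ?_
  ring

/-- entropy only depends on the partition generated -/
lemma Hn_inj (q : γ → ℝ) (f : γ → α) (j : α → β) (hj : Function.Injective j) :
    Hn q (fun c => j (f c)) = Hn q f := by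
  rw [Hn_eq, Hn_eq]
  simp [pushf_inj q f j hj]

lemma Hn_congr_inj (q : γ → ℝ) (f : γ → α) (g : γ → β) (j : α → β)
    (hj : Function.Injective j) (h : ∀ c, g c = j (f c)) : Hn q g = Hn q f := by
  rw [← Hn_inj q f j hj]
  congr 1
  funext c
  exact h c

/-- Only the values on the support matter. -/
lemma pushf_congr_supp (q : γ → ℝ) (f g : γ → α) (h : ∀ c, q c ≠ 0 → f c = g c) :
    pushf q f = pushf q g := by
  classical
  funext a
  unfold pushf
  refine Finset.sum_congr rfl fun c _ => ?_
  by_cases hc : q c = 0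
  · simp [hc]
  · rw [h c hc]

lemma pushf_pos {q : γ → ℝ} (hq : ∀ c, 0 ≤ q c) (f : γ → α) {c : γ} (hc : q c ≠ 0) :
    0 < pushf q f (f c) :=
  lt_of_lt_of_le (lt_of_le_of_ne (hq c) (Ne.symm hc)) (le_pushf hq f c)

/-- chain rule for a kernel factorisation -/
lemma Hn_chain {q : γ → ℝ} (hq : ∀ c, 0 ≤ q c) (f : γ → α) (g : γ → β) (κ : α → β → ℝ)
    (h : ∀ a b, pushf q (fun c => (f c, g c)) (a, b) = pushf q f a * κ a b) :
    Hn q (fun c => (f c, g c)) = Hn q f - ∑ c, q c * Real.log (κ (f c) (g c)) := by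
  rw [Hn_eq, Hn_eq]
  have : ∀ c, q c * Real.log (pushf q (fun c => (f c, g c)) (f c, g c)) =
      q c * Real.log (pushf q f (f c)) + q c * Real.log (κ (f c) (g c)) := by
    intro c
    by_cases hc : q c = 0
    · simp [hc]
    · have h1 := pushf_pos hq (fun c => (f c, g c)) hc
      have h2 := pushf_pos hq f hc
      simp only [h] at h1
      rw [h, Real.log_mul h2.ne' (by rintro h0; simp [h0] at h1)]
      ring
  simp only [this, Finset.sum_add_distrib]
  ring

/-- Gibbs inequality. -/
lemma gibbs {p r : γ → ℝ} (hp : ∀ c, 0 ≤ p c) (hr : ∀ c, 0 ≤ r c)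
    (hpr : ∀ c, p c ≠ 0 → r c ≠ 0) (hs : ∑ c, r c ≤ ∑ c, p c) :
    0 ≤ ∑ c, p c * (Real.log (p c) - Real.log (r c)) := by
  have : ∀ c, p c - r c ≤ p c * (Real.log (p c) - Real.log (r c)) := by
    intro c
    by_cases hc : p c = 0
    · simp [hc, hr c]
    · have h1 : 0 < p c := lt_of_le_of_ne (hp c) (Ne.symm hc)
      have h2 : 0 < r c := lt_of_le_of_ne (hr c) (Ne.symm (hpr c hc))
      have h3 := Real.log_le_sub_one_of_pos (div_pos h2 h1)
      rw [Real.log_div h2.ne' h1.ne'] at h3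
      have h4 := mul_le_mul_of_nonneg_left h3 h1.le
      have h5 : p c * (r c / p c - 1) = r c - p c := by field_simp
      linarith
  have h6 := Finset.sum_le_sum (s := Finset.univ) fun c _ => this c
  rw [Finset.sum_sub_distrib] at h6
  linarith

/-- Equality case of Gibbs inequality. -/
lemma gibbs_eq {p r : γ → ℝ} (hp : ∀ c, 0 ≤ p c) (hr : ∀ c, 0 ≤ r c)
    (hpr : ∀ c, p c ≠ 0 → r c ≠ 0) (hs : ∑ c, r c ≤ ∑ c, p c)
    (h0 : ∑ c, p c * (Real.log (p c) - Real.log (r c)) ≤ 0) : p = r := by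
  have key : ∀ c, 0 ≤ p c * (Real.log (p c) - Real.log (r c)) - (p c - r c) ∧
      (p c * (Real.log (p c) - Real.log (r c)) - (p c - r c) = 0 → p c = r c) := by
    intro c
    by_cases hc : p c = 0
    · simp only [hc]
      constructor
      · simp [hr c]
      · intro h; linarith
    · have h1 : 0 < p c := lt_of_le_of_ne (hp c) (Ne.symm hc)
      have h2 : 0 < r c := lt_of_le_of_ne (hr c) (Ne.symm (hpr c hc))
      have h5 : p c * (r c / p c - 1) = r c - p c := by field_simp
      constructor
      · have h3 := Real.log_le_sub_one_of_pos (div_pos h2 h1)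
        rw [Real.log_div h2.ne' h1.ne'] at h3
        have h4 := mul_le_mul_of_nonneg_left h3 h1.le
        linarith
      · intro h
        by_contra hne
        have h3 := Real.log_lt_sub_one_of_pos (div_pos h2 h1) (by
          intro h'; rw [div_eq_one_iff_eq h1.ne'] at h'; exact hne h'.symm)
        rw [Real.log_div h2.ne' h1.ne'] at h3
        have h4 := mul_lt_mul_of_pos_left h3 h1
        linarith
  have hsum : ∑ c, (p c * (Real.log (p c) - Real.log (r c)) - (p c - r c)) = 0 := by
    apply le_antisymm
    · rw [Finset.sum_sub_distrib, Finset.sum_sub_distrib]; linarith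
    · exact Finset.sum_nonneg fun c _ => (key c).1
  rw [Finset.sum_eq_zero_iff_of_nonneg fun c _ => (key c).1] at hsum
  funext c
  exact (key c).2 (hsum c (Finset.mem_univ c))

/-- Exponential moment (Chernoff) lemma. -/
lemma chernoff {q : γ → ℝ} (hq : IsPMF q) (r : γ → ℝ) (hr : ∀ c, q c ≠ 0 → 0 < r c)
    (hneg : ∑ c, q c * Real.log (r c) < 0) :
    ∃ θ : ℝ, 0 < θ ∧ θ ≤ 1 ∧ ∑ c, q c * r c ^ θ < 1 := by
  obtain ⟨Bd, hB1, hB⟩ : ∃ Bd : ℝ, 1 ≤ Bd ∧ ∀ c, |Real.log (r c)| ≤ Bd := by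
    refine ⟨1 + ∑ c, |Real.log (r c)|, ?_, fun c => ?_⟩
    · have : 0 ≤ ∑ c, |Real.log (r c)| := Finset.sum_nonneg fun c _ => abs_nonneg _
      linarith
    · have := Finset.single_le_sum (f := fun c => |Real.log (r c)|)
        (fun c _ => abs_nonneg _) (Finset.mem_univ c)
      linarith
  set m := ∑ c, q c * Real.log (r c) with hm
  have hB0 : 0 < Bd := by linarith
  set θ := min (1 / Bd) (-m / (2 * Bd ^ 2)) with hθ
  have hθ0 : 0 < θ := lt_min (by positivity) (div_pos (by linarith) (by positivity))
  have hθ1 : θ * Bd ≤ 1 := by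
    have : θ ≤ 1 / Bd := min_le_left _ _
    calc θ * Bd ≤ 1 / Bd * Bd := by gcongr
      _ = 1 := by field_simp
  have hθ2 : θ * Bd ^ 2 ≤ -m / 2 := by
    have : θ ≤ -m / (2 * Bd ^ 2) := min_le_right _ _
    calc θ * Bd ^ 2 ≤ -m / (2 * Bd ^ 2) * Bd ^ 2 := by gcongr
      _ = -m / 2 := by field_simp
  refine ⟨θ, hθ0, ?_, ?_⟩
  · nlinarith
  · have hterm : ∀ c, q c * r c ^ θ ≤ q c * 1 + θ * (q c * Real.log (r c)) +
        θ ^ 2 * Bd ^ 2 * q c := by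
      intro c
      by_cases hc : q c = 0
      · simp [hc]
      · have hrc := hr c hc
        have hqc := hq.1 c
        rw [Real.rpow_def_of_pos hrc]
        set l := Real.log (r c)
        have hl : |l * θ| ≤ θ * Bd := by
          rw [abs_mul, abs_of_pos hθ0, mul_comm]
          exact mul_le_mul_of_nonneg_left (hB c) hθ0.le
        have h1 := Real.abs_exp_sub_one_sub_id_le (x := l * θ) (hl.trans hθ1)
        have h2 := (abs_le.1 h1).2
        have h3 : (l * θ) ^ 2 ≤ (θ * Bd) ^ 2 := sq_le_sq' (abs_le.1 hl).1 (abs_le.1 hl).2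
        have h4 : Real.exp (l * θ) ≤ 1 + l * θ + (θ * Bd) ^ 2 := by linarith
        have := mul_le_mul_of_nonneg_left h4 hqc
        nlinarith
    have h7 := Finset.sum_le_sum (s := Finset.univ) fun c _ => hterm c
    rw [Finset.sum_add_distrib, Finset.sum_add_distrib, ← Finset.mul_sum, ← Finset.mul_sum,
      ← hm] at h7
    simp only [mul_one, hq.2] at h7
    nlinarith

/-- A weighted average dominates some value. -/
lemma exists_le_of_avg {q : γ → ℝ} (hq : IsPMF q) (Φ : γ → ℝ) {c : ℝ}
    (h : ∑ x, q x * Φ x ≤ c) : ∃ x, Φ x ≤ c := by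
  by_contra hcon
  push Not at hcon
  obtain ⟨x0, hx0⟩ : ∃ x, q x ≠ 0 := by
    by_contra h0
    push Not at h0
    have := hq.2
    simp [h0] at this
  have : ∑ x, q x * c < ∑ x, q x * Φ x := by
    refine Finset.sum_lt_sum (fun x _ => mul_le_mul_of_nonneg_left (hcon x).le (hq.1 x)) ⟨x0, Finset.mem_univ _, ?_⟩
    exact mul_lt_mul_of_pos_left (hcon x0) (lt_of_le_of_ne (hq.1 x0) (Ne.symm hx0))
  rw [← Finset.sum_mul, hq.2] at this
  linarith

end Basics

/-! ### Random superposition codebooks -/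

section Codebook

lemma prodw_single {Γ : Type} [Fintype Γ] {N : ℕ} {r : Γ → ℝ} (hr : ∑ x, r x = 1)
    (F : Γ → ℝ) (i0 : Fin N) :
    ∑ ω : Fin N → Γ, (∏ i, r (ω i)) * F (ω i0) = ∑ x, r x * F x := by
  have h1 : ∀ ω : Fin N → Γ, (∏ i, r (ω i)) * F (ω i0) =
      ∏ i, (r (ω i) * (if i = i0 then F (ω i) else 1)) := by
    intro ω
    rw [Finset.prod_mul_distrib]
    simp
  simp only [h1]
  rw [← Fintype.prod_sum (fun i x => r x * (if i = i0 then F x else 1))]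
  have h2 : ∀ i, ∑ x, r x * (if i = i0 then F x else 1) =
      if i = i0 then ∑ x, r x * F x else 1 := by
    intro i
    split_ifs <;> simp [hr]
  simp only [h2]
  simp

lemma prodw_pair {Γ : Type} [Fintype Γ] {N : ℕ} {r : Γ → ℝ} (hr : ∑ x, r x = 1)
    (F G : Γ → ℝ) {i0 i1 : Fin N} (hne : i0 ≠ i1) :
    ∑ ω : Fin N → Γ, (∏ i, r (ω i)) * (F (ω i0) * G (ω i1)) =
      (∑ x, r x * F x) * (∑ x, r x * G x) := by
  have h1 : ∀ ω : Fin N → Γ, (∏ i, r (ω i)) * (F (ω i0) * G (ω i1)) =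
      ∏ i, (r (ω i) * ((if i = i0 then F (ω i) else 1) * (if i = i1 then G (ω i) else 1))) := by
    intro ω
    rw [Finset.prod_mul_distrib, Finset.prod_mul_distrib]
    simp
  simp only [h1]
  rw [← Fintype.prod_sum
    (fun i x => r x * ((if i = i0 then F x else 1) * (if i = i1 then G x else 1)))]
  have h2 : ∀ i, ∑ x, r x * ((if i = i0 then F x else 1) * (if i = i1 then G x else 1)) =
      (if i = i0 then ∑ x, r x * F x else 1) * (if i = i1 then ∑ x, r x * G x else 1) := by
    intro i
    by_cases h : i = i0
    · have : i ≠ i1 := fun h' => hne (h.symm.trans h')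
      simp [h, hne]
    · by_cases h' : i = i1 <;> simp [h, h', hr, Ne.symm hne]
  simp only [h2]
  rw [Finset.prod_mul_distrib]
  simp

variable {U V : Type} [Fintype U] [Fintype V]

/-- expectation over a single pair of codewords -/
noncomputable def EC (pU : U → ℝ) (pV : U → V → ℝ) (f : U → V → ℝ) : ℝ :=
  ∑ u, ∑ v, pU u * pV u v * f u v

/-- the weight of one row of the codebook -/
noncomputable def rowW (pU : U → ℝ) (pV : U → V → ℝ) {N2 : ℕ} (c : U × (Fin N2 → V)) : ℝ :=
  pU c.1 * ∏ j, pV c.1 (c.2 j)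

/-- the weight of a codebook -/
noncomputable def cw (pU : U → ℝ) (pV : U → V → ℝ) {N1 N2 : ℕ}
    (ω : Fin N1 → U × (Fin N2 → V)) : ℝ := ∏ i, rowW pU pV (ω i)

variable {pU : U → ℝ} {pV : U → V → ℝ}

lemma EC_mono (hU : IsPMF pU) (hV : IsKernel pV) {f g : U → V → ℝ}
    (h : ∀ u v, pU u ≠ 0 → pV u v ≠ 0 → f u v ≤ g u v) : EC pU pV f ≤ EC pU pV g := by
  refine Finset.sum_le_sum fun u _ => Finset.sum_le_sum fun v _ => ?_
  by_cases h1 : pU u = 0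
  · simp [h1]
  by_cases h2 : pV u v = 0
  · simp [h2]
  exact mul_le_mul_of_nonneg_left (h u v h1 h2) (mul_nonneg (hU.1 u) ((hV u).1 v))

lemma EC_nonneg (hU : IsPMF pU) (hV : IsKernel pV) {f : U → V → ℝ}
    (h : ∀ u v, 0 ≤ f u v) : 0 ≤ EC pU pV f :=
  Finset.sum_nonneg fun u _ => Finset.sum_nonneg fun v _ =>
    mul_nonneg (mul_nonneg (hU.1 u) ((hV u).1 v)) (h u v)

lemma EC_add (f g : U → V → ℝ) :
    EC pU pV (fun u v => f u v + g u v) = EC pU pV f + EC pU pV g := by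
  simp only [EC, mul_add, Finset.sum_add_distrib]

lemma EC_sub (f g : U → V → ℝ) :
    EC pU pV (fun u v => f u v - g u v) = EC pU pV f - EC pU pV g := by
  simp only [EC, mul_sub, Finset.sum_sub_distrib]

lemma EC_smul (c : ℝ) (f : U → V → ℝ) :
    EC pU pV (fun u v => c * f u v) = c * EC pU pV f := by
  simp only [EC, Finset.mul_sum]
  refine Finset.sum_congr rfl fun u _ => Finset.sum_congr rfl fun v _ => ?_
  ring

lemma EC_mul_const (c : ℝ) (f : U → V → ℝ) :
    EC pU pV (fun u v => f u v * c) = EC pU pV f * c := by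
  rw [mul_comm, ← EC_smul]
  simp only [mul_comm]

lemma EC_sum {ι : Type} (s : Finset ι) (f : ι → U → V → ℝ) :
    EC pU pV (fun u v => ∑ i ∈ s, f i u v) = ∑ i ∈ s, EC pU pV (f i) := by
  simp only [EC, Finset.mul_sum]
  simp_rw [Finset.sum_comm (t := s)]

lemma rowW_nonneg (hU : IsPMF pU) (hV : IsKernel pV) {N2 : ℕ} (c : U × (Fin N2 → V)) :
    0 ≤ rowW pU pV c :=
  mul_nonneg (hU.1 _) (Finset.prod_nonneg fun _ _ => (hV _).1 _)

lemma sum_row (hV : IsKernel pV) {N2 : ℕ} (u : U) :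
    ∑ f : Fin N2 → V, ∏ j, pV u (f j) = 1 := by
  rw [← Fintype.prod_sum (fun _ x => pV u x)]
  simp [(hV u).2]

lemma rowW_sum (hU : IsPMF pU) (hV : IsKernel pV) {N2 : ℕ} :
    ∑ c : U × (Fin N2 → V), rowW pU pV c = 1 := by
  rw [Fintype.sum_prod_type]
  simp only [rowW, ← Finset.mul_sum, sum_row hV, mul_one, hU.2]

lemma cw_isPMF (hU : IsPMF pU) (hV : IsKernel pV) {N1 N2 : ℕ} :
    IsPMF (cw (N1 := N1) (N2 := N2) pU pV) := by
  refine ⟨fun ω => Finset.prod_nonneg fun i _ => rowW_nonneg hU hV _, ?_⟩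
  unfold cw
  rw [← Fintype.prod_sum (fun _ x => rowW pU pV x)]
  simp [rowW_sum hU hV]

lemma row_single (hV : IsKernel pV) {N2 : ℕ} (j : Fin N2) (f : U → V → ℝ) :
    ∑ c : U × (Fin N2 → V), rowW pU pV c * f c.1 (c.2 j) = EC pU pV f := by
  rw [Fintype.sum_prod_type]
  unfold EC
  refine Finset.sum_congr rfl fun u _ => ?_
  have := prodw_single (hV u).2 (fun v => f u v) j
  simp only [rowW, mul_assoc, ← Finset.mul_sum]
  rw [this]

lemma row_pair (hV : IsKernel pV) {N2 : ℕ} {j j' : Fin N2} (hne : j ≠ j') (f g : U → V → ℝ) :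
    ∑ c : U × (Fin N2 → V), rowW pU pV c * (f c.1 (c.2 j) * g c.1 (c.2 j')) =
      EC pU pV (fun u v => f u v * ∑ v', pV u v' * g u v') := by
  rw [Fintype.sum_prod_type]
  unfold EC
  refine Finset.sum_congr rfl fun u _ => ?_
  have := prodw_pair (hV u).2 (fun v => f u v) (fun v => g u v) hne
  simp only [rowW, mul_assoc, ← Finset.mul_sum]
  rw [this]
  simp only [← mul_assoc, ← Finset.sum_mul]

lemma E_same (hU : IsPMF pU) (hV : IsKernel pV) {N1 N2 : ℕ} (i : Fin N1) (j : Fin N2)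
    (f : U → V → ℝ) :
    ∑ ω : Fin N1 → U × (Fin N2 → V), cw pU pV ω * f (ω i).1 ((ω i).2 j) = EC pU pV f := by
  unfold cw
  rw [prodw_single (rowW_sum hU hV) (fun c => f c.1 (c.2 j)) i, row_single hV]

lemma E_row (hU : IsPMF pU) (hV : IsKernel pV) {N1 N2 : ℕ} (i : Fin N1) {j j' : Fin N2}
    (hne : j ≠ j') (f g : U → V → ℝ) :
    ∑ ω : Fin N1 → U × (Fin N2 → V), cw pU pV ω *
      (f (ω i).1 ((ω i).2 j) * g (ω i).1 ((ω i).2 j')) =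
      EC pU pV (fun u v => f u v * ∑ v', pV u v' * g u v') := by
  unfold cw
  rw [prodw_single (rowW_sum hU hV) (fun c => f c.1 (c.2 j) * g c.1 (c.2 j')) i,
    row_pair hV hne]

lemma E_diff (hU : IsPMF pU) (hV : IsKernel pV) {N1 N2 : ℕ} {i i' : Fin N1} (j j' : Fin N2)
    (hne : i ≠ i') (f g : U → V → ℝ) :
    ∑ ω : Fin N1 → U × (Fin N2 → V), cw pU pV ω *
      (f (ω i).1 ((ω i).2 j) * g (ω i').1 ((ω i').2 j')) = EC pU pV f * EC pU pV g := by
  unfold cw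
  rw [prodw_pair (rowW_sum hU hV) (fun c => f c.1 (c.2 j)) (fun c => g c.1 (c.2 j')) hne,
    row_single hV, row_single hV]

/-- the two-level self-plus-background bound -/
lemma E_lin (hU : IsPMF pU) (hV : IsKernel pV) {N1 N2 : ℕ} (i : Fin N1) (j : Fin N2)
    (ψ g : U → V → ℝ) (hψ : ∀ u v, 0 ≤ ψ u v) (hg : ∀ u v, 0 ≤ g u v) :
    ∑ ω : Fin N1 → U × (Fin N2 → V), cw pU pV ω * (ψ (ω i).1 ((ω i).2 j) *
      (((N1 : ℝ) * N2)⁻¹ * ∑ i', ∑ j', g (ω i').1 ((ω i').2 j'))) ≤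
    EC pU pV (fun u v => ψ u v *
      (g u v / (N1 * N2) + (∑ v', pV u v' * g u v') / N1 + EC pU pV g)) := by
  have hN1 : (0 : ℝ) < N1 := by exact_mod_cast (Fin.pos i)
  have hN2 : (0 : ℝ) < N2 := by exact_mod_cast (Fin.pos j)
  have hgb : ∀ u, 0 ≤ ∑ v', pV u v' * g u v' := fun u =>
    Finset.sum_nonneg fun v _ => mul_nonneg ((hV u).1 v) (hg u v)
  set a := EC pU pV (fun u v => ψ u v * g u v) with ha
  set b := EC pU pV (fun u v => ψ u v * ∑ v', pV u v' * g u v') with hb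
  set c := EC pU pV ψ * EC pU pV g with hc
  have ha0 : 0 ≤ a := EC_nonneg hU hV fun u v => mul_nonneg (hψ u v) (hg u v)
  have hb0 : 0 ≤ b := EC_nonneg hU hV fun u v => mul_nonneg (hψ u v) (hgb u)
  have hc0 : 0 ≤ c := mul_nonneg (EC_nonneg hU hV hψ) (EC_nonneg hU hV hg)
  have key : ∀ i' j', ∑ ω : Fin N1 → U × (Fin N2 → V), cw pU pV ω *
      (ψ (ω i).1 ((ω i).2 j) * g (ω i').1 ((ω i').2 j')) ≤
      (if i' = i then (if j' = j then a else 0) else 0) + (if i' = i then b else 0) + c := by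
    intro i' j'
    by_cases h1 : i' = i
    · subst h1
      by_cases h2 : j' = j
      · subst h2
        have := E_same hU hV i' j' (fun u v => ψ u v * g u v)
        simp only [if_true]
        rw [this]
        linarith
      · rw [E_row hU hV i' (Ne.symm h2)]
        simp [h2]
        linarith
    · rw [E_diff hU hV j j' (Ne.symm h1)]
      simp [h1, hc]
  have lhs : ∑ ω : Fin N1 → U × (Fin N2 → V), cw pU pV ω * (ψ (ω i).1 ((ω i).2 j) *
      (((N1 : ℝ) * N2)⁻¹ * ∑ i', ∑ j', g (ω i').1 ((ω i').2 j'))) =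
      ((N1 : ℝ) * N2)⁻¹ * ∑ i', ∑ j', ∑ ω : Fin N1 → U × (Fin N2 → V), cw pU pV ω *
      (ψ (ω i).1 ((ω i).2 j) * g (ω i').1 ((ω i').2 j')) := by
    rw [Finset.mul_sum]
    simp_rw [Finset.mul_sum]
    rw [Finset.sum_comm]
    refine Finset.sum_congr rfl fun i' _ => ?_
    rw [Finset.sum_comm]
    refine Finset.sum_congr rfl fun j' _ => Finset.sum_congr rfl fun ω _ => ?_
    ring
  rw [lhs]
  have h3 : ∑ i', ∑ j', ∑ ω : Fin N1 → U × (Fin N2 → V), cw pU pV ω *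
      (ψ (ω i).1 ((ω i).2 j) * g (ω i').1 ((ω i').2 j')) ≤ a + N2 * b + N1 * N2 * c := by
    refine (Finset.sum_le_sum fun i' _ => Finset.sum_le_sum fun j' _ => key i' j').trans
      (le_of_eq ?_)
    simp only [Finset.sum_add_distrib]
    simp [mul_assoc, Finset.sum_ite_eq']
  have h4 : EC pU pV (fun u v => ψ u v *
      (g u v / (N1 * N2) + (∑ v', pV u v' * g u v') / N1 + EC pU pV g)) =
      ((N1 : ℝ) * N2)⁻¹ * (a + N2 * b + N1 * N2 * c) := by
    have : ∀ u v, ψ u v *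
      (g u v / (N1 * N2) + (∑ v', pV u v' * g u v') / N1 + EC pU pV g) =
      ((N1 : ℝ) * N2)⁻¹ * (ψ u v * g u v) + (N1 : ℝ)⁻¹ * (ψ u v * ∑ v', pV u v' * g u v') +
      ψ u v * EC pU pV g := by
      intro u v
      field_simp
    simp only [this]
    rw [EC_add, EC_add, EC_smul, EC_smul, EC_mul_const, ← ha, ← hb, ← hc]
    field_simp
  rw [h4]
  exact mul_le_mul_of_nonneg_left h3 (by positivity)

/-- the one-level self-plus-background bound -/
lemma E_lin_row (hU : IsPMF pU) (hV : IsKernel pV) {N1 N2 : ℕ} (i : Fin N1) (j : Fin N2)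
    (ψ g : U → V → ℝ) (hψ : ∀ u v, 0 ≤ ψ u v) (hg : ∀ u v, 0 ≤ g u v) :
    ∑ ω : Fin N1 → U × (Fin N2 → V), cw pU pV ω * (ψ (ω i).1 ((ω i).2 j) *
      ((N2 : ℝ)⁻¹ * ∑ j', g (ω i).1 ((ω i).2 j'))) ≤
    EC pU pV (fun u v => ψ u v * (g u v / N2 + ∑ v', pV u v' * g u v')) := by
  have hN2 : (0 : ℝ) < N2 := by exact_mod_cast (Fin.pos j)
  have hgb : ∀ u, 0 ≤ ∑ v', pV u v' * g u v' := fun u =>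
    Finset.sum_nonneg fun v _ => mul_nonneg ((hV u).1 v) (hg u v)
  set a := EC pU pV (fun u v => ψ u v * g u v) with ha
  set b := EC pU pV (fun u v => ψ u v * ∑ v', pV u v' * g u v') with hb
  have ha0 : 0 ≤ a := EC_nonneg hU hV fun u v => mul_nonneg (hψ u v) (hg u v)
  have hb0 : 0 ≤ b := EC_nonneg hU hV fun u v => mul_nonneg (hψ u v) (hgb u)
  have key : ∀ j', ∑ ω : Fin N1 → U × (Fin N2 → V), cw pU pV ω *
      (ψ (ω i).1 ((ω i).2 j) * g (ω i).1 ((ω i).2 j')) ≤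
      (if j' = j then a else 0) + b := by
    intro j'
    by_cases h2 : j' = j
    · subst h2
      have := E_same hU hV i j' (fun u v => ψ u v * g u v)
      simp only [if_true]
      rw [this]
      linarith
    · rw [E_row hU hV i (Ne.symm h2)]
      simp [h2]
      linarith
  have lhs : ∑ ω : Fin N1 → U × (Fin N2 → V), cw pU pV ω * (ψ (ω i).1 ((ω i).2 j) *
      ((N2 : ℝ)⁻¹ * ∑ j', g (ω i).1 ((ω i).2 j'))) =
      (N2 : ℝ)⁻¹ * ∑ j', ∑ ω : Fin N1 → U × (Fin N2 → V), cw pU pV ω *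
      (ψ (ω i).1 ((ω i).2 j) * g (ω i).1 ((ω i).2 j')) := by
    rw [Finset.mul_sum]
    simp_rw [Finset.mul_sum]
    rw [Finset.sum_comm]
    refine Finset.sum_congr rfl fun j' _ => Finset.sum_congr rfl fun ω _ => ?_
    ring
  rw [lhs]
  have h3 : ∑ j', ∑ ω : Fin N1 → U × (Fin N2 → V), cw pU pV ω *
      (ψ (ω i).1 ((ω i).2 j) * g (ω i).1 ((ω i).2 j')) ≤ a + N2 * b := by
    refine (Finset.sum_le_sum fun j' _ => key j').trans (le_of_eq ?_)
    simp only [Finset.sum_add_distrib]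
    simp
  have h4 : EC pU pV (fun u v => ψ u v * (g u v / N2 + ∑ v', pV u v' * g u v')) =
      (N2 : ℝ)⁻¹ * (a + N2 * b) := by
    have : ∀ u v, ψ u v * (g u v / N2 + ∑ v', pV u v' * g u v') =
      (N2 : ℝ)⁻¹ * (ψ u v * g u v) + (ψ u v * ∑ v', pV u v' * g u v') := by
      intro u v
      field_simp
    simp only [this]
    rw [EC_add, EC_smul, ← ha, ← hb]
    field_simp
  rw [h4]
  exact mul_le_mul_of_nonneg_left h3 (by positivity)

end Codebook

/-! ### One-shot Jensen bounds -/

section OneShot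

variable {U V W : Type} [Fintype U] [Fintype V] [Fintype W]
variable {pU : U → ℝ} {pV : U → V → ℝ}

/-- output law given the cloud centre -/
noncomputable def m1 (pV : U → V → ℝ) (T : U → V → W → ℝ) (u : U) (w : W) : ℝ :=
  ∑ v, pV u v * T u v w

/-- output law -/
noncomputable def m0 (pU : U → ℝ) (pV : U → V → ℝ) (T : U → V → W → ℝ) (w : W) : ℝ :=
  EC pU pV (fun u v => T u v w)

/-- joint expectation over codeword and output -/
noncomputable def EX (pU : U → ℝ) (pV : U → V → ℝ) (T f : U → V → W → ℝ) : ℝ :=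
  ∑ w, EC pU pV (fun u v => T u v w * f u v w)

/-- codebook output law -/
noncomputable def Qc {N1 N2 : ℕ} (T : U → V → W → ℝ) (ω : Fin N1 → U × (Fin N2 → V)) (w : W) : ℝ :=
  ((N1 : ℝ) * N2)⁻¹ * ∑ i, ∑ j, T (ω i).1 ((ω i).2 j) w

lemma m1_nonneg (hV : IsKernel pV) {T : U → V → W → ℝ} (hT : ∀ u v w, 0 ≤ T u v w) (u : U) (w : W) :
    0 ≤ m1 pV T u w := Finset.sum_nonneg fun v _ => mul_nonneg ((hV u).1 v) (hT u v w)

lemma m0_nonneg (hU : IsPMF pU) (hV : IsKernel pV) {T : U → V → W → ℝ}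
    (hT : ∀ u v w, 0 ≤ T u v w) (w : W) : 0 ≤ m0 pU pV T w :=
  EC_nonneg hU hV fun u v => hT u v w

lemma m1_ge (hV : IsKernel pV) {T : U → V → W → ℝ} (hT : ∀ u v w, 0 ≤ T u v w)
    (u : U) (v : V) (w : W) : pV u v * T u v w ≤ m1 pV T u w :=
  Finset.single_le_sum (f := fun v => pV u v * T u v w)
    (fun v _ => mul_nonneg ((hV u).1 v) (hT u v w)) (Finset.mem_univ v)

lemma m0_eq (T : U → V → W → ℝ) (w : W) : m0 pU pV T w = ∑ u, pU u * m1 pV T u w := by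
  simp only [m0, EC, m1, Finset.mul_sum, mul_assoc]

lemma m0_ge (hU : IsPMF pU) (hV : IsKernel pV) {T : U → V → W → ℝ} (hT : ∀ u v w, 0 ≤ T u v w)
    (u : U) (w : W) : pU u * m1 pV T u w ≤ m0 pU pV T w := by
  rw [m0_eq]
  exact Finset.single_le_sum (f := fun u => pU u * m1 pV T u w)
    (fun u _ => mul_nonneg (hU.1 u) (m1_nonneg hV hT u w)) (Finset.mem_univ u)

lemma pos_of_supp (hU : IsPMF pU) (hV : IsKernel pV) {T : U → V → W → ℝ}
    (hT : ∀ u v w, 0 ≤ T u v w) {u : U} {v : V} {w : W} (h1 : pU u ≠ 0) (h2 : pV u v ≠ 0)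
    (h3 : T u v w ≠ 0) : 0 < T u v w ∧ 0 < m1 pV T u w ∧ 0 < m0 pU pV T w := by
  have a1 : 0 < pU u := lt_of_le_of_ne (hU.1 u) (Ne.symm h1)
  have a2 : 0 < pV u v := lt_of_le_of_ne ((hV u).1 v) (Ne.symm h2)
  have a3 : 0 < T u v w := lt_of_le_of_ne (hT u v w) (Ne.symm h3)
  have a4 := lt_of_lt_of_le (mul_pos a2 a3) (m1_ge hV hT u v w)
  exact ⟨a3, a4, lt_of_lt_of_le (mul_pos a1 a4) (m0_ge hU hV hT u w)⟩

lemma EC_const (hU : IsPMF pU) (hV : IsKernel pV) (c : ℝ) : EC pU pV (fun _ _ => c) = c := by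
  simp only [EC, ← Finset.sum_mul, ← Finset.mul_sum, (hV _).2, mul_one, hU.2, one_mul]

lemma EX_one (hU : IsPMF pU) (hV : IsKernel pV) {T : U → V → W → ℝ} (hT1 : ∀ u v, ∑ w, T u v w = 1) :
    EX pU pV T (fun _ _ _ => 1) = 1 := by
  simp only [EX, mul_one]
  rw [← EC_sum]
  simp only [hT1, EC_const hU hV]

lemma EX_mono (hU : IsPMF pU) (hV : IsKernel pV) {T f g : U → V → W → ℝ}
    (hT : ∀ u v w, 0 ≤ T u v w)
    (h : ∀ u v w, pU u ≠ 0 → pV u v ≠ 0 → T u v w ≠ 0 → f u v w ≤ g u v w) :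
    EX pU pV T f ≤ EX pU pV T g := by
  refine Finset.sum_le_sum fun w _ => EC_mono hU hV fun u v h1 h2 => ?_
  by_cases h3 : T u v w = 0
  · simp [h3]
  · exact mul_le_mul_of_nonneg_left (h u v w h1 h2 h3) (hT u v w)

lemma EX_add (T f g : U → V → W → ℝ) :
    EX pU pV T (fun u v w => f u v w + g u v w) = EX pU pV T f + EX pU pV T g := by
  simp only [EX, mul_add, EC_add, Finset.sum_add_distrib]

lemma EX_sub (T f g : U → V → W → ℝ) :
    EX pU pV T (fun u v w => f u v w - g u v w) = EX pU pV T f - EX pU pV T g := by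
  simp only [EX, mul_sub, EC_sub, Finset.sum_sub_distrib]

lemma EX_smul (c : ℝ) (T f : U → V → W → ℝ) :
    EX pU pV T (fun u v w => c * f u v w) = c * EX pU pV T f := by
  simp only [EX, mul_left_comm _ c, EC_smul, Finset.mul_sum]

lemma E_inv (hU : IsPMF pU) (hV : IsKernel pV) {N1 N2 : ℕ} (i : Fin N1) (j : Fin N2)
    (g h : U → V → ℝ) (hg : ∀ u v, 0 ≤ g u v) (hh : ∀ u v, 0 ≤ h u v) (α : ℝ) (hα : 0 ≤ α) :
    EC pU pV (fun u v => g u v * h u v /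
      (α + (g u v / (N1 * N2) + (∑ v', pV u v' * g u v') / N1 + EC pU pV g))) ≤
    ∑ ω : Fin N1 → U × (Fin N2 → V), cw pU pV ω *
      (g (ω i).1 ((ω i).2 j) * h (ω i).1 ((ω i).2 j) /
        (α + ((N1 : ℝ) * N2)⁻¹ * ∑ i', ∑ j', g (ω i').1 ((ω i').2 j'))) := by
  have hN1 : (0 : ℝ) < N1 := by exact_mod_cast (Fin.pos i)
  have hN2 : (0 : ℝ) < N2 := by exact_mod_cast (Fin.pos j)
  set st : U → V → ℝ := fun u v =>
    g u v / (N1 * N2) + (∑ v', pV u v' * g u v') / N1 + EC pU pV g with hst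
  have hst_ge : ∀ u v, g u v / (N1 * N2) ≤ st u v := by
    intro u v
    have h1 : 0 ≤ ∑ v', pV u v' * g u v' :=
      Finset.sum_nonneg fun v _ => mul_nonneg ((hV u).1 v) (hg u v)
    have h2 : 0 ≤ (∑ v', pV u v' * g u v') / N1 := div_nonneg h1 hN1.le
    have h3 : 0 ≤ EC pU pV g := EC_nonneg hU hV hg
    simp only [hst]
    linarith
  have hst0 : ∀ u v, 0 ≤ st u v := fun u v =>
    (div_nonneg (hg u v) (by positivity)).trans (hst_ge u v)
  set ψ : U → V → ℝ := fun u v => g u v * h u v / (α + st u v) ^ 2 with hψ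
  set φ : U → V → ℝ := fun u v => g u v * h u v * (2 / (α + st u v) - α / (α + st u v) ^ 2) with hφ
  have hψ0 : ∀ u v, 0 ≤ ψ u v := fun u v =>
    div_nonneg (mul_nonneg (hg u v) (hh u v)) (sq_nonneg _)
  have hlin := E_lin hU hV i j ψ g hψ0 hg
  have hsame := E_same (N1 := N1) (N2 := N2) hU hV i j φ
  have hpt : ∀ ω : Fin N1 → U × (Fin N2 → V),
      φ (ω i).1 ((ω i).2 j) - ψ (ω i).1 ((ω i).2 j) *
        (((N1 : ℝ) * N2)⁻¹ * ∑ i', ∑ j', g (ω i').1 ((ω i').2 j')) ≤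
      g (ω i).1 ((ω i).2 j) * h (ω i).1 ((ω i).2 j) /
        (α + ((N1 : ℝ) * N2)⁻¹ * ∑ i', ∑ j', g (ω i').1 ((ω i').2 j')) := by
    intro ω
    set u := (ω i).1
    set v := (ω i).2 j
    set S := ((N1 : ℝ) * N2)⁻¹ * ∑ i', ∑ j', g (ω i').1 ((ω i').2 j') with hS
    by_cases hz : g u v = 0
    · simp [hφ, hψ, hz]
    have hgp : 0 < g u v := lt_of_le_of_ne (hg u v) (Ne.symm hz)
    have hSpos : 0 < S := by
      apply mul_pos (by positivity)
      have h1 : g u v ≤ ∑ j', g (ω i).1 ((ω i).2 j') :=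
        Finset.single_le_sum (f := fun j' => g (ω i).1 ((ω i).2 j'))
          (fun _ _ => hg _ _) (Finset.mem_univ j)
      have h2 : ∑ j', g (ω i).1 ((ω i).2 j') ≤ ∑ i', ∑ j', g (ω i').1 ((ω i').2 j') :=
        Finset.single_le_sum (f := fun i' => ∑ j', g (ω i').1 ((ω i').2 j'))
          (fun _ _ => Finset.sum_nonneg fun _ _ => hg _ _) (Finset.mem_univ i)
      linarith
    have hstp : 0 < st u v := lt_of_lt_of_le (div_pos hgp (by positivity)) (hst_ge u v)
    have hX : 0 < α + S := by linarith
    have hY : 0 < α + st u v := by linarith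
    have hkey : 2 / (α + st u v) - (α + S) / (α + st u v) ^ 2 ≤ 1 / (α + S) := by
      rw [← sub_nonneg]
      have : 1 / (α + S) - (2 / (α + st u v) - (α + S) / (α + st u v) ^ 2) =
        ((α + st u v) - (α + S)) ^ 2 / ((α + S) * (α + st u v) ^ 2) := by
        field_simp
        ring
      rw [this]
      positivity
    have h6 := mul_le_mul_of_nonneg_left hkey (mul_nonneg hgp.le (hh u v))
    calc _ = g u v * h u v * (2 / (α + st u v) - (α + S) / (α + st u v) ^ 2) := by
          simp only [hφ, hψ]; ring
      _ ≤ _ := h6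
      _ = _ := by ring
  have h7 : ∑ ω : Fin N1 → U × (Fin N2 → V), cw pU pV ω *
      (φ (ω i).1 ((ω i).2 j) - ψ (ω i).1 ((ω i).2 j) *
        (((N1 : ℝ) * N2)⁻¹ * ∑ i', ∑ j', g (ω i').1 ((ω i').2 j'))) ≤ _ :=
    Finset.sum_le_sum fun ω _ => mul_le_mul_of_nonneg_left (hpt ω) ((cw_isPMF hU hV).1 ω)
  refine le_trans ?_ h7
  simp only [mul_sub (cw pU pV _), Finset.sum_sub_distrib]
  rw [hsame]
  refine le_trans (le_of_eq ?_) (sub_le_sub_left hlin _)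
  rw [← EC_sub]
  congr 1
  funext u v
  change _ = φ u v - ψ u v * st u v
  change g u v * h u v / (α + st u v) = _
  by_cases hz : α + st u v = 0
  · simp [hφ, hψ, hz]
  · simp only [hφ, hψ]
    field_simp
    ring

lemma E_log_row (hU : IsPMF pU) (hV : IsKernel pV) {N1 N2 : ℕ} (i : Fin N1) (j : Fin N2)
    (g : U → V → ℝ) (hg : ∀ u v, 0 ≤ g u v) :
    ∑ ω : Fin N1 → U × (Fin N2 → V), cw pU pV ω *
      (g (ω i).1 ((ω i).2 j) * Real.log ((N2 : ℝ)⁻¹ * ∑ j', g (ω i).1 ((ω i).2 j'))) ≤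
    EC pU pV (fun u v => g u v * Real.log (g u v / N2 + ∑ v', pV u v' * g u v')) := by
  have hN2 : (0 : ℝ) < N2 := by exact_mod_cast (Fin.pos j)
  set st : U → V → ℝ := fun u v => g u v / N2 + ∑ v', pV u v' * g u v' with hst
  have hst_ge : ∀ u v, g u v / N2 ≤ st u v := by
    intro u v
    have h1 : 0 ≤ ∑ v', pV u v' * g u v' :=
      Finset.sum_nonneg fun v _ => mul_nonneg ((hV u).1 v) (hg u v)
    simp only [hst]
    linarith
  have hst0 : ∀ u v, 0 ≤ st u v := fun u v =>
    (div_nonneg (hg u v) (by positivity)).trans (hst_ge u v)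
  set ψ : U → V → ℝ := fun u v => g u v / st u v with hψ
  set φ : U → V → ℝ := fun u v => g u v * (Real.log (st u v) - 1) with hφ
  have hlin := E_lin_row hU hV i j ψ g (fun u v => div_nonneg (hg u v) (hst0 u v)) hg
  have hsame := E_same (N1 := N1) (N2 := N2) hU hV i j φ
  have hpt : ∀ ω : Fin N1 → U × (Fin N2 → V),
      g (ω i).1 ((ω i).2 j) * Real.log ((N2 : ℝ)⁻¹ * ∑ j', g (ω i).1 ((ω i).2 j')) ≤
      φ (ω i).1 ((ω i).2 j) + ψ (ω i).1 ((ω i).2 j) *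
        ((N2 : ℝ)⁻¹ * ∑ j', g (ω i).1 ((ω i).2 j')) := by
    intro ω
    set u := (ω i).1 with hu
    set v := (ω i).2 j with hv
    set S := (N2 : ℝ)⁻¹ * ∑ j', g u ((ω i).2 j') with hS
    by_cases hz : g u v = 0
    · simp [hφ, hψ, hz]
    have hgp : 0 < g u v := lt_of_le_of_ne (hg u v) (Ne.symm hz)
    have hSpos : 0 < S := by
      apply mul_pos (by positivity)
      have h1 : g u v ≤ ∑ j', g u ((ω i).2 j') :=
        Finset.single_le_sum (f := fun j' => g u ((ω i).2 j'))
          (fun _ _ => hg _ _) (Finset.mem_univ j)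
      linarith
    have hstp : 0 < st u v := lt_of_lt_of_le (div_pos hgp (by positivity)) (hst_ge u v)
    have h3 := Real.log_le_sub_one_of_pos (div_pos hSpos hstp)
    rw [Real.log_div hSpos.ne' hstp.ne'] at h3
    have h4 : Real.log S ≤ Real.log (st u v) - 1 + S / st u v := by linarith
    have h5 := mul_le_mul_of_nonneg_left h4 hgp.le
    refine h5.trans (le_of_eq ?_)
    simp only [hφ, hψ]
    ring
  have h7 := Finset.sum_le_sum (s := Finset.univ) fun (ω : Fin N1 → U × (Fin N2 → V)) _ =>
    mul_le_mul_of_nonneg_left (hpt ω) ((cw_isPMF hU hV).1 ω)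
  refine h7.trans ?_
  simp only [mul_add (cw pU pV _), Finset.sum_add_distrib]
  rw [hsame]
  refine (add_le_add_right hlin _).trans (le_of_eq ?_)
  rw [← EC_add]
  congr 1
  funext u v
  change φ u v + ψ u v * st u v = g u v * Real.log (st u v)
  by_cases hz : g u v = 0
  · simp [hφ, hψ, hz]
  · have hgp : 0 < g u v := lt_of_le_of_ne (hg u v) (Ne.symm hz)
    have hstp : 0 < st u v := lt_of_lt_of_le (div_pos hgp (by positivity)) (hst_ge u v)
    simp only [hφ, hψ]
    field_simp
    ring

lemma frac_le_rpow {s θ : ℝ} (hs : 0 ≤ s) (h0 : 0 < θ) (h1 : θ ≤ 1) : s / (1 + s) ≤ s ^ θ := by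
  have hd : 0 < 1 + s := by linarith
  rcases le_total s 1 with h | h
  · calc s / (1 + s) ≤ s := by rw [div_le_iff₀ hd]; nlinarith
      _ = s ^ (1 : ℝ) := (Real.rpow_one s).symm
      _ ≤ s ^ θ := Real.rpow_le_rpow_of_exponent_ge' hs h h0.le h1
  · calc s / (1 + s) ≤ 1 := by rw [div_le_one hd]; linarith
      _ ≤ s ^ θ := Real.one_le_rpow h h0.le

lemma frac2_le_rpow {p x y θ1 θ2 : ℝ} (hp : 0 < p) (hx : 0 ≤ x) (hy : 0 ≤ y) (h0 : 0 < θ1)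
    (h1 : θ1 ≤ 1) (h0' : 0 < θ2) (h1' : θ2 ≤ 1) :
    (x + y) / (p + (x + y)) ≤ (x / p) ^ θ1 + (y / p) ^ θ2 := by
  have a := frac_le_rpow (div_nonneg hx hp.le) h0 h1
  have b := frac_le_rpow (div_nonneg hy hp.le) h0' h1'
  have a' : x / p / (1 + x / p) = x / (p + x) := by field_simp
  have b' : y / p / (1 + y / p) = y / (p + y) := by field_simp
  rw [a'] at a
  rw [b'] at b
  have c : (x + y) / (p + (x + y)) = x / (p + (x + y)) + y / (p + (x + y)) := by ring
  have d : x / (p + (x + y)) ≤ x / (p + x) := div_le_div_of_nonneg_left hx (by linarith) (by linarith)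
  have e : y / (p + (x + y)) ≤ y / (p + y) := div_le_div_of_nonneg_left hy (by linarith) (by linarith)
  linarith

lemma Qc_nonneg {N1 N2 : ℕ} {T : U → V → W → ℝ} (hT : ∀ u v w, 0 ≤ T u v w)
    (ω : Fin N1 → U × (Fin N2 → V)) (w : W) : 0 ≤ Qc T ω w :=
  mul_nonneg (by positivity) (Finset.sum_nonneg fun _ _ => Finset.sum_nonneg fun _ _ => hT _ _ _)

lemma Qc_sum {N1 N2 : ℕ} (hN1 : 0 < N1) (hN2 : 0 < N2) {T : U → V → W → ℝ}
    (hT1 : ∀ u v, ∑ w, T u v w = 1)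
    (ω : Fin N1 → U × (Fin N2 → V)) : ∑ w, Qc T ω w = 1 := by
  unfold Qc
  rw [← Finset.mul_sum, Finset.sum_comm]
  simp_rw [Finset.sum_comm (s := Finset.univ (α := W)), hT1]
  have : (N1 : ℝ) ≠ 0 := by positivity
  have : (N2 : ℝ) ≠ 0 := by positivity
  simp
  field_simp

/-- expectation of a codebook average -/
lemma E_avg (hU : IsPMF pU) (hV : IsKernel pV) {N1 N2 : ℕ} (hN1 : 0 < N1) (hN2 : 0 < N2)
    (Φ : (Fin N1 → U × (Fin N2 → V)) → Fin N1 → Fin N2 → ℝ) (c : ℝ)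
    (h : ∀ i j, c ≤ ∑ ω, cw pU pV ω * Φ ω i j) :
    c ≤ ∑ ω, cw pU pV ω * (((N1 : ℝ) * N2)⁻¹ * ∑ i, ∑ j, Φ ω i j) := by
  have h1 : ∑ ω, cw pU pV ω * (((N1 : ℝ) * N2)⁻¹ * ∑ i, ∑ j, Φ ω i j) =
      ((N1 : ℝ) * N2)⁻¹ * ∑ i, ∑ j, ∑ ω, cw pU pV ω * Φ ω i j := by
    rw [Finset.mul_sum]
    simp_rw [Finset.mul_sum]
    rw [Finset.sum_comm]
    refine Finset.sum_congr rfl fun i' _ => ?_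
    rw [Finset.sum_comm]
    refine Finset.sum_congr rfl fun j' _ => Finset.sum_congr rfl fun ω _ => ?_
    ring
  rw [h1]
  have h2 : ∑ i : Fin N1, ∑ j : Fin N2, c ≤ ∑ i, ∑ j, ∑ ω, cw pU pV ω * Φ ω i j :=
    Finset.sum_le_sum fun i _ => Finset.sum_le_sum fun j _ => h i j
  have h3 : (0 : ℝ) < N1 := by positivity
  have h4 : (0 : ℝ) < N2 := by positivity
  calc c = ((N1 : ℝ) * N2)⁻¹ * ∑ i : Fin N1, ∑ j : Fin N2, c := by
        simp
        field_simp
    _ ≤ _ := mul_le_mul_of_nonneg_left h2 (by positivity)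

/-- expectation of a codebook average -/
lemma E_avg_eq (hU : IsPMF pU) (hV : IsKernel pV) {N1 N2 : ℕ} (hN1 : 0 < N1) (hN2 : 0 < N2)
    (f : U → V → ℝ) :
    ∑ ω : Fin N1 → U × (Fin N2 → V), cw pU pV ω *
      (((N1 : ℝ) * N2)⁻¹ * ∑ i, ∑ j, f (ω i).1 ((ω i).2 j)) = EC pU pV f := by
  apply le_antisymm
  · have := E_avg hU hV hN1 hN2 (fun ω i j => - f (ω i).1 ((ω i).2 j)) (- EC pU pV f)
      (fun i j => by
        have := E_same hU hV i j f
        simp only [mul_neg, Finset.sum_neg_distrib]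
        rw [this])
    simp only [mul_neg, Finset.sum_neg_distrib] at this
    linarith
  · exact E_avg hU hV hN1 hN2 (fun ω i j => f (ω i).1 ((ω i).2 j)) (EC pU pV f)
      (fun i j => (E_same hU hV i j f).ge)

/-- Soft covering: expected triangular discrimination. -/
lemma os_cover (hU : IsPMF pU) (hV : IsKernel pV) {N1 N2 : ℕ} (hN1 : 0 < N1) (hN2 : 0 < N2)
    {T : U → V → W → ℝ} (hT : ∀ u v w, 0 ≤ T u v w) (hT1 : ∀ u v, ∑ w, T u v w = 1)
    {θ1 θ2 : ℝ} (h0 : 0 < θ1) (h1 : θ1 ≤ 1) (h0' : 0 < θ2) (h1' : θ2 ≤ 1) :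
    ∑ ω : Fin N1 → U × (Fin N2 → V), cw pU pV ω *
      (∑ w, (Qc T ω w - m0 pU pV T w) ^ 2 / (Qc T ω w + m0 pU pV T w)) ≤
    2 * EX pU pV T (fun u v w => (T u v w / (N1 * N2) / m0 pU pV T w) ^ θ1) +
    2 * EX pU pV T (fun u _ w => (m1 pV T u w / N1 / m0 pU pV T w) ^ θ2) := by
  have n1 : (0 : ℝ) < N1 := by positivity
  have n2 : (0 : ℝ) < N2 := by positivity
  have hm0 := m0_nonneg hU hV hT
  set p := m0 pU pV T with hp
  have hpsum : ∑ w, p w = 1 := by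
    have := EX_one hU hV hT1
    simp only [EX, mul_one] at this
    exact this
  have e1 : ∀ ω : Fin N1 → U × (Fin N2 → V),
      (∑ w, (Qc T ω w - p w) ^ 2 / (Qc T ω w + p w)) =
      2 - 4 * ∑ w, (((N1 : ℝ) * N2)⁻¹ * ∑ i, ∑ j,
        T (ω i).1 ((ω i).2 j) w * p w / (p w + Qc T ω w)) := by
    intro ω
    have : ∀ w, (Qc T ω w - p w) ^ 2 / (Qc T ω w + p w) = Qc T ω w + p w -
        4 * (((N1 : ℝ) * N2)⁻¹ * ∑ i, ∑ j,
        T (ω i).1 ((ω i).2 j) w * p w / (p w + Qc T ω w)) := by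
      intro w
      have e2 : ((N1 : ℝ) * N2)⁻¹ * ∑ i, ∑ j,
        T (ω i).1 ((ω i).2 j) w * p w / (p w + Qc T ω w) =
          Qc T ω w * (p w / (p w + Qc T ω w)) := by
        simp only [Qc, mul_div_assoc]
        generalize p w / (p w + _) = r
        simp only [← Finset.sum_mul, mul_assoc]
      rw [e2]
      have q0 := Qc_nonneg hT ω w
      by_cases hz : Qc T ω w + p w = 0
      · have z1 : Qc T ω w = 0 := by linarith [hm0 w]
        have z2 : p w = 0 := by linarith
        rw [z1, z2]
        simp
      · have : p w + Qc T ω w ≠ 0 := by rwa [add_comm]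
        field_simp
        ring
    simp only [this]
    rw [Finset.sum_sub_distrib, Finset.sum_add_distrib, Qc_sum hN1 hN2 hT1, hpsum,
      ← Finset.mul_sum]
    norm_num
  simp only [e1, mul_sub, Finset.sum_sub_distrib, ← Finset.sum_mul, (cw_isPMF hU hV).2]
  set st : U → V → W → ℝ := fun u v w =>
    T u v w / (N1 * N2) + m1 pV T u w / N1 + p w with hst
  have e3 : EX pU pV T (fun u v w => p w / (p w + st u v w)) ≤
      ∑ ω : Fin N1 → U × (Fin N2 → V), cw pU pV ω * ∑ w, (((N1 : ℝ) * N2)⁻¹ * ∑ i, ∑ j,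
        T (ω i).1 ((ω i).2 j) w * p w / (p w + Qc T ω w)) := by
    rw [Finset.sum_congr rfl fun ω _ => Finset.mul_sum _ _ _]
    rw [Finset.sum_comm]
    refine Finset.sum_le_sum fun w _ => ?_
    refine E_avg hU hV hN1 hN2
      (fun ω i j => T (ω i).1 ((ω i).2 j) w * p w / (p w + Qc T ω w)) _ fun i j => ?_
    have := E_inv hU hV i j (fun u v => T u v w) (fun _ _ => p w) (fun u v => hT u v w)
      (fun _ _ => hm0 w) (p w) (hm0 w)
    refine le_trans (le_of_eq ?_) this
    congr 1
    funext u v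
    rw [mul_div_assoc]
    rfl
  have e4 : EX pU pV T (fun u v w => 2 - 4 * (p w / (p w + st u v w))) ≤
      EX pU pV T (fun u v w => 2 * (T u v w / (N1 * N2) / p w) ^ θ1 +
        2 * (m1 pV T u w / N1 / p w) ^ θ2) := by
    refine EX_mono hU hV hT fun u v w a1 a2 a3 => ?_
    obtain ⟨b1, b2, b3⟩ := pos_of_supp hU hV hT a1 a2 a3
    have b3' : 0 < p w := b3
    set x := T u v w / (N1 * N2) with hx
    set y := m1 pV T u w / N1 with hy
    have x0 : 0 < x := by positivity
    have y0 : 0 < y := by positivity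
    have e5 : 2 - 4 * (p w / (p w + st u v w)) = 2 * ((x + y) / (2 * p w + (x + y))) := by
      simp only [hst, ← hx, ← hy]
      have : p w + (x + y + p w) ≠ 0 := by positivity
      have : 2 * p w + (x + y) ≠ 0 := by positivity
      field_simp
      ring
    rw [e5]
    have := frac2_le_rpow b3' x0.le y0.le h0 h1 h0' h1'
    have e6 : (x + y) / (2 * p w + (x + y)) ≤ (x + y) / (p w + (x + y)) :=
      div_le_div_of_nonneg_left (by positivity) (by positivity) (by linarith)
    linarith
  rw [EX_add, EX_smul, EX_smul] at e4
  refine le_trans ?_ e4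
  rw [EX_sub, EX_smul]
  have e7 : EX pU pV T (fun _ _ _ => (2 : ℝ)) = 2 := by
    have := EX_smul (pU := pU) (pV := pV) 2 T (fun _ _ _ => 1)
    rw [EX_one hU hV hT1] at this
    simpa using this
  rw [e7]
  simp only [one_mul, mul_left_comm _ (4 : ℝ)]
  rw [← Finset.mul_sum]
  linarith

/-- Random coding: expected error of posterior decoding. -/
lemma os_decode (hU : IsPMF pU) (hV : IsKernel pV) {N1 N2 : ℕ} (hN1 : 0 < N1) (hN2 : 0 < N2)
    {T : U → V → W → ℝ} (hT : ∀ u v w, 0 ≤ T u v w) (hT1 : ∀ u v, ∑ w, T u v w = 1)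
    {θ1 θ2 : ℝ} (h0 : 0 < θ1) (h1 : θ1 ≤ 1) (h0' : 0 < θ2) (h1' : θ2 ≤ 1) :
    ∑ ω : Fin N1 → U × (Fin N2 → V), cw pU pV ω *
      (1 - ∑ w, ((N1 : ℝ) * N2)⁻¹ * ∑ i, ∑ j, T (ω i).1 ((ω i).2 j) w *
        (T (ω i).1 ((ω i).2 j) w / (N1 * N2)) / Qc T ω w) ≤
    EX pU pV T (fun u v w => (m1 pV T u w / N1 / (T u v w / (N1 * N2))) ^ θ1) +
    EX pU pV T (fun u v w => (m0 pU pV T w / (T u v w / (N1 * N2))) ^ θ2) := by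
  have n1 : (0 : ℝ) < N1 := by positivity
  have n2 : (0 : ℝ) < N2 := by positivity
  have hm0 := m0_nonneg hU hV hT
  set p := m0 pU pV T with hp
  simp only [mul_sub, Finset.sum_sub_distrib, ← Finset.sum_mul, (cw_isPMF hU hV).2]
  set st : U → V → W → ℝ := fun u v w =>
    T u v w / (N1 * N2) + m1 pV T u w / N1 + p w with hst
  have e3 : EX pU pV T (fun u v w => T u v w / (N1 * N2) / (st u v w)) ≤
      ∑ ω : Fin N1 → U × (Fin N2 → V), cw pU pV ω * ∑ w, ((N1 : ℝ) * N2)⁻¹ * ∑ i, ∑ j,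
        T (ω i).1 ((ω i).2 j) w *
        (T (ω i).1 ((ω i).2 j) w / (N1 * N2)) / Qc T ω w := by
    rw [Finset.sum_congr rfl fun ω _ => Finset.mul_sum _ _ _]
    rw [Finset.sum_comm]
    refine Finset.sum_le_sum fun w _ => ?_
    refine E_avg hU hV hN1 hN2
      (fun ω i j => T (ω i).1 ((ω i).2 j) w *
        (T (ω i).1 ((ω i).2 j) w / (N1 * N2)) / Qc T ω w) _ fun i j => ?_
    have := E_inv hU hV i j (fun u v => T u v w) (fun u v => T u v w / (N1 * N2))
      (fun u v => hT u v w)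
      (fun u v => div_nonneg (hT u v w) (by positivity)) 0 le_rfl
    simp only [zero_add] at this
    refine le_trans (le_of_eq ?_) this
    congr 1
    funext u v
    rw [mul_div_assoc]
    rfl
  have e4 : EX pU pV T (fun u v w => 1 - T u v w / (N1 * N2) / (st u v w)) ≤
      EX pU pV T (fun u v w => (m1 pV T u w / N1 / (T u v w / (N1 * N2))) ^ θ1 +
        (p w / (T u v w / (N1 * N2))) ^ θ2) := by
    refine EX_mono hU hV hT fun u v w a1 a2 a3 => ?_
    obtain ⟨b1, b2, b3⟩ := pos_of_supp hU hV hT a1 a2 a3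
    have b3' : 0 < p w := b3
    have hx0 : 0 < T u v w / (N1 * N2) := by positivity
    have hy0 : 0 < m1 pV T u w / N1 := by positivity
    have := frac2_le_rpow hx0 hy0.le b3'.le h0 h1 h0' h1'
    refine le_trans (le_of_eq ?_) this
    simp only [hst]
    set x := T u v w / (N1 * N2) with hx
    set y := m1 pV T u w / N1 with hy
    have : x + y + p w ≠ 0 := by positivity
    have : x + (y + p w) ≠ 0 := by positivity
    field_simp
    ring
  rw [EX_add] at e4
  refine le_trans ?_ e4
  rw [EX_sub, EX_one hU hV hT1]
  linarith

end OneShot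

/-! ### The unnormalised conditional entropy functional -/

section HH

variable {A G ι : Type} [Fintype A] [Fintype G] [Fintype ι]

/-- unnormalised entropy (in nats) of a finite measure, minus that of its total mass -/
noncomputable def h1 (μ : A → ℝ) : ℝ := ∑ a, Real.negMulLog (μ a) - Real.negMulLog (∑ a, μ a)

lemma h1_eq (μ : A → ℝ) : h1 μ = ∑ a, μ a * (Real.log (∑ a', μ a') - Real.log (μ a)) := by
  simp only [h1, Real.negMulLog, mul_sub, Finset.sum_sub_distrib, ← Finset.sum_mul]
  simp only [neg_mul, Finset.sum_neg_distrib]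
  ring

lemma h1_nonneg {μ : A → ℝ} (hμ : ∀ a, 0 ≤ μ a) : 0 ≤ h1 μ := by
  rw [h1_eq]
  refine Finset.sum_nonneg fun a _ => ?_
  by_cases h : μ a = 0
  · simp [h]
  have hp : 0 < μ a := lt_of_le_of_ne (hμ a) (Ne.symm h)
  refine mul_nonneg hp.le ?_
  have := Finset.single_le_sum (f := μ) (fun a _ => hμ a) (Finset.mem_univ a)
  linarith [Real.log_le_log hp this]

lemma h1_smul (c : ℝ) (μ : A → ℝ) : h1 (fun a => c * μ a) = c * h1 μ := by
  simp only [h1, ← Finset.mul_sum, Real.negMulLog_mul, Finset.sum_add_distrib, ← Finset.sum_mul]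
  ring

lemma h1_super {μ : ι → A → ℝ} (hμ : ∀ i a, 0 ≤ μ i a) :
    ∑ i, h1 (μ i) ≤ h1 (fun a => ∑ i, μ i a) := by
  have e1 : h1 (fun a => ∑ i, μ i a) = ∑ i, ∑ a, μ i a *
      (Real.log (∑ a', ∑ i', μ i' a') - Real.log (∑ i', μ i' a)) := by
    rw [h1_eq]
    refine Eq.trans ?_ Finset.sum_comm
    refine Finset.sum_congr rfl fun a _ => ?_
    rw [Finset.sum_mul]
  rw [e1]
  refine Finset.sum_le_sum fun i _ => ?_
  rw [h1_eq]
  set S := ∑ a', ∑ i', μ i' a' with hS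
  set s := ∑ a', μ i a' with hs
  have hs0 : 0 ≤ s := Finset.sum_nonneg fun a _ => hμ i a
  have hM : ∀ a, μ i a ≤ ∑ i', μ i' a := fun a =>
    Finset.single_le_sum (f := fun i' => μ i' a) (fun i' _ => hμ i' a) (Finset.mem_univ i)
  have hMS : s ≤ S := Finset.sum_le_sum fun a _ => hM a
  have key : ∀ a, μ i a * (Real.log s - Real.log (μ i a)) -
      μ i a * (Real.log S - Real.log (∑ i', μ i' a)) ≤ s * ((∑ i', μ i' a) / S) - μ i a := by
    intro a
    by_cases h : μ i a = 0
    · rw [h]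
      have : 0 ≤ (∑ i', μ i' a) / S :=
        div_nonneg (Finset.sum_nonneg fun i' _ => hμ i' a) (hs0.trans hMS)
      have := mul_nonneg hs0 this
      simpa using this
    have hp : 0 < μ i a := lt_of_le_of_ne (hμ i a) (Ne.symm h)
    have hsp : 0 < s := lt_of_lt_of_le hp
      (Finset.single_le_sum (f := fun a => μ i a) (fun a _ => hμ i a) (Finset.mem_univ a))
    have hSp := lt_of_lt_of_le hsp hMS
    have hMp := lt_of_lt_of_le hp (hM a)
    set M := ∑ i', μ i' a
    have h3 := Real.log_le_sub_one_of_pos (div_pos (mul_pos hsp hMp) (mul_pos hSp hp))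
    rw [Real.log_div (mul_pos hsp hMp).ne' (mul_pos hSp hp).ne', Real.log_mul hsp.ne' hMp.ne',
      Real.log_mul hSp.ne' hp.ne'] at h3
    have h4 := mul_le_mul_of_nonneg_left h3 hp.le
    have h5 : μ i a * (s * M / (S * μ i a) - 1) = s * (M / S) - μ i a := by
      field_simp
    rw [h5] at h4
    linarith
  have h6 := Finset.sum_le_sum (s := Finset.univ) fun a _ => key a
  simp only [Finset.sum_sub_distrib] at h6
  have h7 : ∑ a, s * ((∑ i', μ i' a) / S) - ∑ a, μ i a ≤ 0 := by
    rw [← Finset.mul_sum, ← Finset.sum_div, ← hS, ← hs]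
    by_cases hz : S = 0
    · have : s = 0 := by linarith
      simp [this]
    · rw [div_self hz]
      simp
  linarith

lemma h1_le_card [Nonempty A] {μ : A → ℝ} (hμ : ∀ a, 0 ≤ μ a) :
    h1 μ ≤ (∑ a, μ a) * Real.log (Fintype.card A) := by
  rw [h1_eq]
  have hN : (0 : ℝ) < Fintype.card A := by exact_mod_cast Fintype.card_pos
  set N : ℝ := ((Fintype.card A : ℕ) : ℝ) with hNd
  set s := ∑ a, μ a with hs
  have hs0 : 0 ≤ s := Finset.sum_nonneg fun a _ => hμ a
  have key : ∀ a, μ a * (Real.log s - Real.log (μ a)) - μ a * Real.log N ≤ s / N - μ a := by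
    intro a
    by_cases h : μ a = 0
    · rw [h]
      have := div_nonneg hs0 hN.le
      simpa using this
    have hp : 0 < μ a := lt_of_le_of_ne (hμ a) (Ne.symm h)
    have hsp : 0 < s := lt_of_lt_of_le hp
      (Finset.single_le_sum (f := fun a => μ a) (fun a _ => hμ a) (Finset.mem_univ a))
    have h3 := Real.log_le_sub_one_of_pos (div_pos hsp (mul_pos hN hp))
    rw [Real.log_div hsp.ne' (mul_pos hN hp).ne', Real.log_mul hN.ne' hp.ne'] at h3
    have h4 := mul_le_mul_of_nonneg_left h3 hp.le
    have h5 : μ a * (s / (N * μ a) - 1) = s / N - μ a := by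
      field_simp
    rw [h5] at h4
    linarith
  have h6 := Finset.sum_le_sum (s := Finset.univ) fun a _ => key a
  simp only [Finset.sum_sub_distrib, ← Finset.sum_mul, ← hs] at h6
  have h7 : ∑ _a : A, s / N = s := by
    simp only [Finset.sum_const, Finset.card_univ, nsmul_eq_mul, ← hNd]
    field_simp
  rw [h7] at h6
  linarith

lemma nml_add_le {x y : ℝ} (hx : 0 ≤ x) (hy : 0 ≤ y) :
    Real.negMulLog (x + y) ≤ Real.negMulLog x + Real.negMulLog y := by
  rcases hx.eq_or_lt with rfl | hx
  · simp
  rcases hy.eq_or_lt with rfl | hy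
  · simp
  simp only [Real.negMulLog]
  have h1 := Real.log_le_log hx (by linarith : x ≤ x + y)
  have h2 := Real.log_le_log hy (by linarith : y ≤ x + y)
  nlinarith

lemma nml_add_ge {x y : ℝ} (hx : 0 ≤ x) (hy : 0 ≤ y) :
    Real.negMulLog x + Real.negMulLog y ≤ Real.negMulLog (x + y) + (x + y) * Real.log 2 := by
  rcases hx.eq_or_lt with rfl | hx
  · simp; positivity
  rcases hy.eq_or_lt with rfl | hy
  · simp; positivity
  simp only [Real.negMulLog]
  have hs : 0 < x + y := by linarith
  have a1 := Real.log_le_sub_one_of_pos (div_pos hs (mul_pos two_pos hx))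
  have a2 := Real.log_le_sub_one_of_pos (div_pos hs (mul_pos two_pos hy))
  rw [Real.log_div hs.ne' (by positivity), Real.log_mul two_ne_zero hx.ne'] at a1
  rw [Real.log_div hs.ne' (by positivity), Real.log_mul two_ne_zero hy.ne'] at a2
  have b1 := mul_le_mul_of_nonneg_left a1 hx.le
  have b2 := mul_le_mul_of_nonneg_left a2 hy.le
  have c1 : x * ((x + y) / (2 * x) - 1) = (x + y) / 2 - x := by field_simp
  have c2 : y * ((x + y) / (2 * y) - 1) = (x + y) / 2 - y := by field_simp
  rw [c1] at b1
  rw [c2] at b2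
  nlinarith

lemma h1_add_le {μ ν : A → ℝ} (hμ : ∀ a, 0 ≤ μ a) (hν : ∀ a, 0 ≤ ν a) :
    h1 (fun a => μ a + ν a) ≤ h1 μ + h1 ν + (∑ a, (μ a + ν a)) * Real.log 2 := by
  simp only [h1, Finset.sum_add_distrib]
  have a1 := Finset.sum_le_sum (s := Finset.univ) fun a _ => nml_add_le (hμ a) (hν a)
  rw [Finset.sum_add_distrib] at a1
  have a2 := nml_add_ge (Finset.sum_nonneg fun a (_ : a ∈ Finset.univ) => hμ a)
    (Finset.sum_nonneg fun a (_ : a ∈ Finset.univ) => hν a)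
  linarith

/-- unnormalised conditional entropy of the first coordinate given the second -/
noncomputable def hh (μ : A × G → ℝ) : ℝ := ∑ g, h1 (fun a => μ (a, g))

lemma hh_nonneg {μ : A × G → ℝ} (hμ : ∀ w, 0 ≤ μ w) : 0 ≤ hh μ :=
  Finset.sum_nonneg fun g _ => h1_nonneg fun a => hμ (a, g)

lemma hh_smul (c : ℝ) (μ : A × G → ℝ) : hh (fun w => c * μ w) = c * hh μ := by
  simp only [hh, Finset.mul_sum, h1_smul]

lemma hh_super {μ : ι → A × G → ℝ} (hμ : ∀ i w, 0 ≤ μ i w) :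
    ∑ i, hh (μ i) ≤ hh (fun w => ∑ i, μ i w) := by
  unfold hh
  rw [Finset.sum_comm]
  exact Finset.sum_le_sum fun g _ => h1_super (μ := fun i a => μ i (a, g)) fun i a => hμ i (a, g)

lemma hh_super2 {μ ν : A × G → ℝ} (hμ : ∀ w, 0 ≤ μ w) (hν : ∀ w, 0 ≤ ν w) :
    hh μ + hh ν ≤ hh (fun w => μ w + ν w) := by
  have := hh_super (ι := Bool) (μ := fun b => if b then μ else ν)
    (fun b w => by cases b <;> simp [hμ, hν])
  simpa using this

lemma hh_le_card [Nonempty A] {μ : A × G → ℝ} (hμ : ∀ w, 0 ≤ μ w) :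
    hh μ ≤ (∑ w, μ w) * Real.log (Fintype.card A) := by
  rw [Fintype.sum_prod_type_right, Finset.sum_mul]
  exact Finset.sum_le_sum fun g _ => h1_le_card fun a => hμ (a, g)

lemma hh_add_le {μ ν : A × G → ℝ} (hμ : ∀ w, 0 ≤ μ w) (hν : ∀ w, 0 ≤ ν w) :
    hh (fun w => μ w + ν w) ≤ hh μ + hh ν + (∑ w, (μ w + ν w)) * Real.log 2 := by
  rw [Fintype.sum_prod_type_right, Finset.sum_mul]
  unfold hh
  rw [← Finset.sum_add_distrib, ← Finset.sum_add_distrib]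
  exact Finset.sum_le_sum fun g _ => h1_add_le (fun a => hμ (a, g)) (fun a => hν (a, g))

/-- changing the input law of a kernel changes the equivocation only slightly -/
lemma hh_change [Nonempty A] {p q : A → ℝ} (hp : IsPMF p) (hq : IsPMF q) {k : A → G → ℝ}
    (hk : IsKernel k) :
    hh (fun w : A × G => q w.1 * k w.1 w.2) -
      (∑ a, |q a - p a|) * Real.log (Fintype.card A) - Real.log 2 ≤
    hh (fun w : A × G => p w.1 * k w.1 w.2) := by
  set R : A × G → ℝ := fun w => min (p w.1) (q w.1) * k w.1 w.2 with hR
  set S : A × G → ℝ := fun w => (p w.1 - min (p w.1) (q w.1)) * k w.1 w.2 with hS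
  set S' : A × G → ℝ := fun w => (q w.1 - min (p w.1) (q w.1)) * k w.1 w.2 with hS'
  have k0 : ∀ a g, 0 ≤ k a g := fun a => (hk a).1
  have R0 : ∀ w, 0 ≤ R w := fun w => mul_nonneg (le_min (hp.1 _) (hq.1 _)) (k0 _ _)
  have S0 : ∀ w, 0 ≤ S w := fun w =>
    mul_nonneg (by linarith [min_le_left (p w.1) (q w.1)]) (k0 _ _)
  have S0' : ∀ w, 0 ≤ S' w := fun w =>
    mul_nonneg (by linarith [min_le_right (p w.1) (q w.1)]) (k0 _ _)
  have e1 : (fun w : A × G => p w.1 * k w.1 w.2) = fun w => R w + S w := by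
    funext w; simp only [hR, hS]; ring
  have e2 : (fun w : A × G => q w.1 * k w.1 w.2) = fun w => R w + S' w := by
    funext w; simp only [hR, hS']; ring
  rw [e1, e2]
  have a1 := hh_super2 R0 S0
  have a2 := hh_nonneg S0
  have a3 := hh_add_le R0 S0'
  have a4 := hh_le_card S0'
  have a5 : ∑ w, (R w + S' w) = 1 := by
    rw [← e2, Fintype.sum_prod_type]
    simp only [← Finset.mul_sum, (hk _).2, mul_one, hq.2]
  have a6 : ∑ w, S' w ≤ ∑ a, |q a - p a| := by
    rw [Fintype.sum_prod_type]
    simp only [hS', ← Finset.mul_sum, (hk _).2, mul_one]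
    refine Finset.sum_le_sum fun a _ => ?_
    rcases min_cases (p a) (q a) with h | h
    · rw [h.1]; exact le_abs_self _
    · rw [h.1]; simp
  have a7 : 0 ≤ Real.log (Fintype.card A) :=
    Real.log_natCast_nonneg _
  rw [a5] at a3
  have a8 := mul_le_mul_of_nonneg_right a6 a7
  linarith

end HH

section Equiv

variable {U V A G : Type} [Fintype U] [Fintype V] [Fintype A] [Fintype G]
variable {pU : U → ℝ} {pV : U → V → ℝ}

lemma cw_supp {N1 N2 : ℕ} {ω : Fin N1 → U × (Fin N2 → V)} (h : cw pU pV ω ≠ 0) (i : Fin N1)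
    (j : Fin N2) : pV (ω i).1 ((ω i).2 j) ≠ 0 := by
  have h1 := (Finset.prod_ne_zero_iff.1 h) i (Finset.mem_univ i)
  have h2 := right_ne_zero_of_mul h1
  exact (Finset.prod_ne_zero_iff.1 h2) j (Finset.mem_univ j)

/-- law of the output of the `i`-th row -/
noncomputable def Qr {W : Type} {N1 N2 : ℕ} (T : U → V → W → ℝ) (ω : Fin N1 → U × (Fin N2 → V))
    (i : Fin N1) (w : W) : ℝ := (N2 : ℝ)⁻¹ * ∑ j, T (ω i).1 ((ω i).2 j) w

lemma nml_le {x c : ℝ} (hx : 0 ≤ x) (hc : 0 ≤ c) (h : c = 0 → x = 0) :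
    Real.negMulLog x ≤ - x * Real.log c + c - x := by
  rcases hc.eq_or_lt with h0 | hc
  · have := h h0.symm
    rw [this, ← h0]
    simp
  rcases hx.eq_or_lt with rfl | hx
  · simpa using hc.le
  have a1 := Real.log_le_sub_one_of_pos (div_pos hc hx)
  rw [Real.log_div hc.ne' hx.ne'] at a1
  have a2 := mul_le_mul_of_nonneg_left a1 hx.le
  have c1 : x * (c / x - 1) = c - x := by field_simp
  rw [c1] at a2
  simp only [Real.negMulLog]
  linarith

lemma E_row_avg (hU : IsPMF pU) (hV : IsKernel pV) {N1 N2 : ℕ} (hN2 : 0 < N2) (i : Fin N1)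
    (f : U → V → ℝ) :
    ∑ ω : Fin N1 → U × (Fin N2 → V), cw pU pV ω *
      ((N2 : ℝ)⁻¹ * ∑ j, f (ω i).1 ((ω i).2 j)) = EC pU pV f := by
  have n2 : (0 : ℝ) < N2 := by positivity
  have e1 : ∑ ω : Fin N1 → U × (Fin N2 → V), cw pU pV ω *
      ((N2 : ℝ)⁻¹ * ∑ j, f (ω i).1 ((ω i).2 j)) =
      (N2 : ℝ)⁻¹ * ∑ j, ∑ ω : Fin N1 → U × (Fin N2 → V),
        cw pU pV ω * f (ω i).1 ((ω i).2 j) := by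
    rw [Finset.sum_comm, Finset.mul_sum]
    refine Finset.sum_congr rfl fun ω _ => ?_
    rw [Finset.mul_sum, Finset.mul_sum, Finset.mul_sum]
    refine Finset.sum_congr rfl fun j _ => ?_
    ring
  rw [e1]
  simp only [E_same hU hV]
  simp
  field_simp

/-- Expected equivocation of the codebook law. -/
lemma os_equiv (hU : IsPMF pU) (hV : IsKernel pV) {N1 N2 : ℕ} (hN1 : 0 < N1) (hN2 : 0 < N2)
    {T : U → V → A × G → ℝ} (hT : ∀ u v w, 0 ≤ T u v w) :
    ∑ u, pU u * hh (m1 pV T u) -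
      EX pU pV T (fun u v w => Real.log (1 + T u v w / N2 / m1 pV T u w)) ≤
    ∑ ω : Fin N1 → U × (Fin N2 → V), cw pU pV ω * hh (Qc T ω) := by
  have n1 : (0 : ℝ) < N1 := by positivity
  have n2 : (0 : ℝ) < N2 := by positivity
  set c := ∑ u, pU u * hh (m1 pV T u) -
      EX pU pV T (fun u v w => Real.log (1 + T u v w / N2 / m1 pV T u w)) with hc
  have hm1 := m1_nonneg hV hT
  have key : ∀ i : Fin N1, c ≤ ∑ ω : Fin N1 → U × (Fin N2 → V), cw pU pV ω * hh (Qr T ω i) := by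
    intro i
    have e0 : ∀ μ : A × G → ℝ, hh μ = ∑ w, Real.negMulLog (μ w) -
        ∑ g, Real.negMulLog (∑ a, μ (a, g)) := by
      intro μ
      simp only [hh, h1, Finset.sum_sub_distrib]
      rw [Fintype.sum_prod_type_right]
    -- first part
    have p1 : ∀ w, EC pU pV (fun u v => T u v w * - Real.log (T u v w / N2 + m1 pV T u w)) ≤
        ∑ ω : Fin N1 → U × (Fin N2 → V), cw pU pV ω * Real.negMulLog (Qr T ω i w) := by
      intro w
      have a1 : ∑ ω : Fin N1 → U × (Fin N2 → V), cw pU pV ω * Real.negMulLog (Qr T ω i w) =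
        - ((N2 : ℝ)⁻¹ * ∑ j, ∑ ω : Fin N1 → U × (Fin N2 → V), cw pU pV ω *
          (T (ω i).1 ((ω i).2 j) w *
            Real.log ((N2 : ℝ)⁻¹ * ∑ j', T (ω i).1 ((ω i).2 j') w))) := by
        rw [Finset.sum_comm, Finset.mul_sum, ← Finset.sum_neg_distrib]
        refine Finset.sum_congr rfl fun ω _ => ?_
        rw [← Finset.mul_sum, ← Finset.sum_mul]
        simp only [Real.negMulLog, Qr]
        ring
      rw [a1]
      have a2 : ∀ j : Fin N2, _ := fun j => E_log_row hU hV i j (fun u v => T u v w)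
        (fun u v => hT u v w)
      have a3 := Finset.sum_le_sum (s := Finset.univ) fun j _ => a2 j
      have a4 := mul_le_mul_of_nonneg_left a3 (inv_nonneg.2 n2.le)
      have a5 := neg_le_neg a4
      refine le_trans (le_of_eq ?_) a5
      simp only [mul_neg]
      have : EC pU pV (fun u v => -(T u v w * Real.log (T u v w / N2 + m1 pV T u w))) =
        - EC pU pV (fun u v => (T u v w * Real.log (T u v w / N2 + m1 pV T u w))) := by
        simp only [EC, mul_neg, Finset.sum_neg_distrib]
      rw [this]
      simp only [Finset.sum_const, Finset.card_univ, Fintype.card_fin, nsmul_eq_mul, m1]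
      field_simp
    -- second part
    have p2 : ∀ g, ∑ ω : Fin N1 → U × (Fin N2 → V), cw pU pV ω *
        Real.negMulLog (∑ a, Qr T ω i (a, g)) ≤
        ∑ u, pU u * Real.negMulLog (∑ a, m1 pV T u (a, g)) := by
      intro g
      set TG : U → V → ℝ := fun u v => ∑ a, T u v (a, g) with hTG
      set M : U → ℝ := fun u => ∑ a, m1 pV T u (a, g) with hM
      have hM' : ∀ u, M u = ∑ v, pV u v * TG u v := by
        intro u
        simp only [hM, hTG, m1, Finset.mul_sum]
        rw [Finset.sum_comm]
      have hTG0 : ∀ u v, 0 ≤ TG u v := fun u v => Finset.sum_nonneg fun a _ => hT u v _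
      have hM0 : ∀ u, 0 ≤ M u := fun u => Finset.sum_nonneg fun a _ => hm1 u _
      have hQ : ∀ ω : Fin N1 → U × (Fin N2 → V), ∑ a, Qr T ω i (a, g) =
          (N2 : ℝ)⁻¹ * ∑ j, TG (ω i).1 ((ω i).2 j) := by
        intro ω
        simp only [Qr, ← Finset.mul_sum, hTG]
        rw [Finset.sum_comm]
      have b1 : ∀ ω : Fin N1 → U × (Fin N2 → V),
          cw pU pV ω * Real.negMulLog (∑ a, Qr T ω i (a, g)) ≤ cw pU pV ω *
          ((N2 : ℝ)⁻¹ * ∑ j, (- TG (ω i).1 ((ω i).2 j) * Real.log (M (ω i).1) + M (ω i).1 -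
            TG (ω i).1 ((ω i).2 j))) := by
        intro ω
        by_cases hz : cw pU pV ω = 0
        · simp [hz]
        refine mul_le_mul_of_nonneg_left ?_ ((cw_isPMF hU hV).1 ω)
        have e1 : (N2 : ℝ)⁻¹ * ∑ j, (- TG (ω i).1 ((ω i).2 j) * Real.log (M (ω i).1) + M (ω i).1 -
            TG (ω i).1 ((ω i).2 j)) =
            - (∑ a, Qr T ω i (a, g)) * Real.log (M (ω i).1) + M (ω i).1 -
              ∑ a, Qr T ω i (a, g) := by
          rw [hQ, Finset.sum_sub_distrib, Finset.sum_add_distrib, ← Finset.sum_mul,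
            Finset.sum_neg_distrib]
          simp only [Finset.sum_const, Finset.card_univ, Fintype.card_fin, nsmul_eq_mul]
          field_simp
        rw [e1]
        refine nml_le ?_ (hM0 _) ?_
        · rw [hQ]
          exact mul_nonneg (inv_nonneg.2 n2.le) (Finset.sum_nonneg fun _ _ => hTG0 _ _)
        · intro h0
          rw [hQ]
          rw [hM', Finset.sum_eq_zero_iff_of_nonneg
            (fun v _ => mul_nonneg ((hV _).1 v) (hTG0 _ v))] at h0
          have : ∀ j, TG (ω i).1 ((ω i).2 j) = 0 := by
            intro j
            have := h0 ((ω i).2 j) (Finset.mem_univ _)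
            exact (mul_eq_zero.1 this).resolve_left (cw_supp hz i j)
          simp [this]
      refine (Finset.sum_le_sum fun ω _ => b1 ω).trans (le_of_eq ?_)
      rw [E_row_avg hU hV hN2 i (fun u v => - TG u v * Real.log (M u) + M u - TG u v)]
      unfold EC
      refine Finset.sum_congr rfl fun u _ => ?_
      have e3 : ∑ v, pU u * pV u v * (- TG u v * Real.log (M u) + M u - TG u v) =
        pU u * (- (∑ v, pV u v * TG u v) * Real.log (M u) + (∑ v, pV u v) * M u -
          ∑ v, pV u v * TG u v) := by
        rw [← Finset.sum_neg_distrib, Finset.sum_mul, Finset.sum_mul, ← Finset.sum_add_distrib,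
          ← Finset.sum_sub_distrib, Finset.mul_sum]
        refine Finset.sum_congr rfl fun v _ => ?_
        ring
      rw [e3, ← hM', (hV u).2]
      simp only [Real.negMulLog]
      ring
    simp only [e0, mul_sub, Finset.sum_sub_distrib]
    have q1 := Finset.sum_le_sum (s := Finset.univ) fun w _ => p1 w
    have q2 := Finset.sum_le_sum (s := Finset.univ) fun g _ => p2 g
    have r1 : ∑ ω : Fin N1 → U × (Fin N2 → V), cw pU pV ω * ∑ w, Real.negMulLog (Qr T ω i w) =
        ∑ w, ∑ ω : Fin N1 → U × (Fin N2 → V), cw pU pV ω * Real.negMulLog (Qr T ω i w) := by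
      rw [Finset.sum_comm]
      exact Finset.sum_congr rfl fun ω _ => Finset.mul_sum _ _ _
    have r2 : ∑ ω : Fin N1 → U × (Fin N2 → V), cw pU pV ω *
          ∑ g, Real.negMulLog (∑ a, Qr T ω i (a, g)) =
        ∑ g, ∑ ω : Fin N1 → U × (Fin N2 → V), cw pU pV ω *
          Real.negMulLog (∑ a, Qr T ω i (a, g)) := by
      rw [Finset.sum_comm]
      exact Finset.sum_congr rfl fun ω _ => Finset.mul_sum _ _ _
    rw [r1, r2]
    refine le_trans ?_ (sub_le_sub q1 q2)
    rw [hc]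
    simp only [e0, mul_sub, Finset.sum_sub_distrib]
    have r3 : ∑ u, pU u * ∑ g, Real.negMulLog (∑ a, m1 pV T u (a, g)) =
        ∑ g, ∑ u, pU u * Real.negMulLog (∑ a, m1 pV T u (a, g)) := by
      rw [Finset.sum_comm]
      exact Finset.sum_congr rfl fun ω _ => Finset.mul_sum _ _ _
    rw [r3]
    have r4 : ∑ u, pU u * ∑ w, Real.negMulLog (m1 pV T u w) =
        EX pU pV T (fun u v w => - Real.log (m1 pV T u w)) := by
      unfold EX EC
      rw [Finset.sum_comm]
      refine Finset.sum_congr rfl fun u _ => ?_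
      rw [Finset.mul_sum]
      refine Finset.sum_congr rfl fun w _ => ?_
      have : ∀ v, pU u * pV u v * (T u v w * - Real.log (m1 pV T u w)) =
        (pU u * - Real.log (m1 pV T u w)) * (pV u v * T u v w) := fun v => by ring
      simp only [this, ← Finset.mul_sum]
      rw [← m1, Real.negMulLog]
      ring
    have r5 : EX pU pV T (fun u v w => - Real.log (m1 pV T u w) -
        Real.log (1 + T u v w / N2 / m1 pV T u w)) ≤
        EX pU pV T (fun u v w => - Real.log (T u v w / N2 + m1 pV T u w)) := by
      refine EX_mono hU hV hT fun u v w a1 a2 a3 => ?_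
      obtain ⟨b1, b2, b3⟩ := pos_of_supp hU hV hT a1 a2 a3
      have : T u v w / N2 + m1 pV T u w = m1 pV T u w * (1 + T u v w / N2 / m1 pV T u w) := by
        field_simp
        ring
      rw [this, Real.log_mul b2.ne' (by positivity)]
      linarith
    rw [EX_sub, ← r4] at r5
    unfold EX at r5 ⊢
    linarith
  have s1 : ∀ ω : Fin N1 → U × (Fin N2 → V), (N1 : ℝ)⁻¹ * ∑ i, hh (Qr T ω i) ≤ hh (Qc T ω) := by
    intro ω
    have a1 : Qc T ω = fun w => ∑ i, (N1 : ℝ)⁻¹ * Qr T ω i w := by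
      funext w
      simp only [Qc, Qr, ← Finset.mul_sum, mul_inv]
      ring
    rw [a1, Finset.mul_sum]
    simp only [← hh_smul]
    refine hh_super fun i w => ?_
    refine mul_nonneg (by positivity) (mul_nonneg (by positivity) ?_)
    exact Finset.sum_nonneg fun _ _ => hT _ _ _
  have s2 : ∑ ω : Fin N1 → U × (Fin N2 → V), cw pU pV ω * ((N1 : ℝ)⁻¹ * ∑ i, hh (Qr T ω i)) ≤
      ∑ ω : Fin N1 → U × (Fin N2 → V), cw pU pV ω * hh (Qc T ω) :=
    Finset.sum_le_sum fun ω _ => mul_le_mul_of_nonneg_left (s1 ω) ((cw_isPMF hU hV).1 ω)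
  refine le_trans ?_ s2
  have s3 : ∑ ω : Fin N1 → U × (Fin N2 → V), cw pU pV ω * ((N1 : ℝ)⁻¹ * ∑ i, hh (Qr T ω i)) =
      (N1 : ℝ)⁻¹ * ∑ i, ∑ ω : Fin N1 → U × (Fin N2 → V), cw pU pV ω * hh (Qr T ω i) := by
    rw [Finset.sum_comm, Finset.mul_sum]
    refine Finset.sum_congr rfl fun ω _ => ?_
    rw [← Finset.mul_sum]
    ring
  rw [s3]
  have s4 : ∑ _i : Fin N1, c ≤ ∑ i, ∑ ω : Fin N1 → U × (Fin N2 → V), cw pU pV ω * hh (Qr T ω i) :=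
    Finset.sum_le_sum fun i _ => key i
  calc c = (N1 : ℝ)⁻¹ * ∑ _i : Fin N1, c := by
        simp
        field_simp
    _ ≤ _ := mul_le_mul_of_nonneg_left s4 (by positivity)

end Equiv

/-! ### One-shot coding theorem -/

section OSMain

variable {U V A D G : Type} [Fintype U] [Fintype V] [Fintype A] [Fintype D] [Fintype G]
variable {pU : U → ℝ} {pV : U → V → ℝ}

/-- from triangular discrimination to total variation -/
lemma tv_le {p q : A → ℝ} (hp : IsPMF p) (hq : IsPMF q) {η : ℝ}
    (h : ∑ a, (q a - p a) ^ 2 / (q a + p a) ≤ η) : ∑ a, |q a - p a| ≤ Real.sqrt (2 * η) := by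
  apply Real.le_sqrt_of_sq_le
  have h1 : ∀ a, |q a - p a| = |q a - p a| / Real.sqrt (q a + p a) * Real.sqrt (q a + p a) := by
    intro a
    have hn : 0 ≤ q a + p a := add_nonneg (hq.1 a) (hp.1 a)
    by_cases hz : q a + p a = 0
    · have z1 : q a = 0 := by linarith [hq.1 a, hp.1 a]
      have z2 : p a = 0 := by linarith [hq.1 a, hp.1 a]
      simp [z1, z2]
    · have : Real.sqrt (q a + p a) ≠ 0 := by
        rw [Real.sqrt_ne_zero hn]; exact hz
      field_simp
  rw [Finset.sum_congr rfl fun a _ => h1 a]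
  refine (Finset.sum_mul_sq_le_sq_mul_sq _ _ _).trans ?_
  have h2 : ∑ a, Real.sqrt (q a + p a) ^ 2 = 2 := by
    have : ∀ a, Real.sqrt (q a + p a) ^ 2 = q a + p a := fun a =>
      Real.sq_sqrt (add_nonneg (hq.1 a) (hp.1 a))
    simp only [this, Finset.sum_add_distrib, hp.2, hq.2]
    norm_num
  have h3 : ∑ a, (|q a - p a| / Real.sqrt (q a + p a)) ^ 2 =
      ∑ a, (q a - p a) ^ 2 / (q a + p a) := by
    refine Finset.sum_congr rfl fun a _ => ?_
    rw [div_pow, sq_abs, Real.sq_sqrt (add_nonneg (hq.1 a) (hp.1 a))]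
  rw [h2, h3]
  linarith

lemma exists_post {M : Type} [Fintype M] [Nonempty M] {k : M → A → ℝ} (hk : ∀ m a, 0 ≤ k m a) :
    ∃ post : A → M → ℝ, IsKernel post ∧ ∀ a m, (∑ m', k m' a) * post a m = k m a := by
  refine ⟨fun a m => if ∑ m', k m' a = 0 then ((Fintype.card M : ℕ) : ℝ)⁻¹
    else k m a / ∑ m', k m' a, ?_, ?_⟩
  · intro a
    by_cases hz : ∑ m', k m' a = 0
    · refine ⟨fun m => ?_, ?_⟩
      · simp only [hz, if_true]; positivity
      · simp [hz]
    · refine ⟨fun m => ?_, ?_⟩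
      · simp only [hz, if_false]
        exact div_nonneg (hk m a) (Finset.sum_nonneg fun m' _ => hk m' a)
      · simp only [hz, if_false]
        rw [← Finset.sum_div, div_self hz]
  · intro a m
    by_cases hz : ∑ m', k m' a = 0
    · simp only [hz, zero_mul]
      rw [Finset.sum_eq_zero_iff_of_nonneg fun m' _ => hk m' a] at hz
      exact (hz m (Finset.mem_univ m)).symm
    · simp only [hz, if_false]
      field_simp

lemma m0_isPMF (hU : IsPMF pU) (hV : IsKernel pV) {W : Type} [Fintype W] {T : U → V → W → ℝ}
    (hT : ∀ u v, IsPMF (T u v)) : IsPMF (m0 pU pV T) := by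
  refine ⟨m0_nonneg hU hV fun u v => (hT u v).1, ?_⟩
  have := EX_one hU hV (T := T) fun u v => (hT u v).2
  simp only [EX, mul_one] at this
  exact this

/-- deterministic part: from a good codebook to encoder/decoder -/
lemma os_det [Nonempty A] {N1 N2 : ℕ} (hN1 : 0 < N1) (hN2 : 0 < N2)
    {K : U → V → A → ℝ} (hK : ∀ u v, IsPMF (K u v))
    {κD : V → A → D → ℝ} (hD : ∀ v a, IsPMF (κD v a))
    {κG : V → A → G → ℝ} (hG : ∀ v a, IsPMF (κG v a))
    {cost : A → V → D → ℝ} {dmax D0 : ℝ} (hc0 : ∀ a v d, 0 ≤ cost a v d)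
    (hc1 : ∀ a v d, cost a v d ≤ dmax) (hD0 : 0 ≤ D0)
    {pA : A → ℝ} (hpA : IsPMF pA) (ω : Fin N1 → U × (Fin N2 → V)) :
    ∃ (enc : A → V → ℝ) (dec : D → V), IsKernel enc ∧
      (∑ a, ∑ v, ∑ d, pA a * enc a v * κD v a d * cost a (dec d) d ≤
        D0 + dmax * (∑ a, |Qc K ω a - pA a| +
          Qc (W := Unit) (fun u v _ => ∑ a, ∑ d, K u v a * κD v a d *
            (if D0 < cost a v d then 1 else 0)) ω () +
          (1 - ∑ w, ((N1 : ℝ) * N2)⁻¹ * ∑ i, ∑ j,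
            (∑ a, K (ω i).1 ((ω i).2 j) a * κD ((ω i).2 j) a w) *
            ((∑ a, K (ω i).1 ((ω i).2 j) a * κD ((ω i).2 j) a w) / (N1 * N2)) /
            Qc (fun u v w => ∑ a, K u v a * κD v a w) ω w))) ∧
      (hh (Qc (fun u v (w : A × G) => K u v w.1 * κG v w.1 w.2) ω) -
        (∑ a, |Qc K ω a - pA a|) * Real.log (Fintype.card A) - Real.log 2 ≤
        hh (fun w : A × G => pA w.1 * ∑ v, enc w.1 v * κG v w.1 w.2)) := by
  have n1 : (0 : ℝ) < N1 := by positivity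
  have n2 : (0 : ℝ) < N2 := by positivity
  haveI : Nonempty (Fin N1 × Fin N2) := ⟨(⟨0, hN1⟩, ⟨0, hN2⟩)⟩
  set cu : Fin N1 × Fin N2 → U := fun m => (ω m.1).1 with hcu
  set cv : Fin N1 × Fin N2 → V := fun m => (ω m.1).2 m.2 with hcv
  set ν : ℝ := ((N1 : ℝ) * N2)⁻¹ with hν
  have hν0 : 0 < ν := by positivity
  have hQ : ∀ {W : Type} (T : U → V → W → ℝ) (w : W),
      Qc T ω w = ∑ m, ν * T (cu m) (cv m) w := by
    intro W T w
    rw [Qc, Fintype.sum_prod_type, Finset.mul_sum]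
    refine Finset.sum_congr rfl fun i _ => ?_
    rw [Finset.mul_sum]
  have hdm : 0 ≤ dmax := by
    obtain ⟨a⟩ := ‹Nonempty A›
    have hv : V := cv ⟨⟨0, hN1⟩, ⟨0, hN2⟩⟩
    have hne : Nonempty D := by
      by_contra hne
      rw [not_nonempty_iff] at hne
      have := (hD hv a).2
      simp at this
    obtain ⟨d⟩ := hne
    exact (hc0 a hv d).trans (hc1 a hv d)
  obtain ⟨post, hpost, hpostE⟩ := exists_post (k := fun m a => ν * K (cu m) (cv m) a)
    (fun m a => mul_nonneg hν0.le ((hK _ _).1 a))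
  set QA := Qc K ω with hQAdef
  have hQA : IsPMF QA := ⟨Qc_nonneg (fun u v => (hK u v).1) ω,
    Qc_sum hN1 hN2 (fun u v => (hK u v).2) ω⟩
  have hQpost : ∀ a m, QA a * post a m = ν * K (cu m) (cv m) a := by
    intro a m
    rw [hQAdef, hQ]
    exact hpostE a m
  set TD : U → V → D → ℝ := fun u v w => ∑ a, K u v a * κD v a w with hTD
  have hTD0 : ∀ u v w, 0 ≤ TD u v w := fun u v w =>
    Finset.sum_nonneg fun a _ => mul_nonneg ((hK u v).1 a) ((hD v a).1 w)
  have hmax : ∀ w, ∃ m0 : Fin N1 × Fin N2, ∀ m, TD (cu m) (cv m) w ≤ TD (cu m0) (cv m0) w :=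
    fun w => Finite.exists_max fun m => TD (cu m) (cv m) w
  choose mh hmh using hmax
  have epush : ∀ (a : A) (f : V → ℝ), ∑ v, pushf (post a) cv v * f v = ∑ m, post a m * f (cv m) :=
    fun a f => sum_pushf_mul (post a) cv f
  refine ⟨fun a => pushf (post a) cv, fun w => cv (mh w),
    fun a => pushf_isPMF (hpost a) cv, ?_, ?_⟩
  · -- distortion
    set J : A → ℝ := fun a => ∑ m, ∑ w, post a m * κD (cv m) a w * cost a (cv (mh w)) w with hJ
    have hJ0 : ∀ a, 0 ≤ J a := fun a => Finset.sum_nonneg fun m _ => Finset.sum_nonneg fun w _ =>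
      mul_nonneg (mul_nonneg ((hpost a).1 m) ((hD _ a).1 w)) (hc0 _ _ _)
    have hJ1 : ∀ a, J a ≤ dmax := by
      intro a
      calc J a ≤ ∑ m, ∑ w, post a m * κD (cv m) a w * dmax :=
            Finset.sum_le_sum fun m _ => Finset.sum_le_sum fun w _ =>
              mul_le_mul_of_nonneg_left (hc1 _ _ _) (mul_nonneg ((hpost a).1 m) ((hD _ a).1 w))
        _ = dmax := by
            simp only [← Finset.sum_mul, ← Finset.mul_sum, (hD _ _).2, mul_one, (hpost a).2, one_mul]
    have e1 : ∑ a, ∑ v, ∑ w, pA a * pushf (post a) cv v * κD v a w * cost a (cv (mh w)) w =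
        ∑ a, pA a * J a := by
      refine Finset.sum_congr rfl fun a _ => ?_
      have := epush a (fun v => ∑ w, κD v a w * cost a (cv (mh w)) w)
      simp only [hJ, mul_assoc, ← Finset.mul_sum]
      rw [this]
    rw [e1]
    have e2 : ∑ a, pA a * J a ≤ ∑ a, QA a * J a + dmax * ∑ a, |QA a - pA a| := by
      rw [Finset.mul_sum, ← Finset.sum_add_distrib]
      refine Finset.sum_le_sum fun a _ => ?_
      have a1 := neg_abs_le (QA a - pA a)
      have a2 := abs_nonneg (QA a - pA a)
      nlinarith [hJ0 a, hJ1 a, mul_nonneg a2 (sub_nonneg.2 (hJ1 a)),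
        mul_nonneg (by linarith : 0 ≤ |QA a - pA a| + (QA a - pA a)) (hJ0 a)]
    have e3 : ∑ a, QA a * J a = ∑ m, ∑ a, ∑ w, ν * K (cu m) (cv m) a * κD (cv m) a w *
        cost a (cv (mh w)) w := by
      rw [Finset.sum_comm]
      refine Finset.sum_congr rfl fun a _ => ?_
      simp only [hJ, Finset.mul_sum]
      refine Finset.sum_congr rfl fun m _ => Finset.sum_congr rfl fun w _ => ?_
      rw [← hQpost]
      ring
    classical
    have e4 : ∑ a, QA a * J a ≤ ∑ m, ∑ a, ∑ w, ν * K (cu m) (cv m) a * κD (cv m) a w *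
        (D0 + dmax * (if D0 < cost a (cv m) w then 1 else 0) +
          dmax * (1 - if mh w = m then 1 else 0)) := by
      rw [e3]
      refine Finset.sum_le_sum fun m _ => Finset.sum_le_sum fun a _ =>
        Finset.sum_le_sum fun w _ => mul_le_mul_of_nonneg_left ?_
          (mul_nonneg (mul_nonneg hν0.le ((hK _ _).1 a)) ((hD _ a).1 w))
      by_cases h1 : mh w = m
      · rw [h1]
        by_cases h2 : D0 < cost a (cv m) w
        · simp only [h2, if_true]
          have := hc1 a (cv m) w
          linarith
        · simp only [h2, if_true, if_false]
          linarith
      · simp only [h1, if_false]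
        have := hc1 a (cv (mh w)) w
        have : 0 ≤ dmax * (if D0 < cost a (cv m) w then (1 : ℝ) else 0) := by
          split_ifs <;> simp [hdm]
        linarith
    have f1 : ∑ m, ∑ a, ∑ w, ν * K (cu m) (cv m) a * κD (cv m) a w = 1 := by
      simp only [← Finset.mul_sum, (hD _ _).2, mul_one, (hK _ _).2]
      simp [hν]
      field_simp
    have f2 : ∑ m, ∑ a, ∑ w, ν * K (cu m) (cv m) a * κD (cv m) a w *
          (if D0 < cost a (cv m) w then 1 else 0) =
        Qc (W := Unit) (fun u v _ => ∑ a, ∑ d, K u v a * κD v a d *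
            (if D0 < cost a v d then 1 else 0)) ω () := by
      rw [hQ]
      simp only [Finset.mul_sum, mul_assoc]
    have f3 : ∑ m, ∑ a, ∑ w, ν * K (cu m) (cv m) a * κD (cv m) a w *
          (if mh w = m then 1 else 0) = ∑ w, ν * TD (cu (mh w)) (cv (mh w)) w := by
      have : ∀ m, ∑ a, ∑ w, ν * K (cu m) (cv m) a * κD (cv m) a w *
          (if mh w = m then (1 : ℝ) else 0) =
          ∑ w, (if mh w = m then ν * TD (cu m) (cv m) w else 0) := by
        intro m
        rw [Finset.sum_comm]
        refine Finset.sum_congr rfl fun w _ => ?_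
        by_cases h1 : mh w = m
        · simp only [h1, if_true, mul_one, hTD, Finset.mul_sum, mul_assoc]
        · simp [h1]
      simp only [this]
      rw [Finset.sum_comm]
      refine Finset.sum_congr rfl fun w _ => ?_
      simp
    have e5 : ∑ m, ∑ a, ∑ w, ν * K (cu m) (cv m) a * κD (cv m) a w *
        (D0 + dmax * (if D0 < cost a (cv m) w then 1 else 0) +
          dmax * (1 - if mh w = m then 1 else 0)) =
        D0 * (∑ m, ∑ a, ∑ w, ν * K (cu m) (cv m) a * κD (cv m) a w) +
        dmax * (∑ m, ∑ a, ∑ w, ν * K (cu m) (cv m) a * κD (cv m) a w *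
          (if D0 < cost a (cv m) w then 1 else 0)) +
        dmax * ((∑ m, ∑ a, ∑ w, ν * K (cu m) (cv m) a * κD (cv m) a w) -
          ∑ m, ∑ a, ∑ w, ν * K (cu m) (cv m) a * κD (cv m) a w *
          (if mh w = m then 1 else 0)) := by
      simp only [Finset.mul_sum, ← Finset.sum_sub_distrib, ← Finset.sum_add_distrib]
      refine Finset.sum_congr rfl fun m _ => Finset.sum_congr rfl fun a _ =>
        Finset.sum_congr rfl fun w _ => ?_
      ring
    rw [e5, f1, f2, f3] at e4
    have f4 : ∑ w, ν * ∑ i, ∑ j, TD (ω i).1 ((ω i).2 j) w *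
            (TD (ω i).1 ((ω i).2 j) w / (N1 * N2)) / Qc TD ω w ≤
        ∑ w, ν * TD (cu (mh w)) (cv (mh w)) w := by
      refine Finset.sum_le_sum fun w _ => mul_le_mul_of_nonneg_left ?_ hν0.le
      have g1 : ∑ i, ∑ j, TD (ω i).1 ((ω i).2 j) w *
            (TD (ω i).1 ((ω i).2 j) w / (N1 * N2)) / Qc TD ω w =
          ∑ m, TD (cu m) (cv m) w * ((ν * TD (cu m) (cv m) w) / Qc TD ω w) := by
        rw [Fintype.sum_prod_type]
        refine Finset.sum_congr rfl fun i _ => Finset.sum_congr rfl fun j _ => ?_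
        simp only [hν, hcu, hcv]
        ring
      rw [g1]
      have hq0 := Qc_nonneg hTD0 ω w
      calc ∑ m, TD (cu m) (cv m) w * ((ν * TD (cu m) (cv m) w) / Qc TD ω w)
          ≤ ∑ m, TD (cu (mh w)) (cv (mh w)) w * ((ν * TD (cu m) (cv m) w) / Qc TD ω w) :=
            Finset.sum_le_sum fun m _ => mul_le_mul_of_nonneg_right (hmh w m)
              (div_nonneg (mul_nonneg hν0.le (hTD0 _ _ _)) hq0)
        _ = TD (cu (mh w)) (cv (mh w)) w * (Qc TD ω w / Qc TD ω w) := by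
            rw [← Finset.mul_sum, ← Finset.sum_div, ← hQ]
        _ ≤ TD (cu (mh w)) (cv (mh w)) w * 1 :=
            mul_le_mul_of_nonneg_left (div_self_le_one _) (hTD0 _ _ _)
        _ = _ := mul_one _
    have f5 := mul_le_mul_of_nonneg_left f4 hdm
    change ∑ a, pA a * J a ≤ D0 + dmax * (∑ a, |QA a - pA a| + _ +
      (1 - ∑ w, ν * ∑ i, ∑ j, TD (ω i).1 ((ω i).2 j) w *
            (TD (ω i).1 ((ω i).2 j) w / (N1 * N2)) / Qc TD ω w))
    linarith
  · -- equivocation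
    set k : A → G → ℝ := fun a g => ∑ m, post a m * κG (cv m) a g with hk
    have hkk : IsKernel k := by
      intro a
      refine ⟨fun g => Finset.sum_nonneg fun m _ => mul_nonneg ((hpost a).1 m) ((hG _ a).1 g), ?_⟩
      simp only [hk]
      rw [Finset.sum_comm]
      simp only [← Finset.mul_sum, (hG _ _).2, mul_one, (hpost a).2]
    have e1 : (fun w : A × G => pA w.1 * ∑ v, pushf (post w.1) cv v * κG v w.1 w.2) =
        fun w => pA w.1 * k w.1 w.2 := by
      funext w
      rw [epush w.1 (fun v => κG v w.1 w.2)]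
    have e2 : Qc (fun u v (w : A × G) => K u v w.1 * κG v w.1 w.2) ω =
        fun w => QA w.1 * k w.1 w.2 := by
      funext w
      rw [hQ]
      simp only [hk, Finset.mul_sum]
      refine Finset.sum_congr rfl fun m _ => ?_
      rw [← mul_assoc, ← mul_assoc, hQpost]
    rw [e1, e2]
    exact hh_change hpA hQA hkk

end OSMain

section OSMain2

variable {U V A D G : Type} [Fintype U] [Fintype V] [Fintype A] [Fintype D] [Fintype G]
variable {pU : U → ℝ} {pV : U → V → ℝ}

lemma os_main [Nonempty A] (hU : IsPMF pU) (hV : IsKernel pV)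
    {N1 N2 : ℕ} (hN1 : 0 < N1) (hN2 : 0 < N2)
    {K : U → V → A → ℝ} (hK : ∀ u v, IsPMF (K u v))
    {κD : V → A → D → ℝ} (hD : ∀ v a, IsPMF (κD v a))
    {κG : V → A → G → ℝ} (hG : ∀ v a, IsPMF (κG v a))
    {cost : A → V → D → ℝ} {dmax D0 : ℝ} (hc0 : ∀ a v d, 0 ≤ cost a v d)
    (hc1 : ∀ a v d, cost a v d ≤ dmax) (hD0 : 0 ≤ D0) (hdm : 0 ≤ dmax)
    {TD : U → V → D → ℝ} (hTD : ∀ u v w, TD u v w = ∑ a, K u v a * κD v a w)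
    {TG : U → V → A × G → ℝ} (hTG : ∀ u v w, TG u v w = K u v w.1 * κG v w.1 w.2)
    {α1 α2 β1 β2 : ℝ} (hα1 : 0 < α1 ∧ α1 ≤ 1) (hα2 : 0 < α2 ∧ α2 ≤ 1)
    (hβ1 : 0 < β1 ∧ β1 ≤ 1) (hβ2 : 0 < β2 ∧ β2 ≤ 1)
    {e1 e2 e3 e4 e5 L κ η : ℝ} (hκ : 0 < κ)
    (he1 : EX pU pV K (fun u v w => (K u v w / (N1 * N2) / m0 pU pV K w) ^ α1) ≤ e1)
    (he2 : EX pU pV K (fun u _ w => (m1 pV K u w / N1 / m0 pU pV K w) ^ α2) ≤ e2)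
    (he3 : EX pU pV TD (fun u v w => (m1 pV TD u w / N1 / (TD u v w / (N1 * N2))) ^ β1) ≤ e3)
    (he4 : EX pU pV TD (fun u v w => (m0 pU pV TD w / (TD u v w / (N1 * N2))) ^ β2) ≤ e4)
    (he5 : EC pU pV (fun u v => ∑ a, ∑ d, K u v a * κD v a d *
            (if D0 < cost a v d then 1 else 0)) ≤ e5)
    (hL : EX pU pV TG (fun u v w => Real.log (1 + TG u v w / N2 / m1 pV TG u w)) ≤ L)
    (hη : κ * (2 * e1 + 2 * e2 + e3 + e4 + e5) + L + Real.log (Fintype.card A) ≤ κ * η) :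
    ∃ (enc : A → V → ℝ) (dec : D → V), IsKernel enc ∧
      (∑ a, ∑ v, ∑ d, m0 pU pV K a * enc a v * κD v a d * cost a (dec d) d ≤
        D0 + dmax * (Real.sqrt (2 * η) + 2 * η)) ∧
      ∑ u, pU u * hh (m1 pV TG u) - κ * (2 * e1 + 2 * e2 + e3 + e4 + e5) - L -
        Real.sqrt (2 * η) * Real.log (Fintype.card A) - Real.log 2 ≤
        hh (fun w : A × G => m0 pU pV K w.1 * ∑ v, enc w.1 v * κG v w.1 w.2) := by
  have hpA := m0_isPMF hU hV hK
  have hTDp : ∀ u v, IsPMF (TD u v) := by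
    intro u v
    refine ⟨fun w => ?_, ?_⟩
    · rw [hTD]
      exact Finset.sum_nonneg fun a _ => mul_nonneg ((hK u v).1 a) ((hD v a).1 w)
    · simp only [hTD]
      rw [Finset.sum_comm]
      simp only [← Finset.mul_sum, (hD _ _).2, mul_one, (hK u v).2]
  have hTGp : ∀ u v, IsPMF (TG u v) := by
    intro u v
    refine ⟨fun w => ?_, ?_⟩
    · rw [hTG]
      exact mul_nonneg ((hK u v).1 _) ((hG v _).1 _)
    · rw [Fintype.sum_prod_type]
      simp only [hTG, ← Finset.mul_sum, (hG _ _).2, mul_one, (hK u v).2]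
  set pA := m0 pU pV K with hpAdef
  set X1 : (Fin N1 → U × (Fin N2 → V)) → ℝ := fun ω =>
    ∑ a, (Qc K ω a - pA a) ^ 2 / (Qc K ω a + pA a) with hX1
  set X2 : (Fin N1 → U × (Fin N2 → V)) → ℝ := fun ω =>
    1 - ∑ w, ((N1 : ℝ) * N2)⁻¹ * ∑ i, ∑ j, TD (ω i).1 ((ω i).2 j) w *
        (TD (ω i).1 ((ω i).2 j) w / (N1 * N2)) / Qc TD ω w with hX2
  set φ : U → V → Unit → ℝ := fun u v _ => ∑ a, ∑ d, K u v a * κD v a d *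
            (if D0 < cost a v d then 1 else 0) with hφ
  set X4 : (Fin N1 → U × (Fin N2 → V)) → ℝ := fun ω => Qc φ ω () with hX4
  have b1 := os_cover hU hV hN1 hN2 (fun u v => (hK u v).1) (fun u v => (hK u v).2)
    hα1.1 hα1.2 hα2.1 hα2.2
  have b2 := os_decode hU hV hN1 hN2 (fun u v => (hTDp u v).1) (fun u v => (hTDp u v).2)
    hβ1.1 hβ1.2 hβ2.1 hβ2.2
  have b3 := os_equiv hU hV hN1 hN2 (fun u v => (hTGp u v).1)
  have b4 : ∑ ω : Fin N1 → U × (Fin N2 → V), cw pU pV ω * X4 ω = _ :=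
    E_avg_eq hU hV hN1 hN2 (fun u v => φ u v ())
  have hsum : ∑ ω : Fin N1 → U × (Fin N2 → V), cw pU pV ω *
      (κ * (X1 ω + X2 ω + X4 ω) + (∑ u, pU u * hh (m1 pV TG u) - hh (Qc TG ω))) ≤
      κ * (2 * e1 + 2 * e2 + e3 + e4 + e5) + L := by
    have c1 : ∑ ω : Fin N1 → U × (Fin N2 → V), cw pU pV ω *
      (κ * (X1 ω + X2 ω + X4 ω) + (∑ u, pU u * hh (m1 pV TG u) - hh (Qc TG ω))) =
      κ * (∑ ω : Fin N1 → U × (Fin N2 → V), cw pU pV ω * X1 ω +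
        ∑ ω : Fin N1 → U × (Fin N2 → V), cw pU pV ω * X2 ω +
        ∑ ω : Fin N1 → U × (Fin N2 → V), cw pU pV ω * X4 ω) +
      ((∑ ω : Fin N1 → U × (Fin N2 → V), cw pU pV ω) * ∑ u, pU u * hh (m1 pV TG u) -
        ∑ ω : Fin N1 → U × (Fin N2 → V), cw pU pV ω * hh (Qc TG ω)) := by
      rw [Finset.sum_mul, ← Finset.sum_sub_distrib, ← Finset.sum_add_distrib,
        ← Finset.sum_add_distrib, Finset.mul_sum, ← Finset.sum_add_distrib]
      refine Finset.sum_congr rfl fun ω _ => ?_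
      ring
    rw [c1, (cw_isPMF hU hV).2]
    have c2 : ∑ ω : Fin N1 → U × (Fin N2 → V), cw pU pV ω * X1 ω +
        ∑ ω : Fin N1 → U × (Fin N2 → V), cw pU pV ω * X2 ω +
        ∑ ω : Fin N1 → U × (Fin N2 → V), cw pU pV ω * X4 ω ≤
        2 * e1 + 2 * e2 + e3 + e4 + e5 := by
      rw [b4]
      linarith
    have c3 := mul_le_mul_of_nonneg_left c2 hκ.le
    linarith
  obtain ⟨ω, hω⟩ := exists_le_of_avg (cw_isPMF hU hV) _ hsum
  have hQApmf : IsPMF (Qc K ω) := ⟨Qc_nonneg (fun u v => (hK u v).1) ω,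
    Qc_sum hN1 hN2 (fun u v => (hK u v).2) ω⟩
  have x1 : 0 ≤ X1 ω := Finset.sum_nonneg fun a _ =>
    div_nonneg (sq_nonneg _) (add_nonneg (hQApmf.1 a) (hpA.1 a))
  have x4 : 0 ≤ X4 ω := by
    refine Qc_nonneg (fun u v w => ?_) ω ()
    refine Finset.sum_nonneg fun a _ => Finset.sum_nonneg fun d _ =>
      mul_nonneg (mul_nonneg ((hK u v).1 a) ((hD v a).1 d)) ?_
    split_ifs <;> norm_num
  have x2 : 0 ≤ X2 ω := by
    have n1 : (0 : ℝ) < N1 := by positivity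
    have n2 : (0 : ℝ) < N2 := by positivity
    have : ∑ w, ((N1 : ℝ) * N2)⁻¹ * ∑ i, ∑ j, TD (ω i).1 ((ω i).2 j) w *
        (TD (ω i).1 ((ω i).2 j) w / (N1 * N2)) / Qc TD ω w ≤ ∑ w, Qc TD ω w := by
      refine Finset.sum_le_sum fun w _ => ?_
      refine mul_le_mul_of_nonneg_left ?_ (by positivity)
      refine Finset.sum_le_sum fun i _ => Finset.sum_le_sum fun j _ => ?_
      rw [mul_div_assoc]
      refine mul_le_of_le_one_right ((hTDp _ _).1 _) ?_
      refine div_le_one_of_le₀ ?_ (Qc_nonneg (fun u v => (hTDp u v).1) ω w)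
      rw [Qc, div_eq_inv_mul]
      refine mul_le_mul_of_nonneg_left ?_ (by positivity)
      have g1 : TD (ω i).1 ((ω i).2 j) w ≤ ∑ j', TD (ω i).1 ((ω i).2 j') w :=
        Finset.single_le_sum (f := fun j' => TD (ω i).1 ((ω i).2 j') w)
          (fun _ _ => (hTDp _ _).1 _) (Finset.mem_univ j)
      have g2 : ∑ j', TD (ω i).1 ((ω i).2 j') w ≤ ∑ i', ∑ j', TD (ω i').1 ((ω i').2 j') w :=
        Finset.single_le_sum (f := fun i' => ∑ j', TD (ω i').1 ((ω i').2 j') w)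
          (fun _ _ => Finset.sum_nonneg fun _ _ => (hTDp _ _).1 _) (Finset.mem_univ i)
      linarith
    rw [Qc_sum hN1 hN2 (fun u v => (hTDp u v).2) ω] at this
    simp only [hX2]
    linarith
  have hHU : 0 ≤ ∑ u, pU u * hh (m1 pV TG u) := Finset.sum_nonneg fun u _ =>
    mul_nonneg (hU.1 u) (hh_nonneg (m1_nonneg hV (fun u v => (hTGp u v).1) u))
  have hhQ : hh (Qc TG ω) ≤ Real.log (Fintype.card A) := by
    have := hh_le_card (Qc_nonneg (fun u v => (hTGp u v).1) ω)
    rwa [Qc_sum hN1 hN2 (fun u v => (hTGp u v).2) ω, one_mul] at this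
  have hXη : X1 ω + X2 ω + X4 ω ≤ η := by
    have : κ * (X1 ω + X2 ω + X4 ω) ≤ κ * η := by linarith
    exact le_of_mul_le_mul_left this hκ
  have htv := tv_le hpA hQApmf (by linarith : X1 ω ≤ η)
  have hκX : 0 ≤ κ * (X1 ω + X2 ω + X4 ω) := by positivity
  obtain ⟨enc, dec, h1, h2, h3⟩ := os_det hN1 hN2 hK hD hG hc0 hc1 hD0 hpA ω
  refine ⟨enc, dec, h1, h2.trans ?_, ?_⟩
  · have hTD' : TD = fun u v w => ∑ a, K u v a * κD v a w := by
      funext u v w; exact hTD u v w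
    have : ∑ a, |Qc K ω a - pA a| + X4 ω + X2 ω ≤ Real.sqrt (2 * η) + 2 * η := by linarith
    have := mul_le_mul_of_nonneg_left this hdm
    simp only [hX2, hX4, hφ, hTD'] at this
    linarith
  · refine le_trans ?_ h3
    have hTG' : TG = fun u v w => K u v w.1 * κG v w.1 w.2 := by
      funext u v w; exact hTG u v w
    rw [← hTG']
    have := mul_le_mul_of_nonneg_right htv (Real.log_natCast_nonneg (Fintype.card A))
    linarith

end OSMain2

/-! ### Block (i.i.d.) versions -/

section Block

variable {U V W : Type} [Fintype U] [Fintype V] [Fintype W]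

/-- product law -/
noncomputable def pU' (pU : U → ℝ) (n : ℕ) (u : Fin n → U) : ℝ := ∏ i, pU (u i)

/-- product kernel -/
noncomputable def pV' (pV : U → V → ℝ) (n : ℕ) (u : Fin n → U) (v : Fin n → V) : ℝ :=
  ∏ i, pV (u i) (v i)

/-- product kernel with reindexed output -/
noncomputable def T' (T : U → V → W → ℝ) {n : ℕ} {Wn : Type} (e : Wn ≃ (Fin n → W))
    (u : Fin n → U) (v : Fin n → V) (w : Wn) : ℝ := ∏ i, T (u i) (v i) (e w i)

variable {pU : U → ℝ} {pV : U → V → ℝ}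

lemma pU'_isPMF (hU : IsPMF pU) (n : ℕ) : IsPMF (pU' pU n) := by
  refine ⟨fun u => Finset.prod_nonneg fun i _ => hU.1 _, ?_⟩
  unfold pU'
  rw [← Fintype.prod_sum (fun _ x => pU x)]
  simp [hU.2]

lemma pV'_isKernel (hV : IsKernel pV) (n : ℕ) : IsKernel (pV' pV n) := by
  intro u
  refine ⟨fun v => Finset.prod_nonneg fun i _ => (hV _).1 _, ?_⟩
  unfold pV'
  rw [← Fintype.prod_sum (fun i x => pV (u i) x)]
  simp [(hV _).2]

lemma T'_isPMF {T : U → V → W → ℝ} (hT : ∀ u v, IsPMF (T u v)) {n : ℕ} {Wn : Type} [Fintype Wn]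
    (e : Wn ≃ (Fin n → W)) (u : Fin n → U) (v : Fin n → V) : IsPMF (T' T e u v) := by
  refine ⟨fun w => Finset.prod_nonneg fun i _ => (hT _ _).1 _, ?_⟩
  unfold T'
  rw [e.sum_comp (fun w => ∏ i, T (u i) (v i) (w i)),
    ← Fintype.prod_sum (fun i x => T (u i) (v i) x)]
  simp [(hT _ _).2]

lemma m1_block (T : U → V → W → ℝ) {n : ℕ} {Wn : Type} [Fintype Wn]
    (e : Wn ≃ (Fin n → W)) (u : Fin n → U) (w : Wn) :
    m1 (pV' pV n) (T' T e) u w = ∏ i, m1 pV T (u i) (e w i) := by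
  unfold m1 pV' T'
  simp only [← Finset.prod_mul_distrib]
  rw [← Fintype.prod_sum (fun i x => pV (u i) x * T (u i) x (e w i))]

lemma m0_block (T : U → V → W → ℝ) {n : ℕ} {Wn : Type} [Fintype Wn]
    (e : Wn ≃ (Fin n → W)) (w : Wn) :
    m0 (pU' pU n) (pV' pV n) (T' T e) w = ∏ i, m0 pU pV T (e w i) := by
  simp only [m0_eq, m1_block]
  unfold pU'
  simp only [← Finset.prod_mul_distrib]
  rw [← Fintype.prod_sum (fun i x => pU x * m1 pV T x (e w i))]

/-- joint single-letter law -/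
noncomputable def qj (pU : U → ℝ) (pV : U → V → ℝ) (T : U → V → W → ℝ) (x : U × V × W) : ℝ :=
  pU x.1 * pV x.1 x.2.1 * T x.1 x.2.1 x.2.2

lemma EX_eq_qj (T f : U → V → W → ℝ) :
    EX pU pV T f = ∑ x, qj pU pV T x * f x.1 x.2.1 x.2.2 := by
  unfold EX EC qj
  rw [Finset.sum_comm]
  rw [Fintype.sum_prod_type]
  refine Finset.sum_congr rfl fun u _ => ?_
  rw [Finset.sum_comm, Fintype.sum_prod_type]
  refine Finset.sum_congr rfl fun v _ => Finset.sum_congr rfl fun w _ => ?_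
  simp only
  ring

lemma qj_isPMF (hU : IsPMF pU) (hV : IsKernel pV) {T : U → V → W → ℝ}
    (hT : ∀ u v, IsPMF (T u v)) : IsPMF (qj pU pV T) := by
  refine ⟨fun x => mul_nonneg (mul_nonneg (hU.1 _) ((hV _).1 _)) ((hT _ _).1 _), ?_⟩
  have := EX_one hU hV (T := T) fun u v => (hT u v).2
  rw [EX_eq_qj] at this
  simpa using this

/-- zipping three sequences -/
def zip3 {n : ℕ} {Wn : Type} (e : Wn ≃ (Fin n → W)) :
    (Fin n → U × V × W) ≃ (Fin n → U) × (Fin n → V) × Wn where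
  toFun x := (fun i => (x i).1, fun i => (x i).2.1, e.symm fun i => (x i).2.2)
  invFun y := fun i => (y.1 i, y.2.1 i, e y.2.2 i)
  left_inv x := by simp
  right_inv y := by simp

lemma EX_block (T : U → V → W → ℝ) {n : ℕ} {Wn : Type} [Fintype Wn] (e : Wn ≃ (Fin n → W))
    (F : (Fin n → U) → (Fin n → V) → Wn → ℝ) :
    EX (pU' pU n) (pV' pV n) (T' T e) F =
      ∑ x : Fin n → U × V × W, (∏ i, qj pU pV T (x i)) *
        F (fun i => (x i).1) (fun i => (x i).2.1) (e.symm fun i => (x i).2.2) := by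
  rw [EX_eq_qj, ← (zip3 (U := U) (V := V) e).sum_comp]
  refine Finset.sum_congr rfl fun x _ => ?_
  simp [zip3, qj, pU', pV', T', Finset.prod_mul_distrib]

lemma EX_block_prod (T f : U → V → W → ℝ) {n : ℕ} {Wn : Type} [Fintype Wn]
    (e : Wn ≃ (Fin n → W)) :
    EX (pU' pU n) (pV' pV n) (T' T e) (fun u v w => ∏ i, f (u i) (v i) (e w i)) =
      (EX pU pV T f) ^ n := by
  rw [EX_block, EX_eq_qj]
  simp only [Equiv.apply_symm_apply, ← Finset.prod_mul_distrib]
  rw [← Fintype.prod_sum (fun (_ : Fin n) (x : U × V × W) =>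
    qj pU pV T x * f x.1 x.2.1 x.2.2)]
  simp

lemma EX_block_sum (hU : IsPMF pU) (hV : IsKernel pV) {T : U → V → W → ℝ}
    (hT : ∀ u v, IsPMF (T u v)) (f : U → V → W → ℝ) {n : ℕ} {Wn : Type} [Fintype Wn]
    (e : Wn ≃ (Fin n → W)) :
    EX (pU' pU n) (pV' pV n) (T' T e) (fun u v w => ∑ i, f (u i) (v i) (e w i)) =
      n * EX pU pV T f := by
  rw [EX_block, EX_eq_qj]
  simp only [Equiv.apply_symm_apply, Finset.mul_sum]
  rw [Finset.sum_comm]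
  have := fun i => prodw_single (N := n) (qj_isPMF hU hV hT).2
    (fun x : U × V × W => f x.1 x.2.1 x.2.2) i
  rw [Finset.sum_congr rfl fun i _ => this i]
  simp [Finset.mul_sum]

lemma block_moment (hU : IsPMF pU) (hV : IsKernel pV) {T : U → V → W → ℝ}
    (hT : ∀ u v, IsPMF (T u v)) (r : U → V → W → ℝ)
    (hr : ∀ u v w, pU u ≠ 0 → pV u v ≠ 0 → T u v w ≠ 0 → 0 < r u v w)
    (hneg : EX pU pV T (fun u v w => Real.log (r u v w)) < 0) :
    ∃ θ ρ : ℝ, (0 < θ ∧ θ ≤ 1) ∧ (0 ≤ ρ ∧ ρ < 1) ∧ ∀ (n : ℕ) (Wn : Type) [Fintype Wn]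
      (e : Wn ≃ (Fin n → W)),
      EX (pU' pU n) (pV' pV n) (T' T e) (fun u v w => (∏ i, r (u i) (v i) (e w i)) ^ θ) ≤ ρ ^ n := by
  have hq := qj_isPMF hU hV hT
  have hr' : ∀ x : U × V × W, qj pU pV T x ≠ 0 → 0 < r x.1 x.2.1 x.2.2 := by
    intro x hx
    have h1 := left_ne_zero_of_mul hx
    exact hr _ _ _ (left_ne_zero_of_mul h1) (right_ne_zero_of_mul h1) (right_ne_zero_of_mul hx)
  rw [EX_eq_qj] at hneg
  obtain ⟨θ, h0, h1, h2⟩ := chernoff hq (fun x => r x.1 x.2.1 x.2.2) hr' hneg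
  refine ⟨θ, _, ⟨h0, h1⟩, ⟨Finset.sum_nonneg fun x _ => ?_, h2⟩, ?_⟩
  · by_cases hz : qj pU pV T x = 0
    · simp [hz]
    · exact mul_nonneg (hq.1 x) (Real.rpow_nonneg (hr' x hz).le _)
  · intro n Wn _ e
    have e1 := EX_block_prod (pU := pU) (pV := pV) T (fun u v w => r u v w ^ θ) e
    rw [EX_eq_qj (pU := pU)] at e1
    rw [← e1]
    refine EX_mono (pU'_isPMF hU n) (pV'_isKernel hV n) (fun u v => (T'_isPMF hT e u v).1) ?_
    intro u v w a1 a2 a3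
    unfold pU' at a1
    unfold pV' at a2
    unfold T' at a3
    rw [Finset.prod_ne_zero_iff] at a1 a2 a3
    rw [Real.finsetProd_rpow]
    intro i hi
    exact (hr _ _ _ (a1 i hi) (a2 i hi) (a3 i hi)).le

lemma log_one_add_le {s θ : ℝ} (hs : 0 ≤ s) (h0 : 0 < θ) (h1 : θ ≤ 1) :
    Real.log (1 + s) ≤ s ^ θ / θ := by
  rw [le_div_iff₀ h0, mul_comm, ← Real.log_rpow (by linarith)]
  have a : (1 + s) ^ θ ≤ 1 + s ^ θ := by
    have := Real.rpow_add_le_add_rpow zero_le_one hs h0.le h1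
    simpa using this
  have b : 0 ≤ s ^ θ := Real.rpow_nonneg hs θ
  have c : 0 < (1 + s) ^ θ := Real.rpow_pos_of_pos (by linarith) θ
  calc Real.log ((1 + s) ^ θ) ≤ Real.log (1 + s ^ θ) := Real.log_le_log c a
    _ ≤ (1 + s ^ θ) - 1 := Real.log_le_sub_one_of_pos (by linarith)
    _ = s ^ θ := by ring

/-- sizes of the codebooks -/
lemma exists_size {R : ℝ} (hR : 0 ≤ R) (n : ℕ) :
    ∃ N : ℕ, 0 < N ∧ Real.exp (n * R) ≤ N ∧ (N : ℝ) ≤ 2 * Real.exp (n * R) := by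
  have h1 : 1 ≤ Real.exp (n * R) := Real.one_le_exp (by positivity)
  refine ⟨⌈Real.exp (n * R)⌉₊, Nat.ceil_pos.2 (by linarith), Nat.le_ceil _, ?_⟩
  have := Nat.ceil_lt_add_one (by linarith : 0 ≤ Real.exp (n * R))
  linarith

end Block

section BlockHH

variable {U V A G : Type} [Fintype U] [Fintype V] [Fintype A] [Fintype G]
variable {pU : U → ℝ} {pV : U → V → ℝ}

lemma HU_eq (T : U → V → A × G → ℝ) :
    ∑ u, pU u * hh (m1 pV T u) = EX pU pV T (fun u _ w =>
      Real.log (∑ a, m1 pV T u (a, w.2)) - Real.log (m1 pV T u w)) := by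
  unfold EX EC
  rw [Finset.sum_comm]
  refine Finset.sum_congr rfl fun u _ => ?_
  have e1 : hh (m1 pV T u) = ∑ w : A × G, m1 pV T u w *
      (Real.log (∑ a, m1 pV T u (a, w.2)) - Real.log (m1 pV T u w)) := by
    rw [Fintype.sum_prod_type_right]
    simp only [hh, h1_eq]
  rw [e1, Finset.mul_sum]
  refine Finset.sum_congr rfl fun w _ => ?_
  beta_reduce
  generalize Real.log (∑ a, m1 pV T u (a, w.2)) - Real.log (m1 pV T u w) = c
  unfold m1
  rw [Finset.sum_mul, Finset.mul_sum]
  refine Finset.sum_congr rfl fun v _ => ?_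
  ring

/-- reindexing of pairs of sequences -/
def zip2 {n : ℕ} {Gn : Type} (e : Gn ≃ (Fin n → G)) :
    ((Fin n → A) × Gn) ≃ (Fin n → A × G) where
  toFun y := fun i => (y.1 i, e y.2 i)
  invFun x := (fun i => (x i).1, e.symm fun i => (x i).2)
  left_inv x := by simp
  right_inv y := by simp

lemma HU_block (hU : IsPMF pU) (hV : IsKernel pV) {T : U → V → A × G → ℝ}
    (hT : ∀ u v, IsPMF (T u v)) {n : ℕ} {Gn : Type} [Fintype Gn] (e : Gn ≃ (Fin n → G)) :
    ∑ u, pU' pU n u * hh (m1 (pV' pV n) (T' T (zip2 e)) u) =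
      n * ∑ u, pU u * hh (m1 pV T u) := by
  rw [HU_eq, HU_eq, ← EX_block_sum hU hV hT _ (zip2 e)]
  apply le_antisymm
  all_goals
    refine EX_mono (pU'_isPMF hU n) (pV'_isKernel hV n) (fun u v => (T'_isPMF hT _ u v).1) ?_
    intro u v w a1 a2 a3
    apply le_of_eq
    unfold pU' at a1
    unfold pV' at a2
    unfold T' at a3
    rw [Finset.prod_ne_zero_iff] at a1 a2 a3
    have hp := fun i => (pos_of_supp hU hV (fun u v => (hT u v).1) (a1 i (Finset.mem_univ i))
      (a2 i (Finset.mem_univ i)) (a3 i (Finset.mem_univ i))).2.1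
    have e1 : ∑ a, m1 (pV' pV n) (T' T (zip2 e)) u (a, w.2) =
        ∏ i, ∑ a, m1 pV T (u i) (a, (zip2 e w i).2) := by
      simp only [m1_block]
      rw [Fintype.prod_sum]
      rfl
    have hm : ∀ i, 0 < ∑ a, m1 pV T (u i) (a, (zip2 e w i).2) := fun i =>
      lt_of_lt_of_le (hp i) (Finset.single_le_sum
        (f := fun a => m1 pV T (u i) (a, (zip2 e w i).2))
        (fun a _ => m1_nonneg hV (fun u v => (hT u v).1) _ _) (Finset.mem_univ (zip2 e w i).1))
    rw [e1, m1_block, Real.log_prod fun i _ => (hm i).ne', Real.log_prod fun i _ => (hp i).ne',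
      Finset.sum_sub_distrib]

end BlockHH

/-! ### Block core -/

section Core0

variable {U V W : Type} [Fintype U] [Fintype V] [Fintype W]
variable {pU : U → ℝ} {pV : U → V → ℝ}

lemma block_moment2 (hU : IsPMF pU) (hV : IsKernel pV) {T : U → V → W → ℝ}
    (hT : ∀ u v, IsPMF (T u v)) (r : U → V → W → ℝ)
    (hr : ∀ u v w, pU u ≠ 0 → pV u v ≠ 0 → T u v w ≠ 0 → 0 < r u v w) (c : ℝ)
    (hneg : EX pU pV T (fun u v w => Real.log (r u v w)) + c < 0) :
    ∃ θ ρ : ℝ, (0 < θ ∧ θ ≤ 1) ∧ (0 ≤ ρ ∧ ρ < 1) ∧ ∀ (n : ℕ) (Wn : Type) [Fintype Wn]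
      (e : Wn ≃ (Fin n → W)) (F : (Fin n → U) → (Fin n → V) → Wn → ℝ) (C : ℝ), 0 ≤ C →
      (∀ u v w, (∀ i, pU (u i) ≠ 0) → (∀ i, pV (u i) (v i) ≠ 0) →
        (∀ i, T (u i) (v i) (e w i) ≠ 0) →
        F u v w ≤ C * ((∏ i, r (u i) (v i) (e w i)) * Real.exp (n * c)) ^ θ) →
      EX (pU' pU n) (pV' pV n) (T' T e) F ≤ C * ρ ^ n := by
  obtain ⟨θ, ρ, hθ, hρ, hm⟩ := block_moment hU hV hT (fun u v w => r u v w * Real.exp c)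
    (fun u v w a b c => mul_pos (hr u v w a b c) (Real.exp_pos _)) (by
      refine lt_of_le_of_lt ?_ hneg
      have h1 := EX_one hU hV (T := T) fun u v => (hT u v).2
      have h2 := EX_smul (pU := pU) (pV := pV) c T (fun _ _ _ => 1)
      rw [h1, mul_one] at h2
      conv_rhs => rw [← h2]
      rw [← EX_add]
      refine EX_mono hU hV (fun u v => (hT u v).1) fun u v w a1 a2 a3 => ?_
      rw [Real.log_mul (hr u v w a1 a2 a3).ne' (Real.exp_pos _).ne', Real.log_exp])
  refine ⟨θ, ρ, hθ, hρ, fun n Wn _ e F C hC hF => ?_⟩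
  have h3 := hm n Wn e
  calc EX (pU' pU n) (pV' pV n) (T' T e) F ≤ EX (pU' pU n) (pV' pV n) (T' T e)
        (fun u v w => C * (∏ i, r (u i) (v i) (e w i) * Real.exp c) ^ θ) := by
        refine EX_mono (pU'_isPMF hU n) (pV'_isKernel hV n) (fun u v => (T'_isPMF hT e u v).1) ?_
        intro u v w a1 a2 a3
        unfold pU' at a1
        unfold pV' at a2
        unfold T' at a3
        rw [Finset.prod_ne_zero_iff] at a1 a2 a3
        have := hF u v w (fun i => a1 i (Finset.mem_univ i)) (fun i => a2 i (Finset.mem_univ i))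
          (fun i => a3 i (Finset.mem_univ i))
        rw [Finset.prod_mul_distrib, Finset.prod_const, Finset.card_univ, Fintype.card_fin,
          ← Real.exp_nat_mul]
        exact this
    _ ≤ C * ρ ^ n := by
        rw [EX_smul]
        exact mul_le_mul_of_nonneg_left h3 hC

lemma two_rpow_le {C x β : ℝ} (hC : 1 ≤ C) (hx : 0 ≤ x) (h1 : β ≤ 1) :
    (C * x) ^ β ≤ C * x ^ β := by
  rw [Real.mul_rpow (by linarith) hx]
  refine mul_le_mul_of_nonneg_right ?_ (Real.rpow_nonneg hx _)
  calc C ^ β ≤ C ^ (1 : ℝ) := Real.rpow_le_rpow_of_exponent_le hC h1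
    _ = C := Real.rpow_one C

end Core0

section Core

variable {U V A D G : Type} [Fintype U] [Fintype V] [Fintype A] [Fintype D] [Fintype G]
variable {pU : U → ℝ} {pV : U → V → ℝ}

/-- Pure analysis part of the choice of parameters. -/
lemma choose_params (dmax lA τ θ ε : ℝ) (hdm : 0 ≤ dmax) (hlA : 0 ≤ lA) (hτ : 0 ≤ τ) (hθ : 0 < θ)
    (hε : 0 < ε) (S r : ℕ → ℝ) (hS : Filter.Tendsto S Filter.atTop (nhds 0))
    (hr : Filter.Tendsto r Filter.atTop (nhds 0)) :
    ∃ (n : ℕ) (κ η : ℝ), 0 < n ∧ 0 < κ ∧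
      κ * S n + (n * τ + r n / θ) + n * lA ≤ κ * η ∧
      dmax * (Real.sqrt (2 * η) + 2 * η) ≤ ε ∧
      κ * S n + (n * τ + r n / θ) + Real.sqrt (2 * η) * (n * lA) + Real.log 2 ≤ n * (τ + ε) := by
  have hη : ∃ η : ℝ, 0 < η ∧ dmax * (Real.sqrt (2 * η) + 2 * η) ≤ ε ∧
      Real.sqrt (2 * η) * lA ≤ ε / 4 := by
    have c1 : Filter.Tendsto (fun η : ℝ => dmax * (Real.sqrt (2 * η) + 2 * η))
        (nhdsWithin 0 (Set.Ioi 0)) (nhds 0) := by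
      have : Continuous (fun η : ℝ => dmax * (Real.sqrt (2 * η) + 2 * η)) := by fun_prop
      have h := this.tendsto 0
      simp only [mul_zero, Real.sqrt_zero, add_zero] at h
      exact h.mono_left nhdsWithin_le_nhds
    have c2 : Filter.Tendsto (fun η : ℝ => Real.sqrt (2 * η) * lA)
        (nhdsWithin 0 (Set.Ioi 0)) (nhds 0) := by
      have : Continuous (fun η : ℝ => Real.sqrt (2 * η) * lA) := by fun_prop
      have h := this.tendsto 0
      simp only [mul_zero, Real.sqrt_zero, zero_mul] at h
      exact h.mono_left nhdsWithin_le_nhds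
    have e1 := c1.eventually (eventually_le_nhds hε)
    have e2 := c2.eventually (eventually_le_nhds (by positivity : (0:ℝ) < ε / 4))
    obtain ⟨η, h1, h2, h3⟩ := (e1.and (e2.and self_mem_nhdsWithin)).exists
    exact ⟨η, h3, h1, h2⟩
  obtain ⟨η, hη0, hη1, hη2⟩ := hη
  set K0 := 2 * (τ + 1 + lA) / η with hK0
  have hK0p : 0 < K0 := by positivity
  have t1 := hS.eventually (eventually_le_nhds (by positivity : 0 < min (η / 2) (ε / (8 * K0))))
  have t2 := hr.eventually (eventually_le_nhds (by positivity : 0 < min θ (θ * ε / 4)))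
  have t3 : Filter.Tendsto (fun n : ℕ => (n : ℝ)) Filter.atTop Filter.atTop :=
    tendsto_natCast_atTop_atTop
  have t4 := t3.eventually (Filter.eventually_ge_atTop (8 * Real.log 2 / ε + 1))
  obtain ⟨n, h1, h2, h4⟩ := (t1.and (t2.and t4)).exists
  have hl2 : 0 < Real.log 2 := Real.log_pos (by norm_num)
  have hn1 : (1 : ℝ) ≤ n := by
    have : 0 ≤ 8 * Real.log 2 / ε := by positivity
    linarith
  have hn : 0 < n := by
    rcases Nat.eq_zero_or_pos n with h | h
    · subst h; norm_num at hn1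
    · exact h
  have b1 : S n ≤ η / 2 := h1.trans (min_le_left _ _)
  have b2 : K0 * S n ≤ ε / 8 := by
    have := h1.trans (min_le_right _ _)
    rw [le_div_iff₀ (by positivity)] at this
    linarith
  have b3 : r n / θ ≤ 1 := by
    rw [div_le_one hθ]; exact h2.trans (min_le_left _ _)
  have b4 : r n / θ ≤ ε / 4 := by
    rw [div_le_iff₀ hθ]
    have := h2.trans (min_le_right _ _)
    linarith
  have b5 : Real.log 2 ≤ n * (ε / 8) := by
    have : 8 * Real.log 2 / ε ≤ n := by linarith
    rw [div_le_iff₀ hε] at this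
    linarith
  have hnr : (0 : ℝ) < n := by linarith
  have b6 : τ + 1 + lA = K0 * (η / 2) := by
    rw [hK0]; field_simp
  refine ⟨n, n * K0, η, hn, by positivity, ?_, hη1, ?_⟩
  · have : K0 * S n ≤ K0 * (η / 2) := mul_le_mul_of_nonneg_left b1 hK0p.le
    have h5 : K0 * S n + τ + 1 + lA ≤ K0 * η := by linarith
    have := mul_le_mul_of_nonneg_left h5 hnr.le
    have h6 : r n / θ ≤ n * 1 := by linarith
    linarith
  · have h7 := mul_le_mul_of_nonneg_left b2 hnr.le
    have h8 : r n / θ ≤ n * (ε / 4) := by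
      have : 1 * (ε / 4) ≤ n * (ε / 4) := mul_le_mul_of_nonneg_right hn1 (by positivity)
      linarith
    have h9 := mul_le_mul_of_nonneg_left hη2 hnr.le
    nlinarith

lemma block_core [Nonempty A] (hU : IsPMF pU) (hV : IsKernel pV)
    {K : U → V → A → ℝ} (hK : ∀ u v, IsPMF (K u v))
    {κD : V → A → D → ℝ} (hD : ∀ v a, IsPMF (κD v a))
    {κG : V → A → G → ℝ} (hG : ∀ v a, IsPMF (κG v a))
    {Dn Gn : ℕ → Type} [∀ n, Fintype (Dn n)] [∀ n, Fintype (Gn n)]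
    (eD : ∀ n, Dn n ≃ (Fin n → D)) (eG : ∀ n, Gn n ≃ (Fin n → G))
    {cost : A → V → D → ℝ} {dmax D0 : ℝ} (hc0 : ∀ a v d, 0 ≤ cost a v d)
    (hc1 : ∀ a v d, cost a v d ≤ dmax) (hD0 : 0 ≤ D0) (hdm : 0 ≤ dmax)
    {TD : U → V → D → ℝ} (hTD : ∀ u v w, TD u v w = ∑ a, K u v a * κD v a w)
    {TG : U → V → A × G → ℝ} (hTG : ∀ u v w, TG u v w = K u v w.1 * κG v w.1 w.2)
    {R1 R2 : ℝ} (hR1 : 0 ≤ R1) (hR2 : 0 ≤ R2)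
    (hr1 : EX pU pV K (fun u v w => Real.log (K u v w / m0 pU pV K w)) < R1 + R2)
    (hr2 : EX pU pV K (fun u _ w => Real.log (m1 pV K u w / m0 pU pV K w)) < R1)
    (hr3 : R2 < EX pU pV TD (fun u v w => Real.log (TD u v w / m1 pV TD u w)))
    (hr4 : R1 + R2 < EX pU pV TD (fun u v w => Real.log (TD u v w / m0 pU pV TD w)))
    (hr5 : EC pU pV (fun u v => ∑ a, ∑ d, K u v a * κD v a d * cost a v d) ≤ D0)
    {ε : ℝ} (hε : 0 < ε) :
    ∃ (n : ℕ) (enc : (Fin n → A) → (Fin n → V) → ℝ) (dec : Dn n → (Fin n → V)), 0 < n ∧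
      IsKernel enc ∧
      (∑ a : Fin n → A, ∑ v, ∑ d : Dn n, (∏ i, m0 pU pV K (a i)) * enc a v *
        (∏ i, κD (v i) (a i) (eD n d i)) *
          ((n : ℝ)⁻¹ * ∑ i, cost (a i) (dec d i) (eD n d i)) ≤ D0 + ε) ∧
      n * (∑ u, pU u * hh (m1 pV TG u) -
        max 0 (EX pU pV TG (fun u v w => Real.log (TG u v w / m1 pV TG u w)) - R2) - ε) ≤
        hh (fun w : (Fin n → A) × Gn n => (∏ i, m0 pU pV K (w.1 i)) *
          ∑ v, enc w.1 v * ∏ i, κG (v i) (w.1 i) (eG n w.2 i)) := by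
  have hTDp : ∀ u v, IsPMF (TD u v) := by
    intro u v
    refine ⟨fun w => ?_, ?_⟩
    · rw [hTD]
      exact Finset.sum_nonneg fun a _ => mul_nonneg ((hK u v).1 a) ((hD v a).1 w)
    · simp only [hTD]
      rw [Finset.sum_comm]
      simp only [← Finset.mul_sum, (hD _ _).2, mul_one, (hK u v).2]
  have hTGp : ∀ u v, IsPMF (TG u v) := by
    intro u v
    refine ⟨fun w => ?_, ?_⟩
    · rw [hTG]
      exact mul_nonneg ((hK u v).1 _) ((hG v _).1 _)
    · rw [Fintype.sum_prod_type]
      simp only [hTG, ← Finset.mul_sum, (hG _ _).2, mul_one, (hK u v).2]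
  set T5 : U → V → A × D → ℝ := fun u v w => K u v w.1 * κD v w.1 w.2 with hT5
  have hT5p : ∀ u v, IsPMF (T5 u v) := by
    intro u v
    refine ⟨fun w => ?_, ?_⟩
    · exact mul_nonneg ((hK u v).1 _) ((hD v _).1 _)
    · rw [Fintype.sum_prod_type]
      simp only [hT5, ← Finset.mul_sum, (hD _ _).2, mul_one, (hK u v).2]
  have hKs := fun u v w => pos_of_supp (u := u) (v := v) (w := w) hU hV (fun u v => (hK u v).1)
  have hTDs := fun u v w => pos_of_supp (u := u) (v := v) (w := w) hU hV (fun u v => (hTDp u v).1)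
  have hTGs := fun u v w => pos_of_supp (u := u) (v := v) (w := w) hU hV (fun u v => (hTGp u v).1)
  have hinv : ∀ (f g : U → V → D → ℝ), EX pU pV TD (fun u v w => Real.log (f u v w / g u v w)) =
      - EX pU pV TD (fun u v w => Real.log (g u v w / f u v w)) := by
    intro f g
    have := EX_smul (pU := pU) (pV := pV) (-1) TD (fun u v w => Real.log (g u v w / f u v w))
    rw [show - EX pU pV TD (fun u v w => Real.log (g u v w / f u v w)) = -1 *
      EX pU pV TD (fun u v w => Real.log (g u v w / f u v w)) by ring, ← this]
    congr 1
    funext u v w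
    rw [← inv_div, Real.log_inv]
    ring
  set δ := ε / 4 with hδ
  have hδp : 0 < δ := by positivity
  set τ0 := max 0 (EX pU pV TG (fun u v w => Real.log (TG u v w / m1 pV TG u w)) - R2) with hτ0
  set τ := τ0 + δ with hτ
  have hτp : 0 ≤ τ := add_nonneg (le_max_left _ _) hδp.le
  obtain ⟨θ1, ρ1, hθ1, hρ1, M1⟩ := block_moment2 hU hV hK
    (fun u v w => K u v w / m0 pU pV K w) (fun u v w a b c => by
      have := hKs u v w a b c; exact div_pos this.1 this.2.2) (-(R1 + R2)) (by linarith)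
  obtain ⟨θ2, ρ2, hθ2, hρ2, M2⟩ := block_moment2 hU hV hK
    (fun u v w => m1 pV K u w / m0 pU pV K w) (fun u v w a b c => by
      have := hKs u v w a b c; exact div_pos this.2.1 this.2.2) (-R1) (by linarith)
  obtain ⟨θ3, ρ3, hθ3, hρ3, M3⟩ := block_moment2 hU hV hTDp
    (fun u v w => m1 pV TD u w / TD u v w) (fun u v w a b c => by
      have := hTDs u v w a b c; exact div_pos this.2.1 this.1) R2 (by
      rw [hinv (fun u v w => m1 pV TD u w) TD]; linarith)
  obtain ⟨θ4, ρ4, hθ4, hρ4, M4⟩ := block_moment2 hU hV hTDp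
    (fun u v w => m0 pU pV TD w / TD u v w) (fun u v w a b c => by
      have := hTDs u v w a b c; exact div_pos this.2.2 this.1) (R1 + R2) (by
      rw [hinv (fun u v w => m0 pU pV TD w) TD]; linarith)
  obtain ⟨θ5, ρ5, hθ5, hρ5, M5⟩ := block_moment2 hU hV hT5p
    (fun u v w => Real.exp (cost w.1 v w.2)) (fun u v w a b c => Real.exp_pos _) (-(D0 + δ)) (by
      simp only [Real.log_exp]
      have : EX pU pV T5 (fun u v w => cost w.1 v w.2) =
          EC pU pV (fun u v => ∑ a, ∑ d, K u v a * κD v a d * cost a v d) := by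
        unfold EX
        rw [← EC_sum]
        simp only [Fintype.sum_prod_type, hT5]
      linarith)
  obtain ⟨θ6, ρ6, hθ6, hρ6, M6⟩ := block_moment2 hU hV hTGp
    (fun u v w => TG u v w / m1 pV TG u w) (fun u v w a b c => by
      have := hTGs u v w a b c; exact div_pos this.1 this.2.1) (-(R2 + τ)) (by
      have := le_max_right 0 (EX pU pV TG (fun u v w => Real.log (TG u v w / m1 pV TG u w)) - R2)
      rw [← hτ0] at this
      linarith)
  have tend : ∀ ρ : ℝ, 0 ≤ ρ ∧ ρ < 1 → Filter.Tendsto (fun n : ℕ => ρ ^ n) Filter.atTop (nhds 0) :=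
    fun ρ h => tendsto_pow_atTop_nhds_zero_of_lt_one h.1 h.2
  have hlA : 0 ≤ Real.log (Fintype.card A) := Real.log_natCast_nonneg _
  obtain ⟨n, κ, η, hn, hκ, p1, p2, p3⟩ := choose_params dmax (Real.log (Fintype.card A)) τ θ6 (ε / 2)
    hdm hlA hτp hθ6.1 (by positivity)
    (fun n => 2 * (1 * ρ1 ^ n) + 2 * (1 * ρ2 ^ n) + 2 * ρ3 ^ n + 4 * ρ4 ^ n + 1 * ρ5 ^ n)
    (fun n => ρ6 ^ n) (by
      have := (((((tend ρ1 hρ1).const_mul 1).const_mul 2).add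
        (((tend ρ2 hρ2).const_mul 1).const_mul 2)).add ((tend ρ3 hρ3).const_mul 2)).add
        ((tend ρ4 hρ4).const_mul 4) |>.add ((tend ρ5 hρ5).const_mul 1)
      simpa using this) (tend ρ6 hρ6)
  obtain ⟨N1, hN1, n1a, n1b⟩ := exists_size hR1 n
  obtain ⟨N2, hN2, n2a, n2b⟩ := exists_size hR2 n
  have hN1r : (0 : ℝ) < N1 := by exact_mod_cast hN1
  have hN2r : (0 : ℝ) < N2 := by exact_mod_cast hN2
  have hN12 : Real.exp (n * (R1 + R2)) ≤ N1 * N2 := by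
    rw [mul_add, Real.exp_add]
    exact mul_le_mul n1a n2a (Real.exp_pos _).le hN1r.le
  have hN12' : (N1 : ℝ) * N2 ≤ 4 * Real.exp (n * (R1 + R2)) := by
    rw [mul_add, Real.exp_add]
    have := mul_le_mul n1b n2b hN2r.le (by positivity)
    linarith
  have hnr : (0 : ℝ) < n := by exact_mod_cast hn
  have inv_le : ∀ {N t : ℝ}, 0 < N → Real.exp t ≤ N → N⁻¹ ≤ Real.exp (-t) := by
    intro N t hN h
    rw [Real.exp_neg]
    exact inv_anti₀ (Real.exp_pos _) h
  have H := os_main (A := Fin n → A) (D := Dn n) (G := Gn n) (pU'_isPMF hU n) (pV'_isKernel hV n)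
    hN1 hN2 (K := T' K (Equiv.refl _)) (T'_isPMF hK _)
    (κD := fun v a d => ∏ i, κD (v i) (a i) (eD n d i)) (fun v a => by
      refine ⟨fun d => Finset.prod_nonneg fun i _ => (hD _ _).1 _, ?_⟩
      rw [(eD n).sum_comp (fun w => ∏ i, κD (v i) (a i) (w i)),
        ← Fintype.prod_sum (fun i x => κD (v i) (a i) x)]
      simp [(hD _ _).2])
    (κG := fun v a d => ∏ i, κG (v i) (a i) (eG n d i)) (fun v a => by
      refine ⟨fun d => Finset.prod_nonneg fun i _ => (hG _ _).1 _, ?_⟩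
      rw [(eG n).sum_comp (fun w => ∏ i, κG (v i) (a i) (w i)),
        ← Fintype.prod_sum (fun i x => κG (v i) (a i) x)]
      simp [(hG _ _).2])
    (cost := fun a v d => (n : ℝ)⁻¹ * ∑ i, cost (a i) (v i) (eD n d i)) (dmax := dmax)
    (D0 := D0 + δ)
    (fun a v d => mul_nonneg (by positivity) (Finset.sum_nonneg fun i _ => hc0 _ _ _))
    (fun a v d => by
      rw [inv_mul_le_iff₀ hnr]
      calc ∑ i, cost (a i) (v i) (eD n d i) ≤ ∑ i : Fin n, dmax :=
            Finset.sum_le_sum fun i _ => hc1 _ _ _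
        _ = n * dmax := by simp)
    (by linarith) hdm
    (TD := T' TD (eD n)) (fun u v w => by
      unfold T'
      simp only [hTD, Equiv.refl_apply, ← Finset.prod_mul_distrib]
      rw [Fintype.prod_sum])
    (TG := T' TG (zip2 (eG n))) (fun u v w => by
      unfold T'
      simp only [hTG, Equiv.refl_apply, ← Finset.prod_mul_distrib, zip2, Equiv.coe_fn_mk])
    hθ1 hθ2 hθ3 hθ4 (e1 := 1 * ρ1 ^ n) (e2 := 1 * ρ2 ^ n) (e3 := 2 * ρ3 ^ n) (e4 := 4 * ρ4 ^ n)
    (e5 := 1 * ρ5 ^ n) (L := n * τ + ρ6 ^ n / θ6) (η := η) hκ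
    (by
      refine M1 n _ (Equiv.refl _) _ 1 zero_le_one fun u v w a1 a2 a3 => ?_
      have hp := fun i => hKs _ _ _ (a1 i) (a2 i) (a3 i)
      rw [m0_block, one_mul]
      have hx : 0 ≤ ∏ i, K (u i) (v i) (w i) / m0 pU pV K (w i) :=
        Finset.prod_nonneg fun i _ => (div_pos (hp i).1 (hp i).2.2).le
      have e1 : T' K (Equiv.refl _) u v w / (N1 * N2) / ∏ i, m0 pU pV K (Equiv.refl _ w i) =
          (∏ i, K (u i) (v i) (w i) / m0 pU pV K (w i)) * ((N1 : ℝ) * N2)⁻¹ := by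
        rw [Finset.prod_div_distrib]
        unfold T'
        simp only [Equiv.refl_apply]
        ring
      rw [e1]
      refine Real.rpow_le_rpow (by positivity) ?_ hθ1.1.le
      refine mul_le_mul_of_nonneg_left ?_ hx
      rw [mul_neg]
      exact inv_le (by positivity) hN12)
    (by
      refine M2 n _ (Equiv.refl _) _ 1 zero_le_one fun u v w a1 a2 a3 => ?_
      have hp := fun i => hKs _ _ _ (a1 i) (a2 i) (a3 i)
      rw [m0_block, one_mul, m1_block]
      have hx : 0 ≤ ∏ i, m1 pV K (u i) (w i) / m0 pU pV K (w i) :=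
        Finset.prod_nonneg fun i _ => (div_pos (hp i).2.1 (hp i).2.2).le
      have e1 : (∏ i, m1 pV K (u i) (Equiv.refl _ w i)) / N1 / ∏ i, m0 pU pV K (Equiv.refl _ w i) =
          (∏ i, m1 pV K (u i) (w i) / m0 pU pV K (w i)) * (N1 : ℝ)⁻¹ := by
        rw [Finset.prod_div_distrib]
        simp only [Equiv.refl_apply]
        ring
      rw [e1]
      refine Real.rpow_le_rpow (by positivity) ?_ hθ2.1.le
      refine mul_le_mul_of_nonneg_left ?_ hx
      rw [mul_neg]
      exact inv_le (by positivity) n1a)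
    (by
      refine M3 n _ (eD n) _ 2 zero_le_two fun u v w a1 a2 a3 => ?_
      have hp := fun i => hTDs _ _ _ (a1 i) (a2 i) (a3 i)
      have hx : 0 ≤ ∏ i, m1 pV TD (u i) (eD n w i) / TD (u i) (v i) (eD n w i) :=
        Finset.prod_nonneg fun i _ => (div_pos (hp i).2.1 (hp i).1).le
      refine le_trans ?_ (two_rpow_le one_le_two (by positivity) hθ3.2)
      have hq : T' TD (eD n) u v w ≠ 0 := Finset.prod_ne_zero_iff.2 fun i _ => (hp i).1.ne'
      have e1 : m1 (pV' pV n) (T' TD (eD n)) u w / N1 / (T' TD (eD n) u v w / (N1 * N2)) =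
          (∏ i, m1 pV TD (u i) (eD n w i) / TD (u i) (v i) (eD n w i)) * (N2 : ℝ) := by
        rw [Finset.prod_div_distrib, m1_block]
        rw [show (∏ i, TD (u i) (v i) (eD n w i)) = T' TD (eD n) u v w from rfl]
        field_simp
      rw [e1]
      refine Real.rpow_le_rpow (by positivity) ?_ hθ3.1.le
      rw [mul_left_comm]
      exact mul_le_mul_of_nonneg_left n2b hx)
    (by
      refine M4 n _ (eD n) _ 4 (by norm_num) fun u v w a1 a2 a3 => ?_
      have hp := fun i => hTDs _ _ _ (a1 i) (a2 i) (a3 i)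
      have hx : 0 ≤ ∏ i, m0 pU pV TD (eD n w i) / TD (u i) (v i) (eD n w i) :=
        Finset.prod_nonneg fun i _ => (div_pos (hp i).2.2 (hp i).1).le
      refine le_trans ?_ (two_rpow_le (by norm_num) (by positivity) hθ4.2)
      have hq : T' TD (eD n) u v w ≠ 0 := Finset.prod_ne_zero_iff.2 fun i _ => (hp i).1.ne'
      have e1 : m0 (pU' pU n) (pV' pV n) (T' TD (eD n)) w / (T' TD (eD n) u v w / (N1 * N2)) =
          (∏ i, m0 pU pV TD (eD n w i) / TD (u i) (v i) (eD n w i)) * ((N1 : ℝ) * N2) := by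
        rw [Finset.prod_div_distrib, m0_block]
        rw [show (∏ i, TD (u i) (v i) (eD n w i)) = T' TD (eD n) u v w from rfl]
        field_simp
      rw [e1]
      refine Real.rpow_le_rpow (by positivity) ?_ hθ4.1.le
      rw [mul_left_comm (4 : ℝ)]
      exact mul_le_mul_of_nonneg_left hN12' hx)
    (by
      have h5 := M5 n _ (zip2 (eD n)) (fun u v w => if D0 + δ < (n : ℝ)⁻¹ *
        ∑ i, cost (w.1 i) (v i) (eD n w.2 i) then 1 else 0) 1 zero_le_one fun u v w _ _ _ => by
          rw [one_mul]
          split_ifs with hlt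
          · refine Real.one_le_rpow ?_ hθ5.1.le
            rw [← Real.exp_sum, ← Real.exp_add]
            refine Real.one_le_exp ?_
            rw [lt_inv_mul_iff₀ hnr] at hlt
            simp only [zip2, Equiv.coe_fn_mk]
            linarith
          · exact Real.rpow_nonneg (mul_nonneg (Finset.prod_nonneg fun i _ => (Real.exp_pos _).le)
              (Real.exp_pos _).le) _
      refine le_trans (le_of_eq ?_) h5
      unfold EX
      rw [← EC_sum]
      congr 1
      funext u v
      rw [Fintype.sum_prod_type]
      refine Finset.sum_congr rfl fun a _ => Finset.sum_congr rfl fun d _ => ?_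
      simp only [T', hT5, zip2, Equiv.coe_fn_mk, Equiv.refl_apply, Finset.prod_mul_distrib])
    (by
      have h6 := M6 n _ (zip2 (eG n)) (fun u v w => Real.log (1 + T' TG (zip2 (eG n)) u v w / N2 /
        m1 (pV' pV n) (T' TG (zip2 (eG n))) u w) - n * τ) (1 / θ6)
        (by have := hθ6.1; positivity) fun u v w a1 a2 a3 => by
          have hp := fun i => hTGs _ _ _ (a1 i) (a2 i) (a3 i)
          have hx : 0 ≤ ∏ i, TG (u i) (v i) (zip2 (eG n) w i) / m1 pV TG (u i) (zip2 (eG n) w i) :=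
            Finset.prod_nonneg fun i _ => (div_pos (hp i).1 (hp i).2.1).le
          set x := ∏ i, TG (u i) (v i) (zip2 (eG n) w i) / m1 pV TG (u i) (zip2 (eG n) w i) with hxd
          have e1 : T' TG (zip2 (eG n)) u v w / N2 / m1 (pV' pV n) (T' TG (zip2 (eG n))) u w =
              x * (N2 : ℝ)⁻¹ := by
            rw [hxd, Finset.prod_div_distrib, m1_block]
            unfold T'
            ring
          rw [e1]
          set y := x * Real.exp (n * -(R2 + τ)) with hy
          have hy0 : 0 ≤ y := by positivity
          have e2 : x * (N2 : ℝ)⁻¹ ≤ Real.exp (n * τ) * y := by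
            have e3 : Real.exp (n * τ) * y = x * Real.exp (-(n * R2)) := by
              rw [hy, mul_left_comm, ← Real.exp_add]
              congr 2
              ring
            rw [e3]
            exact mul_le_mul_of_nonneg_left (inv_le hN2r n2a) hx
          have e4 : 1 + x * (N2 : ℝ)⁻¹ ≤ Real.exp (n * τ) * (1 + y) := by
            have : 1 ≤ Real.exp (n * τ) := Real.one_le_exp (by positivity)
            linarith
          have e5 := Real.log_le_log (by positivity) e4
          rw [Real.log_mul (Real.exp_pos _).ne' (by positivity), Real.log_exp] at e5
          have e6 := log_one_add_le hy0 hθ6.1 hθ6.2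
          rw [one_div, inv_mul_eq_div]
          linarith
      have h7 := EX_one (pU'_isPMF hU n) (pV'_isKernel hV n) (T := T' TG (zip2 (eG n)))
        fun u v => (T'_isPMF hTGp _ u v).2
      have h8 := EX_smul (pU := pU' pU n) (pV := pV' pV n) (n * τ) (T' TG (zip2 (eG n)))
        (fun _ _ _ => 1)
      rw [h7] at h8
      simp only [mul_one] at h8
      rw [EX_sub, h8] at h6
      rw [one_div, inv_mul_eq_div] at h6
      linarith)
    (by
      have : Real.log (Fintype.card (Fin n → A)) = n * Real.log (Fintype.card A) := by
        simp
      rw [this]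
      linarith [p1])
  obtain ⟨enc, dec, k1, k2, k3⟩ := H
  have hm0 : ∀ a : Fin n → A, m0 (pU' pU n) (pV' pV n) (T' K (Equiv.refl _)) a =
      ∏ i, m0 pU pV K (a i) := fun a => m0_block K (Equiv.refl _) a
  simp only [hm0] at k2 k3
  have hcA : Real.log (Fintype.card (Fin n → A)) = n * Real.log (Fintype.card A) := by
    simp
  rw [HU_block hU hV hTGp, hcA] at k3
  refine ⟨n, enc, dec, hn, k1, k2.trans ?_, le_trans ?_ k3⟩
  · linarith
  · have : n * (τ + ε / 2) ≤ n * (τ0 + ε) := mul_le_mul_of_nonneg_left (by linarith) hnr.le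
    linarith

end Core

/-! ### Conditional kernels, submodularity and single-letter identities -/

section Single

variable {γ U V W W' α β : Type} [Fintype γ] [Fintype U] [Fintype V] [Fintype W] [Fintype W']
  [Fintype α] [Fintype β]

/-- conditional kernel of `g` given `f` -/
noncomputable def ck (q : γ → ℝ) (f : γ → α) (g : γ → β) (a : α) (b : β) : ℝ :=
  if pushf q f a = 0 then pushf q g b else pushf q (fun c => (f c, g c)) (a, b) / pushf q f a

lemma pushf_pair_le {q : γ → ℝ} (hq : ∀ c, 0 ≤ q c) (f : γ → α) (g : γ → β) (a : α) (b : β) :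
    pushf q (fun c => (f c, g c)) (a, b) ≤ pushf q f a := by
  rw [← sum_pushf_pair q f g a]
  exact Finset.single_le_sum (f := fun b => pushf q (fun c => (f c, g c)) (a, b))
    (fun b _ => pushf_nonneg hq _ _) (Finset.mem_univ b)

lemma ck_isKernel {q : γ → ℝ} (hq : IsPMF q) (f : γ → α) (g : γ → β) : IsKernel (ck q f g) := by
  intro a
  by_cases h : pushf q f a = 0
  · have : ck q f g a = pushf q g := by funext b; simp [ck, h]
    rw [this]
    exact pushf_isPMF hq g
  · have : ck q f g a = fun b => pushf q (fun c => (f c, g c)) (a, b) / pushf q f a := by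
      funext b; simp [ck, h]
    rw [this]
    refine ⟨fun b => div_nonneg (pushf_nonneg hq.1 _ _) (pushf_nonneg hq.1 _ _), ?_⟩
    rw [← Finset.sum_div, sum_pushf_pair, div_self h]

lemma mul_ck {q : γ → ℝ} (hq : ∀ c, 0 ≤ q c) (f : γ → α) (g : γ → β) (a : α) (b : β) :
    pushf q (fun c => (f c, g c)) (a, b) = pushf q f a * ck q f g a b := by
  by_cases h : pushf q f a = 0
  · rw [h, zero_mul]
    have := pushf_pair_le hq f g a b
    rw [h] at this
    exact le_antisymm this (pushf_nonneg hq _ _)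
  · simp only [ck, h, if_false]
    field_simp

/-- coarse graining of a kernel factorisation -/
lemma pushf_coarse (q : γ → ℝ) (f : γ → α) (g : γ → β) (j : α → W) (κ : W → β → ℝ)
    (h : ∀ a b, pushf q (fun c => (f c, g c)) (a, b) = pushf q f a * κ (j a) b) (w : W) (b : β) :
    pushf q (fun c => (j (f c), g c)) (w, b) = pushf q (fun c => j (f c)) w * κ w b := by
  classical
  have e1 := pushf_pushf q (fun c => (f c, g c)) (fun t => (j t.1, t.2))
  have e2 := pushf_pushf q f j
  rw [← e2, show pushf q (fun c => (j (f c), g c)) = _ from e1.symm]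
  unfold pushf at h ⊢
  rw [Fintype.sum_prod_type, Finset.sum_mul]
  refine Finset.sum_congr rfl fun a _ => ?_
  rw [Finset.sum_eq_single b]
  · rw [h a b]
    by_cases hj : j a = w
    · simp [hj]
    · simp [hj]
  · intro b' _ hb
    simp [hb]
  · simp

lemma negMulLog_mul_log (x : ℝ) : Real.negMulLog x = -(x * Real.log x) := by
  simp [Real.negMulLog]

/-- the law of three variables in terms of sums -/
lemma Hn_log (q : γ → ℝ) (f : γ → α) : ∑ c, q c * Real.log (pushf q f (f c)) = - Hn q f := by
  rw [Hn_eq, neg_neg]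

lemma submod_aux {q : γ → ℝ} (hq : ∀ c, 0 ≤ q c) (fu : γ → U) (fv : γ → V) (fw : γ → W) :
    ∑ x : U × V × W, pushf q (fun c => (fu c, fv c, fw c)) x *
      (Real.log (pushf q (fun c => (fu c, fv c, fw c)) x) -
        Real.log (pushf q (fun c => (fu c, fv c)) (x.1, x.2.1) *
          pushf q (fun c => (fu c, fw c)) (x.1, x.2.2) / pushf q fu x.1)) =
      Hn q (fun c => (fu c, fv c)) + Hn q (fun c => (fu c, fw c)) -
        Hn q (fun c => (fu c, fv c, fw c)) - Hn q fu := by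
  rw [sum_pushf_mul q (fun c => (fu c, fv c, fw c)) (fun x =>
    (Real.log (pushf q (fun c => (fu c, fv c, fw c)) x) -
        Real.log (pushf q (fun c => (fu c, fv c)) (x.1, x.2.1) *
          pushf q (fun c => (fu c, fw c)) (x.1, x.2.2) / pushf q fu x.1)))]
  have : ∀ c, q c * (Real.log (pushf q (fun c => (fu c, fv c, fw c)) (fu c, fv c, fw c)) -
        Real.log (pushf q (fun c => (fu c, fv c)) (fu c, fv c) *
          pushf q (fun c => (fu c, fw c)) (fu c, fw c) / pushf q fu (fu c))) =
      q c * Real.log (pushf q (fun c => (fu c, fv c, fw c)) (fu c, fv c, fw c)) -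
      q c * Real.log (pushf q (fun c => (fu c, fv c)) (fu c, fv c)) -
      q c * Real.log (pushf q (fun c => (fu c, fw c)) (fu c, fw c)) +
      q c * Real.log (pushf q fu (fu c)) := by
    intro c
    by_cases hc : q c = 0
    · simp [hc]
    have p1 := pushf_pos hq (fun c => (fu c, fv c)) hc
    have p2 := pushf_pos hq (fun c => (fu c, fw c)) hc
    have p3 := pushf_pos hq fu hc
    rw [Real.log_div (mul_pos p1 p2).ne' p3.ne', Real.log_mul p1.ne' p2.ne']
    ring
  simp only [this, Finset.sum_add_distrib, Finset.sum_sub_distrib]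
  rw [Hn_log q (fun c => (fu c, fv c, fw c)), Hn_log q (fun c => (fu c, fv c)),
    Hn_log q (fun c => (fu c, fw c)), Hn_log q fu]
  ring

lemma submod_side {q : γ → ℝ} (hq : ∀ c, 0 ≤ q c) (fu : γ → U) (fv : γ → V) (fw : γ → W) :
    (∀ x : U × V × W, pushf q (fun c => (fu c, fv c, fw c)) x ≠ 0 →
      pushf q (fun c => (fu c, fv c)) (x.1, x.2.1) *
          pushf q (fun c => (fu c, fw c)) (x.1, x.2.2) / pushf q fu x.1 ≠ 0) ∧
    ∑ x : U × V × W, pushf q (fun c => (fu c, fv c)) (x.1, x.2.1) *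
          pushf q (fun c => (fu c, fw c)) (x.1, x.2.2) / pushf q fu x.1 ≤
      ∑ x : U × V × W, pushf q (fun c => (fu c, fv c, fw c)) x := by
  constructor
  · intro x hx
    have : ∃ c, q c ≠ 0 ∧ (fu c, fv c, fw c) = x := by
      by_contra hcon
      push Not at hcon
      apply hx
      unfold pushf
      refine Finset.sum_eq_zero fun c _ => ?_
      by_cases hc : q c = 0
      · simp [hc]
      · simp [hcon c hc]
    obtain ⟨c, hc, rfl⟩ := this
    have p1 := pushf_pos hq (fun c => (fu c, fv c)) hc
    have p2 := pushf_pos hq (fun c => (fu c, fw c)) hc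
    have p3 := pushf_pos hq fu hc
    exact (div_pos (mul_pos p1 p2) p3).ne'
  · rw [sum_pushf, ← sum_pushf q fu, Fintype.sum_prod_type]
    refine Finset.sum_le_sum fun u _ => ?_
    rw [Fintype.sum_prod_type]
    simp only [← Finset.sum_div, ← Finset.mul_sum, ← Finset.sum_mul]
    rw [sum_pushf_pair, sum_pushf_pair]
    by_cases h : pushf q fu u = 0
    · simp [h]
    · rw [mul_div_assoc, div_self h, mul_one]

/-- conditional mutual information (nats) `I(fv; fw | fu)` -/
noncomputable def Iv (q : γ → ℝ) (fu : γ → U) (fv : γ → V) (fw : γ → W) : ℝ :=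
  Hn q (fun c => (fu c, fv c)) + Hn q (fun c => (fu c, fw c)) -
        Hn q (fun c => (fu c, fv c, fw c)) - Hn q fu

/-- mutual information (nats) -/
noncomputable def I2 (q : γ → ℝ) (fu : γ → U) (fw : γ → W) : ℝ :=
  Hn q fu + Hn q fw - Hn q (fun c => (fu c, fw c))

lemma Iv_nonneg {q : γ → ℝ} (hq : ∀ c, 0 ≤ q c) (fu : γ → U) (fv : γ → V) (fw : γ → W) :
    0 ≤ Iv q fu fv fw := by
  unfold Iv
  rw [← submod_aux hq]
  exact gibbs (pushf_nonneg hq _) (fun x => div_nonneg (mul_nonneg (pushf_nonneg hq _ _)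
    (pushf_nonneg hq _ _)) (pushf_nonneg hq _ _)) (submod_side hq fu fv fw).1
    (submod_side hq fu fv fw).2

lemma Iv_zero {q : γ → ℝ} (hq : ∀ c, 0 ≤ q c) (fu : γ → U) (fv : γ → V) (fw : γ → W)
    (h : Iv q fu fv fw ≤ 0) (x : U × V × W) : pushf q (fun c => (fu c, fv c, fw c)) x =
      pushf q (fun c => (fu c, fv c)) (x.1, x.2.1) *
          pushf q (fun c => (fu c, fw c)) (x.1, x.2.2) / pushf q fu x.1 := by
  unfold Iv at h
  rw [← submod_aux hq] at h
  exact congrFun (gibbs_eq (pushf_nonneg hq _) (fun x => div_nonneg (mul_nonneg (pushf_nonneg hq _ _)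
    (pushf_nonneg hq _ _)) (pushf_nonneg hq _ _)) (submod_side hq fu fv fw).1
    (submod_side hq fu fv fw).2 h) x

lemma Hn_const {q : γ → ℝ} (hq : IsPMF q) (u : U) : Hn q (fun _ => u) = 0 := by
  rw [Hn_eq]
  simp [pushf, hq.2]

lemma Iv_unit {q : γ → ℝ} (hq : IsPMF q) (fv : γ → V) (fw : γ → W) :
    Iv q (fun _ => ()) fv fw = I2 q fv fw := by
  unfold Iv I2
  rw [Hn_const hq, Hn_congr_inj q fv (fun c => ((), fv c)) (fun v => ((), v))
    (Function.LeftInverse.injective (g := fun x => x.2) (fun _ => rfl)) (fun _ => rfl),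
    Hn_congr_inj q fw (fun c => ((), fw c)) (fun v => ((), v))
    (Function.LeftInverse.injective (g := fun x => x.2) (fun _ => rfl)) (fun _ => rfl),
    Hn_congr_inj q (fun c => (fv c, fw c)) (fun c => ((), fv c, fw c)) (fun v => ((), v))
    (Function.LeftInverse.injective (g := fun x => x.2) (fun _ => rfl)) (fun _ => rfl)]
  ring

lemma I2_nonneg {q : γ → ℝ} (hq : IsPMF q) (fv : γ → V) (fw : γ → W) : 0 ≤ I2 q fv fw := by
  rw [← Iv_unit hq]
  exact Iv_nonneg hq.1 _ _ _

lemma Iv_mono {q : γ → ℝ} (hq : ∀ c, 0 ≤ q c) (fu : γ → U) (fv : γ → V) (fw : γ → W)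
    (fw' : γ → W') : Iv q fu fv fw ≤ Iv q fu fv (fun c => (fw c, fw' c)) := by
  have := Iv_nonneg hq (fun c => (fu c, fw c)) fv fw'
  unfold Iv at *
  rw [Hn_congr_inj q (fun c => (fu c, fv c, fw c)) (fun c => ((fu c, fw c), fv c))
    (fun x => ((x.1, x.2.2), x.2.1))
    (Function.LeftInverse.injective (g := fun x => (x.1.1, x.2, x.1.2)) (fun _ => rfl))
    (fun _ => rfl),
    Hn_congr_inj q (fun c => (fu c, fw c, fw' c)) (fun c => ((fu c, fw c), fw' c))
    (fun x => ((x.1, x.2.1), x.2.2))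
    (Function.LeftInverse.injective (g := fun x => (x.1.1, x.1.2, x.2)) (fun _ => rfl))
    (fun _ => rfl),
    Hn_congr_inj q (fun c => (fu c, fv c, fw c, fw' c)) (fun c => ((fu c, fw c), fv c, fw' c))
    (fun x => ((x.1, x.2.2.1), x.2.1, x.2.2.2))
    (Function.LeftInverse.injective (g := fun x => (x.1.1, x.2.1, x.1.2, x.2.2)) (fun _ => rfl))
    (fun _ => rfl)] at this
  linarith

/-! Translation of the expectations `EX` to entropies. -/

section Translate

variable {q : γ → ℝ} {fu : γ → U} {fv : γ → V} {fw : γ → W}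
  {T : U → V → W → ℝ}

lemma qj_push (hq : ∀ c, 0 ≤ q c)
    (hT : ∀ u v w, pushf q (fun c => (fu c, fv c, fw c)) (u, v, w) =
      pushf q (fun c => (fu c, fv c)) (u, v) * T u v w) (x : U × V × W) :
    qj (pushf q fu) (ck q fu fv) T x = pushf q (fun c => (fu c, fv c, fw c)) x := by
  unfold qj
  rw [← mul_ck hq, show x = (x.1, x.2.1, x.2.2) from rfl, hT]

lemma EX_push (hq : ∀ c, 0 ≤ q c)
    (hT : ∀ u v w, pushf q (fun c => (fu c, fv c, fw c)) (u, v, w) =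
      pushf q (fun c => (fu c, fv c)) (u, v) * T u v w) (φ : U → V → W → ℝ) :
    EX (pushf q fu) (ck q fu fv) T φ = ∑ c, q c * φ (fu c) (fv c) (fw c) := by
  rw [EX_eq_qj]
  simp only [qj_push hq hT]
  exact sum_pushf_mul q (fun c => (fu c, fv c, fw c)) (fun x => φ x.1 x.2.1 x.2.2)

lemma m1_push (hq : ∀ c, 0 ≤ q c)
    (hT : ∀ u v w, pushf q (fun c => (fu c, fv c, fw c)) (u, v, w) =
      pushf q (fun c => (fu c, fv c)) (u, v) * T u v w) (u : U) (w : W) :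
    pushf q (fun c => (fu c, fw c)) (u, w) = pushf q fu u * m1 (ck q fu fv) T u w := by
  unfold m1
  rw [Finset.mul_sum]
  simp only [← mul_assoc, ← mul_ck hq, ← hT]
  have := sum_pushf_pair q (fun c => (fu c, fw c)) fv (u, w)
  rw [← this]
  refine Finset.sum_congr rfl fun v _ => ?_
  exact (pushf_inj q (fun c => ((fu c, fw c), fv c)) (fun x => (x.1.1, x.2, x.1.2))
    (Function.LeftInverse.injective (g := fun x => ((x.1, x.2.2), x.2.1)) (fun _ => rfl))
    ((u, w), v)).symm

lemma m0_push (hq : ∀ c, 0 ≤ q c)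
    (hT : ∀ u v w, pushf q (fun c => (fu c, fv c, fw c)) (u, v, w) =
      pushf q (fun c => (fu c, fv c)) (u, v) * T u v w) (w : W) :
    m0 (pushf q fu) (ck q fu fv) T w = pushf q fw w := by
  rw [m0_eq]
  simp only [← m1_push hq hT]
  exact sum_pushf_pair_left q fu fw w

lemma EX_logT_m1 (hq : ∀ c, 0 ≤ q c)
    (hT : ∀ u v w, pushf q (fun c => (fu c, fv c, fw c)) (u, v, w) =
      pushf q (fun c => (fu c, fv c)) (u, v) * T u v w) :
    EX (pushf q fu) (ck q fu fv) T (fun u v w => Real.log (T u v w / m1 (ck q fu fv) T u w)) =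
      Iv q fu fv fw := by
  rw [EX_push hq hT]
  have : ∀ c, q c * Real.log (T (fu c) (fv c) (fw c) / m1 (ck q fu fv) T (fu c) (fw c)) =
      q c * Real.log (pushf q (fun c => (fu c, fv c, fw c)) (fu c, fv c, fw c)) -
      q c * Real.log (pushf q (fun c => (fu c, fv c)) (fu c, fv c)) -
      q c * Real.log (pushf q (fun c => (fu c, fw c)) (fu c, fw c)) +
      q c * Real.log (pushf q fu (fu c)) := by
    intro c
    by_cases hc : q c = 0
    · simp [hc]
    have p0 := pushf_pos hq (fun c => (fu c, fv c, fw c)) hc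
    have p1 := pushf_pos hq (fun c => (fu c, fv c)) hc
    have p2 := pushf_pos hq (fun c => (fu c, fw c)) hc
    have p3 := pushf_pos hq fu hc
    rw [hT] at p0 ⊢
    rw [m1_push hq hT] at p2 ⊢
    have t1 := (right_ne_zero_of_mul p0.ne')
    have t2 := (right_ne_zero_of_mul p2.ne')
    rw [Real.log_div t1 t2, Real.log_mul p1.ne' t1, Real.log_mul p3.ne' t2]
    ring
  simp only [this, Finset.sum_add_distrib, Finset.sum_sub_distrib]
  rw [Hn_log q (fun c => (fu c, fv c, fw c)), Hn_log q (fun c => (fu c, fv c)),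
    Hn_log q (fun c => (fu c, fw c)), Hn_log q fu]
  unfold Iv
  ring

lemma EX_logm1_m0 (hq : ∀ c, 0 ≤ q c)
    (hT : ∀ u v w, pushf q (fun c => (fu c, fv c, fw c)) (u, v, w) =
      pushf q (fun c => (fu c, fv c)) (u, v) * T u v w) :
    EX (pushf q fu) (ck q fu fv) T (fun u _ w => Real.log (m1 (ck q fu fv) T u w /
      m0 (pushf q fu) (ck q fu fv) T w)) = I2 q fu fw := by
  rw [EX_push hq hT]
  have : ∀ c, q c * Real.log (m1 (ck q fu fv) T (fu c) (fw c) /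
      m0 (pushf q fu) (ck q fu fv) T (fw c)) =
      q c * Real.log (pushf q (fun c => (fu c, fw c)) (fu c, fw c)) -
      q c * Real.log (pushf q fw (fw c)) -
      q c * Real.log (pushf q fu (fu c)) := by
    intro c
    by_cases hc : q c = 0
    · simp [hc]
    have p1 := pushf_pos hq fw hc
    have p2 := pushf_pos hq (fun c => (fu c, fw c)) hc
    have p3 := pushf_pos hq fu hc
    rw [m1_push hq hT] at p2 ⊢
    rw [m0_push hq hT]
    have t2 := (right_ne_zero_of_mul p2.ne')
    rw [Real.log_div t2 p1.ne', Real.log_mul p3.ne' t2]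
    ring
  simp only [this, Finset.sum_sub_distrib]
  rw [Hn_log q (fun c => (fu c, fw c)), Hn_log q fw, Hn_log q fu]
  unfold I2
  ring

lemma EX_logT_m0 (hq : ∀ c, 0 ≤ q c)
    (hT : ∀ u v w, pushf q (fun c => (fu c, fv c, fw c)) (u, v, w) =
      pushf q (fun c => (fu c, fv c)) (u, v) * T u v w) :
    EX (pushf q fu) (ck q fu fv) T (fun u v w => Real.log (T u v w /
      m0 (pushf q fu) (ck q fu fv) T w)) = I2 q fu fw + Iv q fu fv fw := by
  rw [← EX_logT_m1 hq hT, ← EX_logm1_m0 hq hT, EX_push hq hT, EX_push hq hT, EX_push hq hT,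
    ← Finset.sum_add_distrib]
  refine Finset.sum_congr rfl fun c _ => ?_
  by_cases hc : q c = 0
  · simp [hc]
  have p0 := pushf_pos hq (fun c => (fu c, fv c, fw c)) hc
  have p1 := pushf_pos hq fw hc
  have p2 := pushf_pos hq (fun c => (fu c, fw c)) hc
  rw [hT] at p0
  rw [m1_push hq hT] at p2
  rw [m0_push hq hT]
  have t1 := (right_ne_zero_of_mul p0.ne')
  have t2 := (right_ne_zero_of_mul p2.ne')
  rw [Real.log_div t1 t2, Real.log_div t2 p1.ne', Real.log_div t1 p1.ne']
  ring

end Translate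

lemma HU_push {G : Type} [Fintype G] {q : γ → ℝ} {fu : γ → U} {fv : γ → V} {fa : γ → α}
    {fg : γ → G} {T : U → V → α × G → ℝ} (hq : ∀ c, 0 ≤ q c)
    (hT : ∀ u v w, pushf q (fun c => (fu c, fv c, fa c, fg c)) (u, v, w) =
      pushf q (fun c => (fu c, fv c)) (u, v) * T u v w) :
    ∑ u, pushf q fu u * hh (m1 (ck q fu fv) T u) =
      Hn q (fun c => (fu c, fa c, fg c)) - Hn q (fun c => (fu c, fg c)) := by
  rw [HU_eq, EX_push (fw := fun c => (fa c, fg c)) hq hT]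
  have hm := m1_push (fw := fun c => (fa c, fg c)) hq hT
  have hs : ∀ u g, pushf q fu u * ∑ a, m1 (ck q fu fv) T u (a, g) =
      pushf q (fun c => (fu c, fg c)) (u, g) := by
    intro u g
    rw [Finset.mul_sum]
    simp only [← hm]
    rw [← sum_pushf_pair q (fun c => (fu c, fg c)) fa (u, g)]
    refine Finset.sum_congr rfl fun v _ => ?_
    exact (pushf_inj q (fun c => ((fu c, fg c), fa c)) (fun x => (x.1.1, x.2, x.1.2))
      (Function.LeftInverse.injective (g := fun x => ((x.1, x.2.2), x.2.1)) (fun _ => rfl))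
      ((u, g), v))
  have : ∀ c, q c * (Real.log (∑ a, m1 (ck q fu fv) T (fu c) (a, fg c)) -
      Real.log (m1 (ck q fu fv) T (fu c) (fa c, fg c))) =
      q c * Real.log (pushf q (fun c => (fu c, fg c)) (fu c, fg c)) -
      q c * Real.log (pushf q (fun c => (fu c, fa c, fg c)) (fu c, fa c, fg c)) := by
    intro c
    by_cases hc : q c = 0
    · simp [hc]
    have p1 := pushf_pos hq (fun c => (fu c, fg c)) hc
    have p2 := pushf_pos hq (fun c => (fu c, fa c, fg c)) hc
    have p3 := pushf_pos hq fu hc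
    rw [hm] at p2 ⊢
    rw [← hs] at p1 ⊢
    have t1 := (right_ne_zero_of_mul p1.ne')
    have t2 := (right_ne_zero_of_mul p2.ne')
    rw [Real.log_mul p3.ne' t1, Real.log_mul p3.ne' t2]
    ring
  simp only [this, Finset.sum_sub_distrib]
  rw [Hn_log q (fun c => (fu c, fa c, fg c)), Hn_log q (fun c => (fu c, fg c))]
  ring

lemma condH_eq_hh (q : γ → ℝ) (f : γ → α) (g : γ → β) :
    condH q f g = hh (pushf q (fun c => (f c, g c))) / Real.log 2 := by
  unfold condH
  rw [Hof_eq, Hof_eq, ← sub_div]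
  congr 1
  unfold Hn hh h1
  rw [Finset.sum_sub_distrib, Fintype.sum_prod_type_right]
  simp only [sum_pushf_pair_left]

end Single

/-! ### Codes -/

section Codes

/-- zipping two sequences -/
def arr2 (α β : Type) (n : ℕ) : ((Fin n → α) × (Fin n → β)) ≃ (Fin n → α × β) where
  toFun y := fun i => (y.1 i, y.2 i)
  invFun x := (fun i => (x i).1, fun i => (x i).2)
  left_inv x := by simp
  right_inv y := by simp

/-- law of the source component `A` -/
noncomputable def srcA (pS : A × B × E → ℝ) : A → ℝ := pushf pS (fun w => w.1)
/-- conditional law of `B` given `A` -/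
noncomputable def srcB (pS : A × B × E → ℝ) : A → B → ℝ := ck pS (fun w => w.1) (fun w => w.2.1)
/-- conditional law of `E` given `A` -/
noncomputable def srcE (pS : A × B × E → ℝ) : A → E → ℝ := ck pS (fun w => w.1) (fun w => w.2.2)
/-- marginal channel to `Y` -/
noncomputable def chY (Wch : X → Y × Z → ℝ) (x : X) (y : Y) : ℝ := ∑ z, Wch x (y, z)
/-- marginal channel to `Z` -/
noncomputable def chZ (Wch : X → Y × Z → ℝ) (x : X) (z : Z) : ℝ := ∑ y, Wch x (y, z)

lemma chY_isKernel {Wch : X → Y × Z → ℝ} (hW : IsKernel Wch) : IsKernel (chY Wch) := fun x =>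
  ⟨fun y => Finset.sum_nonneg fun z _ => (hW x).1 _, by
    have := (hW x).2
    rw [Fintype.sum_prod_type] at this
    exact this⟩

lemma chZ_isKernel {Wch : X → Y × Z → ℝ} (hW : IsKernel Wch) : IsKernel (chZ Wch) := fun x =>
  ⟨fun y => Finset.sum_nonneg fun z _ => (hW x).1 _, by
    have := (hW x).2
    rw [Fintype.sum_prod_type_right] at this
    exact this⟩

lemma sum_srcB {pS : A × B × E → ℝ} (hp : ∀ w, 0 ≤ pS w) (a : A) (b : B) :
    ∑ e, pS (a, b, e) = srcA pS a * srcB pS a b := by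
  classical
  unfold srcA srcB
  rw [← mul_ck hp]
  unfold pushf
  simp only [Fintype.sum_prod_type, Prod.mk.injEq]
  rw [Finset.sum_eq_single a (by intro a' _ h; simp [h]) (by simp),
    Finset.sum_eq_single b (by intro a' _ h; simp [h]) (by simp)]
  simp

lemma sum_srcE {pS : A × B × E → ℝ} (hp : ∀ w, 0 ≤ pS w) (a : A) (e : E) :
    ∑ b, pS (a, b, e) = srcA pS a * srcE pS a e := by
  classical
  unfold srcA srcE
  rw [← mul_ck hp]
  unfold pushf
  simp only [Fintype.sum_prod_type, Prod.mk.injEq]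
  rw [Finset.sum_eq_single a (by intro a' _ h; simp [h]) (by simp)]
  simp

lemma marg1 {β ε χ υ ζ : Type} [Fintype β] [Fintype ε] [Fintype χ] [Fintype υ] [Fintype ζ]
    (P : β → ε → ℝ) (F : χ → ℝ) (W : χ → υ → ζ → ℝ) (φ : β → υ → ℝ) :
    ∑ b, ∑ e, ∑ x, ∑ y, ∑ z, P b e * F x * W x y z * φ b y =
      ∑ x, F x * ∑ b, ∑ y, (∑ e, P b e) * (∑ z, W x y z) * φ b y := by
  simp only [Finset.mul_sum, Finset.sum_mul]
  have : ∀ b, ∑ e, ∑ x, ∑ y, ∑ z, P b e * F x * W x y z * φ b y =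
      ∑ x, ∑ y, ∑ z, ∑ e, P b e * F x * W x y z * φ b y := by
    intro b
    rw [Finset.sum_comm]
    refine Finset.sum_congr rfl fun x _ => ?_
    rw [Finset.sum_comm]
    refine Finset.sum_congr rfl fun y _ => ?_
    rw [Finset.sum_comm]
  simp only [this]
  rw [Finset.sum_comm]
  refine Finset.sum_congr rfl fun x _ => Finset.sum_congr rfl fun b _ =>
    Finset.sum_congr rfl fun y _ => ?_
  refine Finset.sum_congr rfl fun z _ => Finset.sum_congr rfl fun e _ => ?_
  ring

lemma marg2 {β ε χ υ ζ : Type} [Fintype β] [Fintype ε] [Fintype χ] [Fintype υ] [Fintype ζ]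
    (P : β → ε → ℝ) (F : χ → ℝ) (W : χ → υ → ζ → ℝ) (φ : ε → ζ → ℝ) :
    ∑ b, ∑ e, ∑ x, ∑ y, ∑ z, P b e * F x * W x y z * φ e z =
      ∑ x, F x * ∑ e, ∑ z, (∑ b, P b e) * (∑ y, W x y z) * φ e z := by
  rw [← marg1 (fun e b => P b e) F (fun x z y => W x y z) φ, Finset.sum_comm]
  refine Finset.sum_congr rfl fun x _ => Finset.sum_congr rfl fun b _ =>
    Finset.sum_congr rfl fun y _ => ?_
  rw [Finset.sum_comm]

variable {V : Type} [Fintype V]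

open Classical in
/-- channel encoder obtained from a stochastic choice of `V`-sequences -/
noncomputable def encF (xfun : V → A → X) {n : ℕ} (enc : (Fin n → A) → (Fin n → V) → ℝ)
    (a : Fin n → A) (x : Fin n → X) : ℝ :=
  ∑ v, enc a v * (if x = (fun i => xfun (v i) (a i)) then 1 else 0)

lemma sum_encF (xfun : V → A → X) {n : ℕ} (enc : (Fin n → A) → (Fin n → V) → ℝ)
    (a : Fin n → A) (φ : (Fin n → X) → ℝ) :
    ∑ x, encF xfun enc a x * φ x = ∑ v, enc a v * φ (fun i => xfun (v i) (a i)) := by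
  classical
  unfold encF
  simp only [Finset.sum_mul]
  rw [Finset.sum_comm]
  refine Finset.sum_congr rfl fun v _ => ?_
  rw [Finset.sum_eq_single (fun i => xfun (v i) (a i)) (by intro x _ h; simp [h]) (by simp)]
  simp

lemma encF_isKernel (xfun : V → A → X) {n : ℕ} {enc : (Fin n → A) → (Fin n → V) → ℝ}
    (h : IsKernel enc) : IsKernel (encF xfun enc) := by
  intro a
  refine ⟨fun x => Finset.sum_nonneg fun v _ => mul_nonneg ((h a).1 v) (by split_ifs <;> simp), ?_⟩
  have := sum_encF xfun enc a (fun _ => 1)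
  simp only [mul_one] at this
  rw [this, (h a).2]

lemma code_cost {pS : A × B × E → ℝ} (hp : ∀ w, 0 ≤ pS w) (Wch : X → Y × Z → ℝ)
    (xfun : V → A → X) {n : ℕ} (enc : (Fin n → A) → (Fin n → V) → ℝ)
    (φ : (Fin n → A) → (Fin n → B) → (Fin n → Y) → ℝ) :
    expVal (codeJoint pS Wch (encF xfun enc)) (fun w => φ w.1 w.2.1 w.2.2.2.2.1) =
    ∑ a : Fin n → A, ∑ v, ∑ d : (Fin n → B) × (Fin n → Y), (∏ i, srcA pS (a i)) * enc a v *
      (∏ i, srcB pS (a i) (d.1 i) * chY Wch (xfun (v i) (a i)) (d.2 i)) * φ a d.1 d.2 := by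
  unfold expVal codeJoint
  rw [Fintype.sum_prod_type]
  refine Finset.sum_congr rfl fun a _ => ?_
  simp only [Fintype.sum_prod_type]
  rw [marg1 (fun (b : Fin n → B) (e : Fin n → E) => ∏ i, pS (a i, b i, e i)) (encF xfun enc a)
    (fun x (y : Fin n → Y) (z : Fin n → Z) => ∏ i, Wch (x i) (y i, z i)) (φ a), sum_encF]
  refine Finset.sum_congr rfl fun v _ => ?_
  rw [Finset.mul_sum]
  refine Finset.sum_congr rfl fun b _ => ?_
  rw [Finset.mul_sum]
  refine Finset.sum_congr rfl fun y _ => ?_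
  rw [← Fintype.prod_sum (fun i e => pS (a i, b i, e)),
    ← Fintype.prod_sum (fun i z => Wch (xfun (v i) (a i)) (y i, z))]
  simp only [sum_srcB hp, Finset.prod_mul_distrib, chY]
  ring

lemma code_push {pS : A × B × E → ℝ} (hp : ∀ w, 0 ≤ pS w) (Wch : X → Y × Z → ℝ)
    (xfun : V → A → X) {n : ℕ} (enc : (Fin n → A) → (Fin n → V) → ℝ) :
    pushf (codeJoint pS Wch (encF xfun enc)) (fun w => (w.1, (w.2.2.1, w.2.2.2.2.2))) =
    fun w => (∏ i, srcA pS (w.1 i)) * ∑ v, enc w.1 v *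
      ∏ i, (srcE pS (w.1 i) (w.2.1 i) * chZ Wch (xfun (v i) (w.1 i)) (w.2.2 i)) := by
  classical
  funext ⟨a, e, z⟩
  have h0 : pushf (codeJoint pS Wch (encF xfun enc)) (fun w => (w.1, (w.2.2.1, w.2.2.2.2.2)))
      (a, e, z) = ∑ w, codeJoint pS Wch (encF xfun enc) w *
        ((if w.1 = a then 1 else 0) * ((if w.2.2.1 = e then 1 else 0) *
          (if w.2.2.2.2.2 = z then 1 else 0))) := by
    unfold pushf
    refine Finset.sum_congr rfl fun w _ => ?_
    by_cases h1 : w.1 = a <;> by_cases h2 : w.2.2.1 = e <;> by_cases h3 : w.2.2.2.2.2 = z <;>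
      simp [h1, h2, h3]
  rw [h0]
  unfold codeJoint
  rw [Fintype.sum_prod_type, Finset.sum_eq_single a (by intro a' _ h; simp [h]) (by simp)]
  simp only [if_true, one_mul]
  simp only [Fintype.sum_prod_type]
  rw [marg2 (fun (b : Fin n → B) (e : Fin n → E) => ∏ i, pS (a i, b i, e i)) (encF xfun enc a)
    (fun x (y : Fin n → Y) (z : Fin n → Z) => ∏ i, Wch (x i) (y i, z i))
    (fun e' z' => (if e' = e then 1 else 0) * (if z' = z then 1 else 0)), sum_encF, Finset.mul_sum]
  refine Finset.sum_congr rfl fun v _ => ?_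
  rw [Finset.sum_eq_single e (by intro a' _ h; simp [h]) (by simp),
    Finset.sum_eq_single z (by intro a' _ h; simp [h]) (by simp)]
  rw [← Fintype.prod_sum (fun i b => pS (a i, b, e i)),
    ← Fintype.prod_sum (fun i y => Wch (xfun (v i) (a i)) (y, z i))]
  simp only [sum_srcE hp, Finset.prod_mul_distrib, chZ]
  simp only [if_true, mul_one]
  ring

end Codes

section Strict

variable {γ U V : Type} [Fintype γ] [Fintype U] [Fintype V]

/-- A single-letter system: joint law `q` of all the variables with the required factorisations. -/
structure Sys (pS : A × B × E → ℝ) (Wch : X → Y × Z → ℝ) (q : γ → ℝ) (fu : γ → U) (fv : γ → V)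
    (fa : γ → A) (fb : γ → B) (fe : γ → E) (fy : γ → Y) (fz : γ → Z) (xfun : V → A → X) : Prop where
  pmf : IsPMF q
  src : pushf q fa = srcA pS
  fBY : ∀ u v a b y, pushf q (fun c => (fu c, fv c, fa c, fb c, fy c)) (u, v, a, b, y) =
    pushf q (fun c => (fu c, fv c, fa c)) (u, v, a) * (srcB pS a b * chY Wch (xfun v a) y)
  fEZ : ∀ u v a e z, pushf q (fun c => (fu c, fv c, fa c, fe c, fz c)) (u, v, a, e, z) =
    pushf q (fun c => (fu c, fv c, fa c)) (u, v, a) * (srcE pS a e * chZ Wch (xfun v a) z)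

lemma prod_isPMF {β δ : Type} [Fintype β] [Fintype δ] {p : β → ℝ} {r : δ → ℝ}
    (hp : IsPMF p) (hr : IsPMF r) : IsPMF (fun x : β × δ => p x.1 * r x.2) := by
  refine ⟨fun x => mul_nonneg (hp.1 _) (hr.1 _), ?_⟩
  rw [Fintype.sum_prod_type]
  simp only [← Finset.mul_sum, hr.2, mul_one, hp.2]

lemma achievable_strict {pS : A × B × E → ℝ} (hpS : IsPMF pS)
    {Wch : X → Y × Z → ℝ} (hW : IsKernel Wch) {d : A → A → ℝ} {dmax : ℝ} (hdmax : 0 ≤ dmax)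
    (hd : ∀ a a', 0 ≤ d a a' ∧ d a a' ≤ dmax) {D Δ : ℝ} (hD : 0 ≤ D)
    {q : γ → ℝ} {fu : γ → U} {fv : γ → V} {fa : γ → A} {fb : γ → B} {fe : γ → E} {fy : γ → Y}
    {fz : γ → Z} {xfun : V → A → X} (S : Sys pS Wch q fu fv fa fb fe fy fz xfun)
    (Ahat : V → B → Y → A)
    (c1 : I2 q fu fa ≤ I2 q fu (fun c => (fb c, fy c)))
    (c2 : Iv q fu fv fa < Iv q fu fv (fun c => (fb c, fy c)))
    (c3 : ∑ c, q c * d (fa c) (Ahat (fv c) (fb c) (fy c)) ≤ D)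
    (c4 : Δ * Real.log 2 ≤ Hn q (fun c => (fu c, fa c, fe c, fz c)) -
      Hn q (fun c => (fu c, fe c, fz c)) -
      max 0 (Iv q fu fv (fun c => (fa c, fe c, fz c)) - Iv q fu fv (fun c => (fb c, fy c)))) :
    Achievable pS Wch d 1 D Δ := by
  intro ε hε
  have hl2 : 0 < Real.log 2 := Real.log_pos (by norm_num)
  have hq := S.pmf
  have hAne : Nonempty A := by
    by_contra hcon
    rw [not_nonempty_iff] at hcon
    have := hpS.2
    simp at this
  set K : U → V → A → ℝ := fun u v => ck q (fun c => (fu c, fv c)) fa (u, v) with hKd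
  have hK : ∀ u v, IsPMF (K u v) := fun u v => ck_isKernel hq _ _ (u, v)
  have hKT : ∀ u v w, pushf q (fun c => (fu c, fv c, fa c)) (u, v, w) =
      pushf q (fun c => (fu c, fv c)) (u, v) * K u v w := by
    intro u v w
    rw [hKd, ← mul_ck hq.1]
    exact pushf_inj q (fun c => ((fu c, fv c), fa c)) (fun x => (x.1.1, x.1.2, x.2))
      (Function.LeftInverse.injective (g := fun x => ((x.1, x.2.1), x.2.2)) (fun _ => rfl))
      ((u, v), w)
  set κD : V → A → B × Y → ℝ := fun v a w => srcB pS a w.1 * chY Wch (xfun v a) w.2 with hκD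
  set κG : V → A → E × Z → ℝ := fun v a w => srcE pS a w.1 * chZ Wch (xfun v a) w.2 with hκG
  have hDk : ∀ v a, IsPMF (κD v a) := fun v a =>
    prod_isPMF (ck_isKernel hpS _ _ a) (chY_isKernel hW _)
  have hGk : ∀ v a, IsPMF (κG v a) := fun v a =>
    prod_isPMF (ck_isKernel hpS _ _ a) (chZ_isKernel hW _)
  set TD : U → V → B × Y → ℝ := fun u v w => ∑ a, K u v a * κD v a w with hTD
  set TG : U → V → A × E × Z → ℝ := fun u v w => K u v w.1 * κG v w.1 w.2 with hTG
  set T5 : U → V → A × B × Y → ℝ := fun u v w => K u v w.1 * κD v w.1 w.2 with hT5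
  have hT5T : ∀ u v w, pushf q (fun c => (fu c, fv c, fa c, fb c, fy c)) (u, v, w) =
      pushf q (fun c => (fu c, fv c)) (u, v) * T5 u v w := by
    rintro u v ⟨a, b, y⟩
    rw [S.fBY, hKT]
    simp only [hT5, hκD]
    ring
  have hTGT : ∀ u v w, pushf q (fun c => (fu c, fv c, fa c, fe c, fz c)) (u, v, w) =
      pushf q (fun c => (fu c, fv c)) (u, v) * TG u v w := by
    rintro u v ⟨a, b, y⟩
    rw [S.fEZ, hKT]
    simp only [hTG, hκG]
    ring
  have hTDT : ∀ u v w, pushf q (fun c => (fu c, fv c, fb c, fy c)) (u, v, w) =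
      pushf q (fun c => (fu c, fv c)) (u, v) * TD u v w := by
    rintro u v w
    rw [← sum_pushf_pair q (fun c => (fu c, fv c, fb c, fy c)) fa (u, v, w)]
    simp only [hTD]
    rw [Finset.mul_sum]
    refine Finset.sum_congr rfl fun a _ => ?_
    rw [← hT5T u v (a, w)]
    exact (pushf_inj q (fun c => ((fu c, fv c, fb c, fy c), fa c))
      (fun x => (x.1.1, x.1.2.1, x.2, x.1.2.2))
      (Function.LeftInverse.injective (g := fun x => ((x.1, x.2.1, x.2.2.2), x.2.2.1))
        (fun _ => rfl)) ((u, v, w), a)).symm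
  set IA := Iv q fu fv fa with hIA
  set IB := Iv q fu fv (fun c => (fb c, fy c)) with hIB
  set IG := Iv q fu fv (fun c => (fa c, fe c, fz c)) with hIG
  have hIA0 : 0 ≤ IA := Iv_nonneg hq.1 _ _ _
  have hI20 : 0 ≤ I2 q fu fa := I2_nonneg hq _ _
  set η := min (IB - IA) (ε * Real.log 2 / 2) with hη
  have hη0 : 0 < η := lt_min (by linarith) (by positivity)
  have hη1 : η ≤ IB - IA := min_le_left _ _
  have hη2 : η ≤ ε * Real.log 2 / 2 := min_le_right _ _
  set ε' := min ε (ε * Real.log 2 / 2) with hε'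
  have hε0 : 0 < ε' := lt_min hε (by positivity)
  obtain ⟨n, enc, dec, hn, k1, k2, k3⟩ := block_core (pU := pushf q fu) (pV := ck q fu fv)
    (pushf_isPMF hq fu) (ck_isKernel hq _ _) hK hDk hGk (Dn := fun n => (Fin n → B) × (Fin n → Y))
    (Gn := fun n => (Fin n → E) × (Fin n → Z)) (fun n => arr2 B Y n) (fun n => arr2 E Z n)
    (cost := fun a v w => d a (Ahat v w.1 w.2)) (dmax := dmax) (D0 := D)
    (fun a v w => (hd _ _).1) (fun a v w => (hd _ _).2) hD hdmax (TD := TD) (fun _ _ _ => rfl)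
    (TG := TG) (fun _ _ _ => rfl) (R1 := I2 q fu fa + η / 2) (R2 := IB - η)
    (by linarith) (by linarith)
    (by
      rw [EX_logT_m0 hq.1 hKT]
      linarith)
    (by
      rw [EX_logm1_m0 hq.1 hKT]
      linarith)
    (by
      rw [EX_logT_m1 (fw := fun c => (fb c, fy c)) hq.1 hTDT]
      linarith)
    (by
      rw [EX_logT_m0 (fw := fun c => (fb c, fy c)) hq.1 hTDT]
      linarith)
    (by
      have e1 := EX_push (fw := fun c => (fa c, fb c, fy c)) hq.1 hT5T
        (fun _ v w => d w.1 (Ahat v w.2.1 w.2.2))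
      refine le_trans (le_of_eq ?_) c3
      rw [← e1]
      unfold EX
      rw [← EC_sum]
      congr 1
      funext u v
      rw [Fintype.sum_prod_type])
    hε0
  have hsrc : ∀ a, m0 (pushf q fu) (ck q fu fv) K a = srcA pS a := by
    intro a
    rw [m0_push hq.1 hKT, S.src]
  simp only [hsrc] at k2 k3
  refine ⟨n, n, hn, encF xfun enc, fun b y i => Ahat (dec (b, y) i) (b i) (y i),
    encF_isKernel xfun k1, ?_, ?_, ?_⟩
  · have : (n : ℝ) / n = 1 := div_self (by positivity)
    linarith
  · have := code_cost hpS.1 Wch xfun enc (fun a b y =>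
      seqDist d a (fun i => Ahat (dec (b, y) i) (b i) (y i)))
    rw [this]
    refine le_trans ?_ (k2.trans (add_le_add_right (min_le_left _ _) D))
    exact le_of_eq rfl
  · rw [condH_eq_hh, code_push hpS.1]
    rw [HU_push hq.1 hTGT, EX_logT_m1 (fw := fun c => (fa c, fe c, fz c)) hq.1 hTGT] at k3
    have hnr : (0 : ℝ) < n := by exact_mod_cast hn
    have b1 : max 0 (IG - (IB - η)) ≤ max 0 (IG - IB) + η := by
      have e1 := le_max_left 0 (IG - IB)
      have e2 := le_max_right 0 (IG - IB)
      apply max_le <;> linarith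
    have b2 : ε' ≤ ε * Real.log 2 / 2 := min_le_right _ _
    have b3 : (Δ - ε) * Real.log 2 ≤ Hn q (fun c => (fu c, fa c, fe c, fz c)) -
      Hn q (fun c => (fu c, fe c, fz c)) - max 0 (IG - (IB - η)) - ε' := by
      linarith
    have b4 := (mul_le_mul_of_nonneg_left b3 hnr.le).trans k3
    rw [← div_eq_inv_mul, div_div, le_div_iff₀ (by positivity)]
    refine le_trans (le_of_eq (by ring)) (b4.trans (le_of_eq rfl))

end Strict

/-! ### The hybrid system, mixtures -/

section Hyb

variable {γ U V W : Type} [Fintype γ] [Fintype U] [Fintype V] [Fintype W]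

lemma condMutInf_eq (q : γ → ℝ) (f : γ → V) (g : γ → W) (h : γ → U) :
    condMutInf q f g h = Iv q h f g / Real.log 2 := by
  unfold condMutInf condH Iv
  simp only [Hof_eq]
  rw [Hn_congr_inj q (fun c => (h c, f c)) (fun c => (f c, h c)) (fun x => (x.2, x.1))
    (Function.LeftInverse.injective (g := fun x => (x.2, x.1)) (fun _ => rfl)) (fun _ => rfl),
    Hn_congr_inj q (fun c => (h c, g c)) (fun c => (g c, h c)) (fun x => (x.2, x.1))
    (Function.LeftInverse.injective (g := fun x => (x.2, x.1)) (fun _ => rfl)) (fun _ => rfl),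
    Hn_congr_inj q (fun c => (h c, f c, g c)) (fun c => (f c, g c, h c))
      (fun x => (x.2.1, x.2.2, x.1))
    (Function.LeftInverse.injective (g := fun x => (x.2.2, x.1, x.2.1)) (fun _ => rfl))
    (fun _ => rfl)]
  ring

lemma mutInf_eq (q : γ → ℝ) (f : γ → V) (g : γ → W) :
    mutInf q f g = I2 q f g / Real.log 2 := by
  unfold mutInf I2
  simp only [Hof_eq]
  ring

lemma hybrid_sys {pS : A × B × E → ℝ} (hpS : IsPMF pS) {Wch : X → Y × Z → ℝ} (hW : IsKernel Wch)
    {pU : V → U → ℝ} {pVX : A → V × X → ℝ} {xfun : V → A → X} (hU : IsKernel pU)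
    (hVX : IsKernel pVX) (hx : ∀ a v x, pVX a (v, x) ≠ 0 → x = xfun v a) :
    Sys pS Wch (hybridJoint pS Wch pU pVX) (fun w => w.1) (fun w => w.2.1) (fun w => w.2.2.1)
      (fun w => w.2.2.2.1) (fun w => w.2.2.2.2.1) (fun w => w.2.2.2.2.2.2.1)
      (fun w => w.2.2.2.2.2.2.2) xfun ∧
    ∀ u v a, pushf (hybridJoint pS Wch pU pVX) (fun c => (c.1, c.2.1, c.2.2.1)) (u, v, a) =
      pU v u * (∑ x, pVX a (v, x)) * srcA pS a := by
  classical
  set q := hybridJoint pS Wch pU pVX with hq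
  have hq0 : ∀ w, 0 ≤ q w := fun w => mul_nonneg (mul_nonneg (mul_nonneg ((hU _).1 _)
    ((hVX _).1 _)) (hpS.1 _)) ((hW _).1 _)
  -- full BY law
  have m5 : ∀ u v a b y, pushf q (fun c => (c.1, c.2.1, c.2.2.1, c.2.2.2.1, c.2.2.2.2.2.2.1))
      (u, v, a, b, y) = pU v u * (∑ x, pVX a (v, x)) * srcA pS a *
        (srcB pS a b * chY Wch (xfun v a) y) := by
    intro u v a b y
    unfold pushf
    simp only [Fintype.sum_prod_type, Prod.mk.injEq]
    rw [Finset.sum_eq_single u (by intro _ _ h; simp [h]) (by simp),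
      Finset.sum_eq_single v (by intro _ _ h; simp [h]) (by simp),
      Finset.sum_eq_single a (by intro _ _ h; simp [h]) (by simp),
      Finset.sum_eq_single b (by intro _ _ h; simp [h]) (by simp)]
    simp only [true_and]
    have : ∀ e x, ∑ y', ∑ z, (if y' = y then
        q (u, v, a, b, e, x, y', z) else 0) =
        pU v u * pVX a (v, x) * pS (a, b, e) * chY Wch (xfun v a) y := by
      intro e x
      rw [Finset.sum_eq_single y (by intro _ _ h; simp [h]) (by simp)]
      simp only [if_true, hq, hybridJoint]
      rw [← Finset.mul_sum]
      by_cases h0 : pVX a (v, x) = 0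
      · simp [h0]
      · rw [← hx a v x h0]
        rfl
    simp only [this]
    rw [mul_assoc _ (srcA pS a), ← mul_assoc (srcA pS a), ← sum_srcB hpS.1]
    simp only [Finset.mul_sum, Finset.sum_mul]
    refine Finset.sum_congr rfl fun e _ => Finset.sum_congr rfl fun x _ => ?_
    ring
  have m5' : ∀ u v a e z, pushf q (fun c => (c.1, c.2.1, c.2.2.1, c.2.2.2.2.1, c.2.2.2.2.2.2.2))
      (u, v, a, e, z) = pU v u * (∑ x, pVX a (v, x)) * srcA pS a *
        (srcE pS a e * chZ Wch (xfun v a) z) := by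
    intro u v a e z
    unfold pushf
    simp only [Fintype.sum_prod_type, Prod.mk.injEq]
    rw [Finset.sum_eq_single u (by intro _ _ h; simp [h]) (by simp),
      Finset.sum_eq_single v (by intro _ _ h; simp [h]) (by simp),
      Finset.sum_eq_single a (by intro _ _ h; simp [h]) (by simp)]
    simp only [true_and]
    have : ∀ b, ∑ e', ∑ x, ∑ y, ∑ z', (if e' = e ∧ z' = z then
        q (u, v, a, b, e', x, y, z') else 0) =
        ∑ x, pU v u * pVX a (v, x) * pS (a, b, e) * chZ Wch (xfun v a) z := by
      intro b
      rw [Finset.sum_eq_single e (by intro _ _ h; simp [h]) (by simp)]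
      refine Finset.sum_congr rfl fun x _ => ?_
      simp only [true_and]
      have : ∀ y, ∑ z', (if z' = z then
          q (u, v, a, b, e, x, y, z') else 0) = q (u, v, a, b, e, x, y, z) := by
        intro y
        rw [Finset.sum_eq_single z (by intro _ _ h; simp [h]) (by simp)]
        simp
      simp only [this]
      simp only [hq, hybridJoint]
      rw [← Finset.mul_sum]
      by_cases h0 : pVX a (v, x) = 0
      · simp [h0]
      · rw [← hx a v x h0]
        rfl
    simp only [this]
    rw [mul_assoc _ (srcA pS a), ← mul_assoc (srcA pS a), ← sum_srcE hpS.1]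
    simp only [Finset.mul_sum, Finset.sum_mul]
    refine Finset.sum_congr rfl fun e _ => Finset.sum_congr rfl fun x _ => ?_
    ring
  have m3 : ∀ u v a, pushf q (fun c => (c.1, c.2.1, c.2.2.1)) (u, v, a) =
      pU v u * (∑ x, pVX a (v, x)) * srcA pS a := by
    intro u v a
    have e1 := sum_pushf_pair q (fun c => (c.1, c.2.1, c.2.2.1))
      (fun c => (c.2.2.2.1, c.2.2.2.2.2.2.1)) (u, v, a)
    rw [← e1]
    have e2 : ∀ t : B × Y, pushf q (fun c => ((c.1, c.2.1, c.2.2.1),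
        (c.2.2.2.1, c.2.2.2.2.2.2.1))) ((u, v, a), t) =
        pU v u * (∑ x, pVX a (v, x)) * srcA pS a * (srcB pS a t.1 * chY Wch (xfun v a) t.2) := by
      intro t
      rw [← m5]
      exact (pushf_inj q (fun c => ((c.1, c.2.1, c.2.2.1), (c.2.2.2.1, c.2.2.2.2.2.2.1)))
        (fun x => (x.1.1, x.1.2.1, x.1.2.2, x.2))
        (Function.LeftInverse.injective (g := fun x => ((x.1, x.2.1, x.2.2.1), x.2.2.2))
        (fun _ => rfl)) ((u, v, a), t)).symm
    simp only [e2]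
    have e3 := (prod_isPMF (p := srcB pS a) (r := chY Wch (xfun v a)) (ck_isKernel hpS _ _ a)
      (chY_isKernel hW (xfun v a))).2
    rw [← Finset.mul_sum]
    simp only at e3
    rw [e3, mul_one]
  have ma : ∀ a, pushf q (fun c => c.2.2.1) a = srcA pS a := by
    intro a
    have e1 := sum_pushf_pair q (fun c => c.2.2.1) (fun c => (c.1, c.2.1)) a
    rw [← e1]
    have e2 : ∀ t : U × V, pushf q (fun c => (c.2.2.1, (c.1, c.2.1))) (a, t) =
        pU t.2 t.1 * (∑ x, pVX a (t.2, x)) * srcA pS a := by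
      intro t
      rw [← m3]
      exact (pushf_inj q (fun c => (c.2.2.1, (c.1, c.2.1)))
        (fun x => (x.2.1, x.2.2, x.1))
        (Function.LeftInverse.injective (g := fun x => (x.2.2, x.1, x.2.1))
        (fun _ => rfl)) (a, t)).symm
    simp only [e2]
    rw [← Finset.sum_mul, Fintype.sum_prod_type_right]
    simp only [← Finset.sum_mul, (hU _).2, one_mul]
    rw [← Fintype.sum_prod_type (f := fun x => pVX a x), (hVX a).2, one_mul]
  refine ⟨⟨⟨hq0, ?_⟩, funext ma, ?_, ?_⟩, m3⟩
  · rw [← sum_pushf q (fun c => c.2.2.1)]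
    simp only [ma]
    exact (pushf_isPMF hpS _).2
  · intro u v a b y
    rw [m5, m3]
  · intro u v a e z
    rw [m5', m3]

end Hyb

section Mix

variable {γ₁ γ₂ α α₁ α₂ : Type} [Fintype γ₁] [Fintype γ₂] [Fintype α] [Fintype α₁] [Fintype α₂]

/-- mixture of two laws -/
noncomputable def mixq (t : ℝ) (q₁ : γ₁ → ℝ) (q₂ : γ₂ → ℝ) : γ₁ ⊕ γ₂ → ℝ :=
  Sum.elim (fun c => (1 - t) * q₁ c) (fun c => t * q₂ c)

lemma mixq_isPMF {t : ℝ} (h0 : 0 ≤ t) (h1 : t ≤ 1) {q₁ : γ₁ → ℝ} {q₂ : γ₂ → ℝ}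
    (hq₁ : IsPMF q₁) (hq₂ : IsPMF q₂) : IsPMF (mixq t q₁ q₂) := by
  refine ⟨?_, ?_⟩
  · rintro (c | c)
    · exact mul_nonneg (by linarith) (hq₁.1 c)
    · exact mul_nonneg h0 (hq₂.1 c)
  · simp only [mixq, Fintype.sum_sum_type, Sum.elim_inl, Sum.elim_inr, ← Finset.mul_sum, hq₁.2,
      hq₂.2]
    ring

lemma pushf_mixq (t : ℝ) (q₁ : γ₁ → ℝ) (q₂ : γ₂ → ℝ) (F : γ₁ ⊕ γ₂ → α) (a : α) :
    pushf (mixq t q₁ q₂) F a = (1 - t) * pushf q₁ (fun c => F (Sum.inl c)) a +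
      t * pushf q₂ (fun c => F (Sum.inr c)) a := by
  simp only [pushf, mixq, Fintype.sum_sum_type, Sum.elim_inl, Sum.elim_inr, Finset.mul_sum, mul_ite,
    mul_zero]

lemma Hn_mix {t : ℝ} (h0 : 0 < t) (h1 : t < 1) {q₁ : γ₁ → ℝ} {q₂ : γ₂ → ℝ}
    (hq₁ : IsPMF q₁) (hq₂ : IsPMF q₂) (F : γ₁ ⊕ γ₂ → α) (f₁ : γ₁ → α₁) (f₂ : γ₂ → α₂)
    (j₁ : α₁ → α) (j₂ : α₂ → α) (hj₁ : Function.Injective j₁) (hj₂ : Function.Injective j₂)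
    (hF₁ : ∀ c, F (Sum.inl c) = j₁ (f₁ c)) (hF₂ : ∀ c, F (Sum.inr c) = j₂ (f₂ c))
    (hne : ∀ a b, j₁ a ≠ j₂ b) :
    Hn (mixq t q₁ q₂) F = (1 - t) * Hn q₁ f₁ + t * Hn q₂ f₂ -
      ((1 - t) * Real.log (1 - t) + t * Real.log t) := by
  rw [Hn_eq, Fintype.sum_sum_type, Hn_eq, Hn_eq]
  have z₁ : ∀ a, pushf q₂ (fun c => F (Sum.inr c)) (j₁ a) = 0 := by
    intro a
    unfold pushf
    refine Finset.sum_eq_zero fun c _ => ?_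
    rw [if_neg]
    show ¬ F (Sum.inr c) = j₁ a
    rw [hF₂]
    exact (hne _ _).symm
  have z₂ : ∀ a, pushf q₁ (fun c => F (Sum.inl c)) (j₂ a) = 0 := by
    intro a
    unfold pushf
    refine Finset.sum_eq_zero fun c _ => ?_
    rw [if_neg]
    show ¬ F (Sum.inl c) = j₂ a
    rw [hF₁]
    exact (hne _ _)
  have a₁ : ∀ c, mixq t q₁ q₂ (Sum.inl c) * Real.log (pushf (mixq t q₁ q₂) F (F (Sum.inl c))) =
      (1 - t) * (q₁ c * Real.log (pushf q₁ f₁ (f₁ c))) + q₁ c * ((1 - t) * Real.log (1 - t)) := by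
    intro c
    by_cases hc : q₁ c = 0
    · simp [mixq, hc]
    have p := pushf_pos hq₁.1 f₁ hc
    rw [pushf_mixq, hF₁, z₁]
    simp only [hF₁]
    rw [pushf_inj q₁ f₁ j₁ hj₁, mul_zero, add_zero, Real.log_mul (by linarith) p.ne']
    simp only [mixq, Sum.elim_inl]
    ring
  have a₂ : ∀ c, mixq t q₁ q₂ (Sum.inr c) * Real.log (pushf (mixq t q₁ q₂) F (F (Sum.inr c))) =
      t * (q₂ c * Real.log (pushf q₂ f₂ (f₂ c))) + q₂ c * (t * Real.log t) := by
    intro c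
    by_cases hc : q₂ c = 0
    · simp [mixq, hc]
    have p := pushf_pos hq₂.1 f₂ hc
    rw [pushf_mixq, hF₂, z₂]
    simp only [hF₂]
    rw [pushf_inj q₂ f₂ j₂ hj₂, mul_zero, zero_add, Real.log_mul (by linarith) p.ne']
    simp only [mixq, Sum.elim_inr]
    ring
  simp only [a₁, a₂, Finset.sum_add_distrib, ← Finset.mul_sum, ← Finset.sum_mul, hq₁.2, hq₂.2]
  ring

lemma Hn_mix_concave {t : ℝ} (h0 : 0 ≤ t) (h1 : t ≤ 1) {q₁ : γ₁ → ℝ} {q₂ : γ₂ → ℝ}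
    (hq₁ : IsPMF q₁) (hq₂ : IsPMF q₂) (F : γ₁ ⊕ γ₂ → α) :
    (1 - t) * Hn q₁ (fun c => F (Sum.inl c)) + t * Hn q₂ (fun c => F (Sum.inr c)) ≤
      Hn (mixq t q₁ q₂) F := by
  unfold Hn
  rw [Finset.mul_sum, Finset.mul_sum, ← Finset.sum_add_distrib]
  refine Finset.sum_le_sum fun a _ => ?_
  rw [pushf_mixq]
  exact Real.concaveOn_negMulLog.2 (pushf_nonneg hq₁.1 _ _) (pushf_nonneg hq₂.1 _ _)
    (by linarith) h0 (by ring)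

end Mix

/-! ### Mixing two systems -/

section Mix2

lemma pushf_zero {γ α : Type} [Fintype γ] (q : γ → ℝ) (f : γ → α) (a : α) (h : ∀ c, f c ≠ a) :
    pushf q f a = 0 := by
  unfold pushf
  exact Finset.sum_eq_zero fun c _ => if_neg (h c)

variable {γ₁ γ₂ U₁ V₁ U₂ V₂ W : Type} [Fintype γ₁] [Fintype γ₂] [Fintype U₁] [Fintype V₁]
  [Fintype U₂] [Fintype V₂] [Fintype W]

lemma Iv_mix {t : ℝ} (h0 : 0 < t) (h1 : t < 1) {q₁ : γ₁ → ℝ} {q₂ : γ₂ → ℝ}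
    (hq₁ : IsPMF q₁) (hq₂ : IsPMF q₂) (fu₁ : γ₁ → U₁) (fv₁ : γ₁ → V₁) (fu₂ : γ₂ → U₂)
    (fv₂ : γ₂ → V₂) (FW : γ₁ ⊕ γ₂ → W) :
    Iv (mixq t q₁ q₂) (Sum.map fu₁ fu₂) (Sum.map fv₁ fv₂) FW =
      (1 - t) * Iv q₁ fu₁ fv₁ (fun c => FW (Sum.inl c)) +
        t * Iv q₂ fu₂ fv₂ (fun c => FW (Sum.inr c)) := by
  unfold Iv
  rw [Hn_mix h0 h1 hq₁ hq₂ (fun c => (Sum.map fu₁ fu₂ c, Sum.map fv₁ fv₂ c))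
      (fun c => (fu₁ c, fv₁ c)) (fun c => (fu₂ c, fv₂ c))
      (fun x => (Sum.inl x.1, Sum.inl x.2)) (fun x => (Sum.inr x.1, Sum.inr x.2))
      (by rintro ⟨a, b⟩ ⟨c, d⟩ h; simpa using h) (by rintro ⟨a, b⟩ ⟨c, d⟩ h; simpa using h)
      (fun _ => rfl) (fun _ => rfl) (by intro a b; simp),
    Hn_mix h0 h1 hq₁ hq₂ (fun c => (Sum.map fu₁ fu₂ c, FW c))
      (fun c => (fu₁ c, FW (Sum.inl c))) (fun c => (fu₂ c, FW (Sum.inr c)))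
      (fun x => (Sum.inl x.1, x.2)) (fun x => (Sum.inr x.1, x.2))
      (by rintro ⟨a, b⟩ ⟨c, d⟩ h; simpa using h) (by rintro ⟨a, b⟩ ⟨c, d⟩ h; simpa using h)
      (fun _ => rfl) (fun _ => rfl) (by intro a b; simp),
    Hn_mix h0 h1 hq₁ hq₂ (fun c => (Sum.map fu₁ fu₂ c, Sum.map fv₁ fv₂ c, FW c))
      (fun c => (fu₁ c, fv₁ c, FW (Sum.inl c))) (fun c => (fu₂ c, fv₂ c, FW (Sum.inr c)))
      (fun x => (Sum.inl x.1, Sum.inl x.2.1, x.2.2)) (fun x => (Sum.inr x.1, Sum.inr x.2.1, x.2.2))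
      (by rintro ⟨a, b, e⟩ ⟨c, d, f⟩ h; simpa using h)
      (by rintro ⟨a, b, e⟩ ⟨c, d, f⟩ h; simpa using h)
      (fun _ => rfl) (fun _ => rfl) (by intro a b; simp),
    Hn_mix h0 h1 hq₁ hq₂ (Sum.map fu₁ fu₂) fu₁ fu₂ Sum.inl Sum.inr Sum.inl_injective
      Sum.inr_injective (fun _ => rfl) (fun _ => rfl) (by intro a b; simp)]
  ring

lemma Hn_mix_u {t : ℝ} (h0 : 0 < t) (h1 : t < 1) {q₁ : γ₁ → ℝ} {q₂ : γ₂ → ℝ}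
    (hq₁ : IsPMF q₁) (hq₂ : IsPMF q₂) (fu₁ : γ₁ → U₁) (fu₂ : γ₂ → U₂) (FW : γ₁ ⊕ γ₂ → W) :
    Hn (mixq t q₁ q₂) (fun c => (Sum.map fu₁ fu₂ c, FW c)) =
      (1 - t) * Hn q₁ (fun c => (fu₁ c, FW (Sum.inl c))) +
        t * Hn q₂ (fun c => (fu₂ c, FW (Sum.inr c))) -
      ((1 - t) * Real.log (1 - t) + t * Real.log t) :=
  Hn_mix h0 h1 hq₁ hq₂ (fun c => (Sum.map fu₁ fu₂ c, FW c))
      (fun c => (fu₁ c, FW (Sum.inl c))) (fun c => (fu₂ c, FW (Sum.inr c)))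
      (fun x => (Sum.inl x.1, x.2)) (fun x => (Sum.inr x.1, x.2))
      (by rintro ⟨a, b⟩ ⟨c, d⟩ h; simpa using h) (by rintro ⟨a, b⟩ ⟨c, d⟩ h; simpa using h)
      (fun _ => rfl) (fun _ => rfl) (by intro a b; simp)

variable {pS : A × B × E → ℝ} {Wch : X → Y × Z → ℝ}
  {q₁ : γ₁ → ℝ} {fu₁ : γ₁ → U₁} {fv₁ : γ₁ → V₁} {fa₁ : γ₁ → A} {fb₁ : γ₁ → B} {fe₁ : γ₁ → E}
  {fy₁ : γ₁ → Y} {fz₁ : γ₁ → Z} {xfun₁ : V₁ → A → X}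
  {q₂ : γ₂ → ℝ} {fu₂ : γ₂ → U₂} {fv₂ : γ₂ → V₂} {fa₂ : γ₂ → A} {fb₂ : γ₂ → B} {fe₂ : γ₂ → E}
  {fy₂ : γ₂ → Y} {fz₂ : γ₂ → Z} {xfun₂ : V₂ → A → X}

lemma pushf_mix_uv {t : ℝ} (FW : γ₁ ⊕ γ₂ → W) (u : U₁ ⊕ U₂) (v : V₁ ⊕ V₂) (w : W) :
    pushf (mixq t q₁ q₂) (fun c => (Sum.map fu₁ fu₂ c, Sum.map fv₁ fv₂ c, FW c)) (u, v, w) =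
      match u, v with
      | Sum.inl u, Sum.inl v =>
        (1 - t) * pushf q₁ (fun c => (fu₁ c, fv₁ c, FW (Sum.inl c))) (u, v, w)
      | Sum.inr u, Sum.inr v =>
        t * pushf q₂ (fun c => (fu₂ c, fv₂ c, FW (Sum.inr c))) (u, v, w)
      | _, _ => 0 := by
  rw [pushf_mixq]
  rcases u with u | u <;> rcases v with v | v
  · rw [pushf_zero q₂ _ _ (by intro c; simp), mul_zero, add_zero]
    simp only
    congr 1
    exact pushf_inj q₁ (fun c => (fu₁ c, fv₁ c, FW (Sum.inl c)))
      (fun x => (Sum.inl x.1, Sum.inl x.2.1, x.2.2))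
      (by rintro ⟨a, b, e⟩ ⟨c, d, f⟩ h; simpa using h) (u, v, w)
  · rw [pushf_zero q₂ _ _ (by intro c; simp), pushf_zero q₁ _ _ (by intro c; simp)]
    simp
  · rw [pushf_zero q₂ _ _ (by intro c; simp), pushf_zero q₁ _ _ (by intro c; simp)]
    simp
  · rw [pushf_zero q₁ _ _ (by intro c; simp), mul_zero, zero_add]
    simp only
    congr 1
    exact pushf_inj q₂ (fun c => (fu₂ c, fv₂ c, FW (Sum.inr c)))
      (fun x => (Sum.inr x.1, Sum.inr x.2.1, x.2.2))
      (by rintro ⟨a, b, e⟩ ⟨c, d, f⟩ h; simpa using h) (u, v, w)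

lemma mix_sys {t : ℝ} (h0 : 0 < t) (h1 : t < 1)
    (S₁ : Sys pS Wch q₁ fu₁ fv₁ fa₁ fb₁ fe₁ fy₁ fz₁ xfun₁)
    (S₂ : Sys pS Wch q₂ fu₂ fv₂ fa₂ fb₂ fe₂ fy₂ fz₂ xfun₂) :
    Sys pS Wch (mixq t q₁ q₂) (Sum.map fu₁ fu₂) (Sum.map fv₁ fv₂) (Sum.elim fa₁ fa₂)
      (Sum.elim fb₁ fb₂) (Sum.elim fe₁ fe₂) (Sum.elim fy₁ fy₂) (Sum.elim fz₁ fz₂)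
      (Sum.elim xfun₁ xfun₂) := by
  refine ⟨mixq_isPMF h0.le h1.le S₁.pmf S₂.pmf, ?_, ?_, ?_⟩
  · funext a
    rw [pushf_mixq]
    simp only [Sum.elim_inl, Sum.elim_inr]
    rw [show pushf q₁ (fun c => fa₁ c) = _ from S₁.src, show pushf q₂ (fun c => fa₂ c) = _ from S₂.src]
    ring
  · intro u v a b y
    rw [pushf_mix_uv (FW := fun c => (Sum.elim fa₁ fa₂ c, Sum.elim fb₁ fb₂ c, Sum.elim fy₁ fy₂ c)),
      pushf_mix_uv (FW := Sum.elim fa₁ fa₂)]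
    rcases u with u | u <;> rcases v with v | v <;> simp only [Sum.elim_inl, Sum.elim_inr, zero_mul]
    · rw [S₁.fBY, mul_assoc]
    · rw [S₂.fBY, mul_assoc]
  · intro u v a b y
    rw [pushf_mix_uv (FW := fun c => (Sum.elim fa₁ fa₂ c, Sum.elim fe₁ fe₂ c, Sum.elim fz₁ fz₂ c)),
      pushf_mix_uv (FW := Sum.elim fa₁ fa₂)]
    rcases u with u | u <;> rcases v with v | v <;> simp only [Sum.elim_inl, Sum.elim_inr, zero_mul]
    · rw [S₁.fEZ, mul_assoc]
    · rw [S₂.fEZ, mul_assoc]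

lemma Achievable.mono {d : A → A → ℝ} {D Δ : ℝ}
    (h : ∀ ε : ℝ, 0 < ε → ∃ D' Δ', Achievable pS Wch d 1 D' Δ' ∧ D' ≤ D + ε ∧ Δ - ε ≤ Δ') :
    Achievable pS Wch d 1 D Δ := by
  intro ε hε
  obtain ⟨D', Δ', h1, h2, h3⟩ := h (ε / 2) (by linarith)
  obtain ⟨n, m, hn, F, g, hF, e1, e2, e3⟩ := h1 (ε / 2) (by linarith)
  exact ⟨n, m, hn, F, g, hF, by linarith, by linarith, by linarith⟩

theorem mix_achievable (hpS : IsPMF pS) (hW : IsKernel Wch) {d : A → A → ℝ} {dmax D Δ Δ₂ : ℝ}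
    (hdmax : 0 ≤ dmax) (hd : ∀ a a', 0 ≤ d a a' ∧ d a a' ≤ dmax) (hD : 0 ≤ D)
    (S₁ : Sys pS Wch q₁ fu₁ fv₁ fa₁ fb₁ fe₁ fy₁ fz₁ xfun₁)
    (S₂ : Sys pS Wch q₂ fu₂ fv₂ fa₂ fb₂ fe₂ fy₂ fz₂ xfun₂)
    (Ahat₁ : V₁ → B → Y → A) (Ahat₂ : V₂ → B → Y → A)
    (c1 : I2 q₁ fu₁ fa₁ ≤ I2 q₁ fu₁ (fun c => (fb₁ c, fy₁ c)))
    (c2 : Iv q₁ fu₁ fv₁ fa₁ ≤ Iv q₁ fu₁ fv₁ (fun c => (fb₁ c, fy₁ c)))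
    (c3 : ∑ c, q₁ c * d (fa₁ c) (Ahat₁ (fv₁ c) (fb₁ c) (fy₁ c)) ≤ D)
    (c4 : Δ * Real.log 2 ≤ Hn q₁ (fun c => (fu₁ c, fa₁ c, fe₁ c, fz₁ c)) -
      Hn q₁ (fun c => (fu₁ c, fe₁ c, fz₁ c)) -
      max 0 (Iv q₁ fu₁ fv₁ (fun c => (fa₁ c, fe₁ c, fz₁ c)) -
        Iv q₁ fu₁ fv₁ (fun c => (fb₁ c, fy₁ c))))
    (b1 : I2 q₂ fu₂ fa₂ ≤ I2 q₂ fu₂ (fun c => (fb₂ c, fy₂ c)))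
    (b2 : Iv q₂ fu₂ fv₂ fa₂ < Iv q₂ fu₂ fv₂ (fun c => (fb₂ c, fy₂ c)))
    (b4 : Δ₂ * Real.log 2 ≤ Hn q₂ (fun c => (fu₂ c, fa₂ c, fe₂ c, fz₂ c)) -
      Hn q₂ (fun c => (fu₂ c, fe₂ c, fz₂ c)) -
      max 0 (Iv q₂ fu₂ fv₂ (fun c => (fa₂ c, fe₂ c, fz₂ c)) -
        Iv q₂ fu₂ fv₂ (fun c => (fb₂ c, fy₂ c)))) :
    Achievable pS Wch d 1 D Δ := by
  have key : ∀ t : ℝ, 0 < t → t < 1 →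
      Achievable pS Wch d 1 ((1 - t) * D + t * dmax) ((1 - t) * Δ + t * Δ₂) := by
    intro t h0 h1
    have h1' : 0 < 1 - t := by linarith
    refine achievable_strict hpS hW hdmax hd
      (add_nonneg (mul_nonneg h1'.le hD) (mul_nonneg h0.le hdmax))
      (mix_sys h0 h1 S₁ S₂) (Sum.elim Ahat₁ Ahat₂) ?_ ?_ ?_ ?_
    · unfold I2 at *
      rw [Hn_mix_u h0 h1 S₁.pmf S₂.pmf, Hn_mix_u h0 h1 S₁.pmf S₂.pmf fu₁ fu₂
        (fun c => (Sum.elim fb₁ fb₂ c, Sum.elim fy₁ fy₂ c))]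
      have k := Hn_mix_concave h0.le h1.le S₁.pmf S₂.pmf
        (fun c => (Sum.elim fb₁ fb₂ c, Sum.elim fy₁ fy₂ c))
      have l1 : Hn q₁ fa₁ = ∑ a, Real.negMulLog (srcA pS a) := by unfold Hn; rw [S₁.src]
      have l2 : Hn q₂ fa₂ = ∑ a, Real.negMulLog (srcA pS a) := by unfold Hn; rw [S₂.src]
      have l3 : Hn (mixq t q₁ q₂) (Sum.elim fa₁ fa₂) = ∑ a, Real.negMulLog (srcA pS a) := by
        unfold Hn; rw [(mix_sys h0 h1 S₁ S₂).src]
      rw [l3]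
      rw [l1] at c1
      rw [l2] at b1
      simp only [Sum.elim_inl, Sum.elim_inr] at k ⊢
      nlinarith [mul_le_mul_of_nonneg_left c1 h1'.le, mul_le_mul_of_nonneg_left b1 h0.le]
    · rw [Iv_mix h0 h1 S₁.pmf S₂.pmf, Iv_mix h0 h1 S₁.pmf S₂.pmf fu₁ fv₁ fu₂ fv₂
        (fun c => (Sum.elim fb₁ fb₂ c, Sum.elim fy₁ fy₂ c))]
      simp only [Sum.elim_inl, Sum.elim_inr]
      exact add_lt_add_of_le_of_lt (mul_le_mul_of_nonneg_left c2 h1'.le)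
        (mul_lt_mul_of_pos_left b2 h0)
    · simp only [mixq, Fintype.sum_sum_type, Sum.elim_inl, Sum.elim_inr, Sum.map_inl, Sum.map_inr,
        mul_assoc, ← Finset.mul_sum]
      refine add_le_add (mul_le_mul_of_nonneg_left c3 h1'.le) (mul_le_mul_of_nonneg_left ?_ h0.le)
      calc _ ≤ ∑ c, q₂ c * dmax := Finset.sum_le_sum fun c _ =>
              mul_le_mul_of_nonneg_left (hd _ _).2 (S₂.pmf.1 c)
        _ = dmax := by rw [← Finset.sum_mul, S₂.pmf.2, one_mul]
    · rw [Hn_mix_u h0 h1 S₁.pmf S₂.pmf fu₁ fu₂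
          (fun c => (Sum.elim fa₁ fa₂ c, Sum.elim fe₁ fe₂ c, Sum.elim fz₁ fz₂ c)),
        Hn_mix_u h0 h1 S₁.pmf S₂.pmf fu₁ fu₂
          (fun c => (Sum.elim fe₁ fe₂ c, Sum.elim fz₁ fz₂ c)),
        Iv_mix h0 h1 S₁.pmf S₂.pmf fu₁ fv₁ fu₂ fv₂
          (fun c => (Sum.elim fa₁ fa₂ c, Sum.elim fe₁ fe₂ c, Sum.elim fz₁ fz₂ c)),
        Iv_mix h0 h1 S₁.pmf S₂.pmf fu₁ fv₁ fu₂ fv₂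
          (fun c => (Sum.elim fb₁ fb₂ c, Sum.elim fy₁ fy₂ c))]
      simp only [Sum.elim_inl, Sum.elim_inr]
      have k1 := mul_le_mul_of_nonneg_left c4 h1'.le
      have k2 := mul_le_mul_of_nonneg_left b4 h0.le
      set i1 := Iv q₁ fu₁ fv₁ (fun c => (fa₁ c, fe₁ c, fz₁ c))
      set i2 := Iv q₁ fu₁ fv₁ (fun c => (fb₁ c, fy₁ c))
      set i3 := Iv q₂ fu₂ fv₂ (fun c => (fa₂ c, fe₂ c, fz₂ c))
      set i4 := Iv q₂ fu₂ fv₂ (fun c => (fb₂ c, fy₂ c))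
      have m : max 0 ((1 - t) * i1 + t * i3 - ((1 - t) * i2 + t * i4)) ≤
          (1 - t) * max 0 (i1 - i2) + t * max 0 (i3 - i4) := by
        refine max_le (add_nonneg (mul_nonneg h1'.le (le_max_left _ _))
          (mul_nonneg h0.le (le_max_left _ _))) ?_
        have e1 := mul_le_mul_of_nonneg_left (le_max_right 0 (i1 - i2)) h1'.le
        have e2 := mul_le_mul_of_nonneg_left (le_max_right 0 (i3 - i4)) h0.le
        linarith
      linarith
  refine Achievable.mono fun ε hε => ?_
  obtain ⟨t, ht0, ht1, ht2⟩ : ∃ t : ℝ, 0 < t ∧ t < 1 ∧ t * (dmax + |Δ₂ - Δ|) ≤ ε := by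
    refine ⟨min (1 / 2) (ε / (dmax + |Δ₂ - Δ| + 1)), lt_min (by norm_num) (by positivity),
      lt_of_le_of_lt (min_le_left _ _) (by norm_num), ?_⟩
    calc _ ≤ ε / (dmax + |Δ₂ - Δ| + 1) * (dmax + |Δ₂ - Δ|) :=
          mul_le_mul_of_nonneg_right (min_le_right _ _) (by positivity)
      _ ≤ ε / (dmax + |Δ₂ - Δ| + 1) * (dmax + |Δ₂ - Δ| + 1) :=
          mul_le_mul_of_nonneg_left (by linarith) (by positivity)
      _ = ε := div_mul_cancel₀ _ (by positivity)
  have n1 := mul_nonneg ht0.le hdmax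
  have n2 := mul_nonneg ht0.le (abs_nonneg (Δ₂ - Δ))
  have n3 := mul_nonneg ht0.le hD
  have n4 := mul_le_mul_of_nonneg_left (neg_abs_le (Δ₂ - Δ)) ht0.le
  exact ⟨_, _, key t ht0 ht1, by linarith, by linarith⟩

end Mix2

/-! ### Entropy identities for a system -/

section Fac

variable {γ S α β W R U V W' : Type} [Fintype γ] [Fintype S] [Fintype α] [Fintype β] [Fintype W]
  [Fintype U] [Fintype V] [Fintype W']

lemma Iv_congr_inj (q : γ → ℝ) (fu : γ → U) (fv : γ → V) (fw : γ → W) (fw' : γ → W') (j : W → W')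
    (hj : Function.Injective j) (h : ∀ c, fw' c = j (fw c)) : Iv q fu fv fw' = Iv q fu fv fw := by
  unfold Iv
  rw [Hn_congr_inj q (fun c => (fu c, fw c)) (fun c => (fu c, fw' c)) (fun x => (x.1, j x.2))
      (by rintro ⟨a, b⟩ ⟨c, d⟩ e; simp only [Prod.mk.injEq] at e ⊢; exact ⟨e.1, hj e.2⟩)
      (fun c => by simp only [h]),
    Hn_congr_inj q (fun c => (fu c, fv c, fw c)) (fun c => (fu c, fv c, fw' c))
      (fun x => (x.1, x.2.1, j x.2.2))
      (by
        rintro ⟨a, b, s⟩ ⟨c, d, t⟩ e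
        simp only [Prod.mk.injEq] at e ⊢
        exact ⟨e.1, e.2.1, hj e.2.2⟩)
      (fun c => by simp only [h])]

lemma fac1 {q : γ → ℝ} {fs : γ → S} {fe : γ → α} {fz : γ → β} {κ₁ : S → α → ℝ} {κ₂ : S → β → ℝ}
    (hκ₂ : IsKernel κ₂)
    (h : ∀ s e z, pushf q (fun c => (fs c, fe c, fz c)) (s, e, z) =
      pushf q fs s * (κ₁ s e * κ₂ s z)) (s : S) (e : α) :
    pushf q (fun c => (fs c, fe c)) (s, e) = pushf q fs s * κ₁ s e := by
  rw [← sum_pushf_pair q (fun c => (fs c, fe c)) fz (s, e)]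
  have : ∀ z, pushf q (fun c => ((fs c, fe c), fz c)) ((s, e), z) =
      pushf q fs s * (κ₁ s e * κ₂ s z) := by
    intro z
    rw [← h]
    exact (pushf_inj q (fun c => ((fs c, fe c), fz c)) (fun x => (x.1.1, x.1.2, x.2))
      (Function.LeftInverse.injective (g := fun x => ((x.1, x.2.1), x.2.2)) (fun _ => rfl))
      ((s, e), z)).symm
  simp only [this, ← Finset.mul_sum, (hκ₂ s).2, mul_one]

lemma fac2 {q : γ → ℝ} {fs : γ → S} {fe : γ → α} {fz : γ → β} {κ₁ : S → α → ℝ} {κ₂ : S → β → ℝ}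
    (hκ₂ : IsKernel κ₂)
    (h : ∀ s e z, pushf q (fun c => (fs c, fe c, fz c)) (s, e, z) =
      pushf q fs s * (κ₁ s e * κ₂ s z)) (t : S × α) (z : β) :
    pushf q (fun c => ((fs c, fe c), fz c)) (t, z) =
      pushf q (fun c => (fs c, fe c)) t * κ₂ t.1 z := by
  rw [show t = (t.1, t.2) from rfl, fac1 hκ₂ h, mul_assoc, ← h]
  exact (pushf_inj q (fun c => ((fs c, fe c), fz c)) (fun x => (x.1.1, x.1.2, x.2))
      (Function.LeftInverse.injective (g := fun x => ((x.1, x.2.1), x.2.2)) (fun _ => rfl))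
      (t, z)).symm

lemma Hn_coarse {q : γ → ℝ} (hq : ∀ c, 0 ≤ q c) (f : γ → α) (g : γ → β) (j : α → W) (i : W → R)
    (κ : R → β → ℝ)
    (h : ∀ a b, pushf q (fun c => (f c, g c)) (a, b) = pushf q f a * κ (i (j a)) b) :
    Hn q (fun c => (j (f c), g c)) =
      Hn q (fun c => j (f c)) - ∑ c, q c * Real.log (κ (i (j (f c))) (g c)) :=
  Hn_chain hq (fun c => j (f c)) g (fun w b => κ (i w) b)
    (pushf_coarse q f g j (fun w b => κ (i w) b) h)

end Fac

section SysFacts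

variable {γ U V : Type} [Fintype γ] [Fintype U] [Fintype V]
  {pS : A × B × E → ℝ} {Wch : X → Y × Z → ℝ}
  {q : γ → ℝ} {fu : γ → U} {fv : γ → V} {fa : γ → A} {fb : γ → B} {fe : γ → E} {fy : γ → Y}
  {fz : γ → Z} {xfun : V → A → X}

lemma Sys.h3E (S : Sys pS Wch q fu fv fa fb fe fy fz xfun) (s : U × V × A) (e : E) (z : Z) :
    pushf q (fun c => ((fu c, fv c, fa c), fe c, fz c)) (s, e, z) =
      pushf q (fun c => (fu c, fv c, fa c)) s *
        (srcE pS s.2.2 e * chZ Wch (xfun s.2.1 s.2.2) z) := by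
  rw [← S.fEZ]
  exact (pushf_inj q (fun c => ((fu c, fv c, fa c), fe c, fz c))
    (fun x => (x.1.1, x.1.2.1, x.1.2.2, x.2.1, x.2.2))
    (Function.LeftInverse.injective
      (g := fun x => ((x.1, x.2.1, x.2.2.1), x.2.2.2.1, x.2.2.2.2)) (fun _ => rfl))
      (s, e, z)).symm

lemma Sys.h3B (S : Sys pS Wch q fu fv fa fb fe fy fz xfun) (s : U × V × A) (e : B) (z : Y) :
    pushf q (fun c => ((fu c, fv c, fa c), fb c, fy c)) (s, e, z) =
      pushf q (fun c => (fu c, fv c, fa c)) s *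
        (srcB pS s.2.2 e * chY Wch (xfun s.2.1 s.2.2) z) := by
  rw [← S.fBY]
  exact (pushf_inj q (fun c => ((fu c, fv c, fa c), fb c, fy c))
    (fun x => (x.1.1, x.1.2.1, x.1.2.2, x.2.1, x.2.2))
    (Function.LeftInverse.injective
      (g := fun x => ((x.1, x.2.1, x.2.2.1), x.2.2.2.1, x.2.2.2.2)) (fun _ => rfl))
      (s, e, z)).symm

lemma Sys.facE (hW : IsKernel Wch) (S : Sys pS Wch q fu fv fa fb fe fy fz xfun)
    (s : U × V × A) (e : E) : pushf q (fun c => ((fu c, fv c, fa c), fe c)) (s, e) =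
      pushf q (fun c => (fu c, fv c, fa c)) s * srcE pS s.2.2 e :=
  fac1 (κ₁ := fun s e => srcE pS s.2.2 e) (κ₂ := fun s z => chZ Wch (xfun s.2.1 s.2.2) z)
    (fun _ => chZ_isKernel hW _) S.h3E s e

lemma Sys.facZ (hW : IsKernel Wch) (S : Sys pS Wch q fu fv fa fb fe fy fz xfun)
    (s : (U × V × A) × E) (z : Z) : pushf q (fun c => (((fu c, fv c, fa c), fe c), fz c)) (s, z) =
      pushf q (fun c => ((fu c, fv c, fa c), fe c)) s * chZ Wch (xfun s.1.2.1 s.1.2.2) z :=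
  fac2 (κ₁ := fun s e => srcE pS s.2.2 e) (κ₂ := fun s z => chZ Wch (xfun s.2.1 s.2.2) z)
    (fun _ => chZ_isKernel hW _) S.h3E s z

lemma Sys.facB (hW : IsKernel Wch) (S : Sys pS Wch q fu fv fa fb fe fy fz xfun)
    (s : U × V × A) (e : B) : pushf q (fun c => ((fu c, fv c, fa c), fb c)) (s, e) =
      pushf q (fun c => (fu c, fv c, fa c)) s * srcB pS s.2.2 e :=
  fac1 (κ₁ := fun s e => srcB pS s.2.2 e) (κ₂ := fun s z => chY Wch (xfun s.2.1 s.2.2) z)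
    (fun _ => chY_isKernel hW _) S.h3B s e

lemma Sys.facY (hW : IsKernel Wch) (S : Sys pS Wch q fu fv fa fb fe fy fz xfun)
    (s : (U × V × A) × B) (z : Y) : pushf q (fun c => (((fu c, fv c, fa c), fb c), fy c)) (s, z) =
      pushf q (fun c => ((fu c, fv c, fa c), fb c)) s * chY Wch (xfun s.1.2.1 s.1.2.2) z :=
  fac2 (κ₁ := fun s e => srcB pS s.2.2 e) (κ₂ := fun s z => chY Wch (xfun s.2.1 s.2.2) z)
    (fun _ => chY_isKernel hW _) S.h3B s z

/-- the equivocation identity -/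
lemma Sys.equiv_id (hW : IsKernel Wch) (S : Sys pS Wch q fu fv fa fb fe fy fz xfun) :
    Hn q (fun c => (fa c, fu c, fe c)) - Hn q (fun c => (fu c, fe c)) - Iv q fu fv fa -
      Iv q (fun c => (fu c, fe c)) (fun c => xfun (fv c) (fa c)) fz =
    Hn q (fun c => (fu c, fa c, fe c, fz c)) - Hn q (fun c => (fu c, fe c, fz c)) -
      Iv q fu fv (fun c => (fa c, fe c, fz c)) := by
  classical
  have E1 := Hn_coarse S.pmf.1 (fun c => (fu c, fv c, fa c)) fe (fun s => s) (fun s => s.2.2)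
    (srcE pS) (S.facE hW)
  have E2 := Hn_coarse S.pmf.1 (fun c => (fu c, fv c, fa c)) fe (fun s => (s.1, s.2.2))
    (fun s => s.2) (srcE pS) (S.facE hW)
  have Z1 := Hn_coarse S.pmf.1 (fun c => ((fu c, fv c, fa c), fe c)) fz (fun s => s)
    (fun s => xfun s.1.2.1 s.1.2.2) (chZ Wch) (S.facZ hW)
  have Z2 := Hn_coarse S.pmf.1 (fun c => ((fu c, fv c, fa c), fe c)) fz
    (fun s => ((s.1.1, s.2), xfun s.1.2.1 s.1.2.2))
    (fun s => s.2) (chZ Wch) (S.facZ hW)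
  simp only at E1 E2 Z1 Z2
  have r1 := Hn_congr_inj q (fun c => ((fu c, fa c), fe c)) (fun c => (fa c, fu c, fe c))
    (fun x => (x.1.2, x.1.1, x.2))
    (Function.LeftInverse.injective (g := fun x => ((x.2.1, x.1), x.2.2)) (fun _ => rfl))
    (fun _ => rfl)
  have r2 := Hn_congr_inj q (fun c => (((fu c, fv c, fa c), fe c), fz c))
    (fun c => (fu c, fv c, fa c, fe c, fz c))
    (fun x => (x.1.1.1, x.1.1.2.1, x.1.1.2.2, x.1.2, x.2))
    (Function.LeftInverse.injective
      (g := fun x => (((x.1, x.2.1, x.2.2.1), x.2.2.2.1), x.2.2.2.2)) (fun _ => rfl))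
    (fun _ => rfl)
  have r3 := Hn_congr_inj q (fun c => (((fu c, fe c), xfun (fv c) (fa c)), fz c))
    (fun c => ((fu c, fe c), xfun (fv c) (fa c), fz c))
    (fun x => (x.1.1, x.1.2, x.2))
    (Function.LeftInverse.injective (g := fun x => ((x.1, x.2.1), x.2.2)) (fun _ => rfl))
    (fun _ => rfl)
  have r4 := Hn_congr_inj q (fun c => (fu c, fe c, fz c))
    (fun c => ((fu c, fe c), fz c)) (fun x => ((x.1, x.2.1), x.2.2))
    (Function.LeftInverse.injective (g := fun x => (x.1.1, x.1.2, x.2)) (fun _ => rfl))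
    (fun _ => rfl)
  unfold Iv
  linarith

end SysFacts

section Mode2

variable {pS : A × B × E → ℝ} {Wch : X → Y × Z → ℝ}

open Classical in
/-- the auxiliary uniform channel input -/
noncomputable def unifVX (A X : Type) [Fintype X] : A → X × X → ℝ :=
  fun _ w => if w.1 = w.2 then (Fintype.card X : ℝ)⁻¹ else 0

/-- joint law of the auxiliary system -/
noncomputable def q2 (pS : A × B × E → ℝ) (Wch : X → Y × Z → ℝ) :
    Unit × X × A × B × E × X × Y × Z → ℝ :=
  hybridJoint pS Wch (fun _ _ => 1) (unifVX A X)

lemma q2_sys (hpS : IsPMF pS) (hW : IsKernel Wch) [Nonempty X] :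
    Sys pS Wch (q2 pS Wch) (fun w => w.1) (fun w => w.2.1) (fun w => w.2.2.1)
      (fun w => w.2.2.2.1) (fun w => w.2.2.2.2.1) (fun w => w.2.2.2.2.2.2.1)
      (fun w => w.2.2.2.2.2.2.2) (fun v _ => v) ∧
    ∀ u v a, pushf (q2 pS Wch) (fun c => (c.1, c.2.1, c.2.2.1)) (u, v, a) =
      (Fintype.card X : ℝ)⁻¹ * srcA pS a := by
  classical
  have hx : ∀ (a : A) v x, unifVX A X a (v, x) ≠ 0 → x = v := by
    intro a v x h
    by_contra hne
    exact h (if_neg (fun e => hne e.symm))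
  have hs : ∀ (a : A) (v : X), ∑ x, unifVX A X a (v, x) = (Fintype.card X : ℝ)⁻¹ := by
    intro a v
    simp [unifVX]
  have hVX : IsKernel (unifVX A X) := by
    intro a
    refine ⟨fun w => ?_, ?_⟩
    · unfold unifVX
      split_ifs
      · positivity
      · exact le_rfl
    · rw [Fintype.sum_prod_type]
      simp only [hs]
      simp
  have := hybrid_sys hpS hW (pU := fun (_ : X) (_ : Unit) => (1 : ℝ)) (pVX := unifVX A X)
    (xfun := fun v _ => v) (fun _ => ⟨fun _ => zero_le_one, by simp⟩) hVX hx
  refine ⟨this.1, fun u v a => ?_⟩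
  have h2 := this.2 u v a
  rw [hs, one_mul] at h2
  exact h2

lemma q2_b1 (hpS : IsPMF pS) (hW : IsKernel Wch) [Nonempty X] :
    I2 (q2 pS Wch) (fun w => w.1) (fun w => w.2.2.1) ≤
      I2 (q2 pS Wch) (fun w => w.1) (fun w => (w.2.2.2.1, w.2.2.2.2.2.2.1)) := by
  have hq := (q2_sys hpS hW).1.pmf
  refine le_trans (le_of_eq ?_) (I2_nonneg hq _ _)
  unfold I2
  have h1 : Hn (q2 pS Wch) (fun w => w.1) = 0 := Hn_const hq ()
  rw [h1, Hn_congr_inj (q2 pS Wch) (fun w => w.2.2.1) (fun c => (c.1, c.2.2.1)) (fun a => ((), a))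
    (Function.LeftInverse.injective (g := fun x => x.2) (fun _ => rfl)) (fun _ => rfl)]
  ring

lemma q2_b2 (hpS : IsPMF pS) (hW : IsKernel Wch) {x₁ x₂ : X} (hx : chY Wch x₁ ≠ chY Wch x₂) :
    Iv (q2 pS Wch) (fun w => w.1) (fun w => w.2.1) (fun w => w.2.2.1) <
      Iv (q2 pS Wch) (fun w => w.1) (fun w => w.2.1)
        (fun w => (w.2.2.2.1, w.2.2.2.2.2.2.1)) := by
  classical
  have : Nonempty X := ⟨x₁⟩
  obtain ⟨S, h3⟩ := q2_sys hpS hW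
  have hsA : ∑ a, srcA pS a = 1 := (pushf_isPMF hpS _).2
  have h2 : ∀ s, pushf (q2 pS Wch) (fun c => (c.1, c.2.1)) s = (Fintype.card X : ℝ)⁻¹ := by
    intro s
    rw [← sum_pushf_pair (q2 pS Wch) (fun c => (c.1, c.2.1)) (fun c => c.2.2.1) s]
    have : ∀ a, pushf (q2 pS Wch) (fun c => ((c.1, c.2.1), c.2.2.1)) (s, a) =
        (Fintype.card X : ℝ)⁻¹ * srcA pS a := by
      intro a
      rw [← h3 s.1 s.2 a]
      exact (pushf_inj (q2 pS Wch) (fun c => ((c.1, c.2.1), c.2.2.1))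
        (fun x => (x.1.1, x.1.2, x.2))
        (Function.LeftInverse.injective (g := fun x => ((x.1, x.2.1), x.2.2)) (fun _ => rfl))
        (s, a)).symm
    simp only [this, ← Finset.mul_sum, hsA, mul_one]
  have fA : ∀ s a, pushf (q2 pS Wch) (fun c => ((c.1, c.2.1), c.2.2.1)) (s, a) =
      pushf (q2 pS Wch) (fun c => (c.1, c.2.1)) s * srcA pS a := by
    intro s a
    rw [h2, ← h3 s.1 s.2 a]
    exact (pushf_inj (q2 pS Wch) (fun c => ((c.1, c.2.1), c.2.2.1))
        (fun x => (x.1.1, x.1.2, x.2))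
        (Function.LeftInverse.injective (g := fun x => ((x.1, x.2.1), x.2.2)) (fun _ => rfl))
        (s, a)).symm
  have A1 := Hn_coarse S.pmf.1 (fun c => (c.1, c.2.1)) (fun c => c.2.2.1) (fun s => s)
    (fun _ => ()) (fun _ => srcA pS) fA
  have A2 := Hn_coarse S.pmf.1 (fun c => (c.1, c.2.1)) (fun c => c.2.2.1) (fun s => s.1)
    (fun _ => ()) (fun _ => srcA pS) fA
  have r1 := Hn_congr_inj (q2 pS Wch) (fun c => ((c.1, c.2.1), c.2.2.1))
    (fun c => (c.1, c.2.1, c.2.2.1)) (fun x => (x.1.1, x.1.2, x.2))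
    (Function.LeftInverse.injective (g := fun x => ((x.1, x.2.1), x.2.2)) (fun _ => rfl))
    (fun _ => rfl)
  simp only at A1 A2
  have z : Iv (q2 pS Wch) (fun w => w.1) (fun w => w.2.1) (fun w => w.2.2.1) = 0 := by
    unfold Iv
    linarith
  rw [z]
  by_contra hcon
  push Not at hcon
  have l1 := Iv_mono S.pmf.1 (fun w => w.1) (fun w => w.2.1) (fun w => w.2.2.2.2.2.2.1)
    (fun w => w.2.2.2.1)
  rw [Iv_congr_inj (q2 pS Wch) (fun w => w.1) (fun w => w.2.1)
    (fun w => (w.2.2.2.1, w.2.2.2.2.2.2.1)) (fun w => (w.2.2.2.2.2.2.1, w.2.2.2.1)) Prod.swap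
    Prod.swap_injective (fun _ => rfl)] at l1
  have l2 := Iv_zero S.pmf.1 _ _ _ (l1.trans hcon)
  have fY := pushf_coarse (q2 pS Wch) _ _ (fun s : (Unit × X × A) × B => (s.1.1, s.1.2.1)) (fun s y => chY Wch s.2 y)
    (S.facY hW)
  have hc : (Fintype.card X : ℝ)⁻¹ ≠ 0 := by simp
  have k : ∀ v y, chY Wch v y =
      pushf (q2 pS Wch) (fun c => (c.1, c.2.2.2.2.2.2.1)) ((), y) /
        pushf (q2 pS Wch) (fun c => c.1) () := by
    intro v y
    have e1 := l2 ((), v, y)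
    have e2 := fY ((), v) y
    have e3 := pushf_inj (q2 pS Wch) (fun c => ((c.1, c.2.1), c.2.2.2.2.2.2.1))
        (fun x => (x.1.1, x.1.2, x.2))
        (Function.LeftInverse.injective (g := fun x => ((x.1, x.2.1), x.2.2)) (fun _ => rfl))
        (((), v), y)
    simp only at e1 e2 e3
    rw [e1, e2, h2, mul_div_assoc] at e3
    exact (mul_left_cancel₀ hc e3).symm
  exact hx (funext fun y => by rw [k, k])

end Mode2

/-! ### The zero-capacity case and the final assembly -/

section ZeroCap

lemma code0_eq (pS : A × B × E → ℝ) (Wch : X → Y × Z → ℝ) :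
    codeJoint (n := 1) (m := 0) pS Wch (fun _ _ => 1) =
      pushf pS (fun w => ((fun _ => w.1), (fun _ => w.2.1), (fun _ => w.2.2), Fin.elim0, Fin.elim0,
        Fin.elim0)) := by
  funext w
  obtain ⟨a, b, e, x, y, z⟩ := w
  have hx : x = Fin.elim0 := Subsingleton.elim _ _
  have hy : y = Fin.elim0 := Subsingleton.elim _ _
  have hz : z = Fin.elim0 := Subsingleton.elim _ _
  have ha : a = fun _ => a 0 := by funext i; rw [Subsingleton.elim i 0]
  have hb : b = fun _ => b 0 := by funext i; rw [Subsingleton.elim i 0]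
  have he : e = fun _ => e 0 := by funext i; rw [Subsingleton.elim i 0]
  have h1 := pushf_inj pS (fun w => w) (fun w => ((fun _ : Fin 1 => w.1), (fun _ : Fin 1 => w.2.1),
    (fun _ : Fin 1 => w.2.2), (Fin.elim0 : Fin 0 → X), (Fin.elim0 : Fin 0 → Y),
    (Fin.elim0 : Fin 0 → Z)))
    (Function.LeftInverse.injective (g := fun t => (t.1 0, t.2.1 0, t.2.2.1 0)) (fun _ => rfl))
    (a 0, b 0, e 0)
  have h2 : pushf pS (fun w => w) (a 0, b 0, e 0) = pS (a 0, b 0, e 0) := by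
    classical
    unfold pushf
    refine (Finset.sum_eq_single (a 0, b 0, e 0) (fun c _ hc => if_neg hc)
      (fun hc => absurd (Finset.mem_univ _) hc)).trans (if_pos rfl)
  simp only at h1
  rw [h2, ← ha, ← hb, ← he, ← hx, ← hy, ← hz] at h1
  rw [← hx, ← hy, ← hz, h1]
  simp [codeJoint]

lemma Hn_pushf {γ α β : Type} [Fintype γ] [Fintype α] [Fintype β] (q : γ → ℝ) (φ : γ → α)
    (f : α → β) : Hn (pushf q φ) f = Hn q (fun c => f (φ c)) := by
  unfold Hn
  rw [pushf_pushf]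

lemma zero_code {pS : A × B × E → ℝ} {Wch : X → Y × Z → ℝ} {d : A → A → ℝ} {D Δ : ℝ}
    (best : B → A) (h1 : ∑ w, pS w * d w.1 (best w.2.1) ≤ D)
    (h2 : Δ * Real.log 2 ≤ Hn pS (fun w => (w.1, w.2.2)) - Hn pS (fun w => w.2.2)) :
    Achievable pS Wch d 1 D Δ := by
  intro ε hε
  have hl2 : 0 < Real.log 2 := Real.log_pos (by norm_num)
  refine ⟨1, 0, one_pos, fun _ _ => 1, fun b _ _ => best (b 0), ?_, ?_, ?_, ?_⟩
  · intro a
    exact ⟨fun _ => zero_le_one, by simp⟩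
  · simp only [Nat.cast_zero, Nat.cast_one, zero_div]
    linarith
  · rw [code0_eq]
    unfold expVal
    rw [sum_pushf_mul]
    simp only [seqDist, Nat.cast_one, inv_one, one_mul, Finset.univ_unique, Finset.sum_singleton]
    linarith
  · rw [code0_eq]
    unfold condH
    rw [Hof_eq, Hof_eq, Hn_pushf, Hn_pushf]
    rw [Hn_congr_inj pS (fun w => (w.1, w.2.2)) _
        (fun t => ((fun _ => t.1), (fun _ => t.2), Fin.elim0))
        (Function.LeftInverse.injective (g := fun t => (t.1 0, t.2.1 0)) (fun _ => rfl))
        (fun _ => rfl),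
      Hn_congr_inj pS (fun w => w.2.2) _
        (fun t => ((fun _ => t), Fin.elim0))
        (Function.LeftInverse.injective (g := fun t => t.1 0) (fun _ => rfl))
        (fun _ => rfl), ← sub_div]
    simp only [Nat.cast_one, inv_one, one_mul]
    have : Δ ≤ (Hn pS (fun w => (w.1, w.2.2)) - Hn pS (fun w => w.2.2)) / Real.log 2 := by
      rw [le_div_iff₀ hl2]
      exact h2
    linarith

variable {γ U V : Type} [Fintype γ] [Fintype U] [Fintype V]
  {pS : A × B × E → ℝ} {Wch : X → Y × Z → ℝ}
  {q : γ → ℝ} {fu : γ → U} {fv : γ → V} {fa : γ → A} {fb : γ → B} {fe : γ → E} {fy : γ → Y}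
  {fz : γ → Z} {xfun : V → A → X}

lemma zero_cap (hpS : IsPMF pS) (hW : IsKernel Wch) {d : A → A → ℝ} {D Δ : ℝ}
    (S : Sys pS Wch q fu fv fa fb fe fy fz xfun) (Ahat : V → B → Y → A) (wy : Y → ℝ)
    (hwy : ∀ x, chY Wch x = wy) (hwy0 : ∀ y, 0 ≤ wy y)
    (c1 : I2 q fu fa ≤ I2 q fu (fun c => (fb c, fy c)))
    (c2 : Iv q fu fv fa ≤ Iv q fu fv (fun c => (fb c, fy c)))
    (c3 : ∑ c, q c * d (fa c) (Ahat (fv c) (fb c) (fy c)) ≤ D)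
    (c4 : Δ * Real.log 2 ≤ Hn q (fun c => (fu c, fa c, fe c, fz c)) -
      Hn q (fun c => (fu c, fe c, fz c)) -
      max 0 (Iv q fu fv (fun c => (fa c, fe c, fz c)) -
        Iv q fu fv (fun c => (fb c, fy c)))) :
    Achievable pS Wch d 1 D Δ := by
  classical
  have hq := S.pmf
  have hA : Nonempty A := by
    by_contra hcon
    rw [not_nonempty_iff] at hcon
    have := hpS.2
    simp at this
  have fY : ∀ s z, pushf q (fun c => (((fu c, fv c, fa c), fb c), fy c)) (s, z) =
      pushf q (fun c => ((fu c, fv c, fa c), fb c)) s * wy z := by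
    intro s z
    rw [S.facY hW, hwy]
  -- entropies
  have Y1 := Hn_coarse hq.1 (fun c => ((fu c, fv c, fa c), fb c)) fy (fun s => s.2)
    (fun _ => ()) (fun _ => wy) fY
  have Y2 := Hn_coarse hq.1 (fun c => ((fu c, fv c, fa c), fb c)) fy (fun s => (s.1.1, s.2))
    (fun _ => ()) (fun _ => wy) fY
  have Y3 := Hn_coarse hq.1 (fun c => ((fu c, fv c, fa c), fb c)) fy
    (fun s => (s.1.1, s.1.2.1, s.2)) (fun _ => ()) (fun _ => wy) fY
  have B1 := Hn_coarse hq.1 (fun c => (fu c, fv c, fa c)) fb (fun s => s) (fun s => s.2.2)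
    (srcB pS) (S.facB hW)
  have B2 := Hn_coarse hq.1 (fun c => (fu c, fv c, fa c)) fb (fun s => s.2.2) (fun s => s)
    (srcB pS) (S.facB hW)
  simp only at Y1 Y2 Y3 B1 B2
  have r1 := Hn_congr_inj q (fun c => ((fu c, fb c), fy c)) (fun c => (fu c, fb c, fy c))
    (fun x => (x.1.1, x.1.2, x.2))
    (Function.LeftInverse.injective (g := fun x => ((x.1, x.2.1), x.2.2)) (fun _ => rfl))
    (fun _ => rfl)
  have r2 := Hn_congr_inj q (fun c => ((fu c, fv c, fb c), fy c))
    (fun c => (fu c, fv c, fb c, fy c))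
    (fun x => (x.1.1, x.1.2.1, x.1.2.2, x.2))
    (Function.LeftInverse.injective (g := fun x => ((x.1, x.2.1, x.2.2.1), x.2.2.2))
    (fun _ => rfl)) (fun _ => rfl)
  have r3 := Hn_congr_inj q (fun c => ((fu c, fv c, fa c), fb c))
    (fun c => (fb c, (fu c, fv c), fa c))
    (fun x => (x.2, (x.1.1, x.1.2.1), x.1.2.2))
    (Function.LeftInverse.injective (g := fun x => ((x.2.1.1, x.2.1.2, x.2.2), x.1))
    (fun _ => rfl)) (fun _ => rfl)
  have r4 := Hn_congr_inj q (fun c => (fa c, fb c)) (fun c => (fb c, fa c)) Prod.swap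
    Prod.swap_injective (fun _ => rfl)
  have r5 := Hn_congr_inj q (fun c => (fu c, fv c, fb c)) (fun c => (fb c, fu c, fv c))
    (fun x => (x.2.2, x.1, x.2.1))
    (Function.LeftInverse.injective (g := fun x => (x.2.1, x.2.2, x.1))
    (fun _ => rfl)) (fun _ => rfl)
  have hIv : Iv q fb (fun c => (fu c, fv c)) fa ≤ 0 := by
    unfold Iv I2 at *
    linarith
  have ind := Iv_zero hq.1 _ _ _ hIv
  -- the cost of an arbitrary decoder
  have cost : ∀ h : V → B → Y → A, ∑ c, q c * d (fa c) (h (fv c) (fb c) (fy c)) =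
      ∑ b, ∑ s : U × V, ∑ y, pushf q (fun c => (fb c, fu c, fv c)) (b, s) / pushf q fb b * wy y *
        ∑ a, pushf q (fun c => (fb c, fa c)) (b, a) * d a (h s.2 b y) := by
    intro h
    have e1 := sum_pushf_mul q (fun c => (((fu c, fv c, fa c), fb c), fy c))
      (fun x => d x.1.1.2.2 (h x.1.1.2.1 x.1.2 x.2))
    have e2 := sum_pushf_mul q (fun c => ((fb c, (fu c, fv c), fa c), fy c))
      (fun x => d x.1.2.2 (h x.1.2.1.2 x.1.1 x.2))
    simp only at e2
    rw [← e2, Fintype.sum_prod_type]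
    simp only [Fintype.sum_prod_type (α₁ := B), Fintype.sum_prod_type (α₁ := U × V)]
    refine Finset.sum_congr rfl fun b _ => Finset.sum_congr rfl fun s _ => ?_
    rw [Finset.sum_comm]
    refine Finset.sum_congr rfl fun y _ => ?_
    rw [Finset.mul_sum]
    refine Finset.sum_congr rfl fun a _ => ?_
    have e3 := pushf_inj q (fun c => (((fu c, fv c, fa c), fb c), fy c))
      (fun x => ((x.1.2, (x.1.1.1, x.1.1.2.1), x.1.1.2.2), x.2))
      (Function.LeftInverse.injective
        (g := fun x => (((x.1.2.1.1, x.1.2.1.2, x.1.2.2), x.1.1), x.2))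
      (fun _ => rfl)) (((s.1, s.2, a), b), y)
    have e4 := pushf_inj q (fun c => ((fu c, fv c, fa c), fb c))
      (fun x => (x.2, (x.1.1, x.1.2.1), x.1.2.2))
      (Function.LeftInverse.injective (g := fun x => ((x.2.1.1, x.2.1.2, x.2.2), x.1))
      (fun _ => rfl)) ((s.1, s.2, a), b)
    have e5 := ind (b, s, a)
    simp only [Prod.mk.eta] at e3 e4 e5
    rw [e3, fY, ← e4, e5]
    ring
  have hb : ∀ b, ∃ a', ∀ a'', ∑ a, pushf q (fun c => (fb c, fa c)) (b, a) * d a a' ≤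
      ∑ a, pushf q (fun c => (fb c, fa c)) (b, a) * d a a'' := fun b =>
    Finite.exists_min (fun a' => ∑ a, pushf q (fun c => (fb c, fa c)) (b, a) * d a a')
  choose best hbest using hb
  have hcost : ∑ c, q c * d (fa c) (best (fb c)) ≤ D := by
    refine le_trans ?_ c3
    rw [cost (fun _ b _ => best b), cost Ahat]
    refine Finset.sum_le_sum fun b _ => Finset.sum_le_sum fun s _ => Finset.sum_le_sum fun y _ => ?_
    exact mul_le_mul_of_nonneg_left (hbest _ _) (mul_nonneg (div_nonneg (pushf_nonneg hq.1 _ _)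
      (pushf_nonneg hq.1 _ _)) (hwy0 y))
  have pAB : pushf q (fun c => (fa c, fb c)) = pushf pS (fun w => (w.1, w.2.1)) := by
    funext x
    have e1 := pushf_coarse q (fun c => (fu c, fv c, fa c)) fb (fun s => s.2.2) (srcB pS)
      (S.facB hW) x.1 x.2
    simp only at e1
    rw [show pushf q (fun c => fa c) = _ from S.src] at e1
    have e2 := mul_ck hpS.1 (fun w => w.1) (fun w => w.2.1) x.1 x.2
    rw [show x = (x.1, x.2) from rfl, e1, e2]
    rfl
  have pAE : pushf q (fun c => (fa c, fe c)) = pushf pS (fun w => (w.1, w.2.2)) := by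
    funext x
    have e1 := pushf_coarse q (fun c => (fu c, fv c, fa c)) fe (fun s => s.2.2) (srcE pS)
      (S.facE hW) x.1 x.2
    simp only at e1
    rw [show pushf q (fun c => fa c) = _ from S.src] at e1
    have e2 := mul_ck hpS.1 (fun w => w.1) (fun w => w.2.2) x.1 x.2
    rw [show x = (x.1, x.2) from rfl, e1, e2]
    rfl
  have pE : pushf q fe = pushf pS (fun w => w.2.2) := by
    funext e
    rw [← sum_pushf_pair_left q fa fe, pAE, sum_pushf_pair_left pS (fun w => w.1)]
  refine zero_code best ?_ ?_
  · refine le_trans (le_of_eq ?_) hcost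
    have e1 := sum_pushf_mul q (fun c => (fa c, fb c)) (fun x => d x.1 (best x.2))
    rw [pAB, sum_pushf_mul] at e1
    exact e1
  · have k1 : Hn pS (fun w => (w.1, w.2.2)) = Hn q (fun c => (fa c, fe c)) := by
      unfold Hn; rw [pAE]
    have k2 : Hn pS (fun w => w.2.2) = Hn q fe := by
      unfold Hn; rw [pE]
    rw [k1, k2]
    have n1 := Iv_nonneg hq.1 fe fa (fun c => (fu c, fz c))
    have n2 := le_max_left 0 (Iv q fu fv (fun c => (fa c, fe c, fz c)) -
        Iv q fu fv (fun c => (fb c, fy c)))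
    have s1 := Hn_congr_inj q (fun c => (fa c, fe c)) (fun c => (fe c, fa c)) Prod.swap
      Prod.swap_injective (fun _ => rfl)
    have s2 := Hn_congr_inj q (fun c => (fu c, fe c, fz c)) (fun c => (fe c, fu c, fz c))
      (fun x => (x.2.1, x.1, x.2.2))
      (Function.LeftInverse.injective (g := fun x => (x.2.1, x.1, x.2.2))
      (fun _ => rfl)) (fun _ => rfl)
    have s3 := Hn_congr_inj q (fun c => (fu c, fa c, fe c, fz c))
      (fun c => (fe c, fa c, fu c, fz c))
      (fun x => (x.2.2.1, x.2.1, x.1, x.2.2.2))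
      (Function.LeftInverse.injective (g := fun x => (x.2.2.1, x.2.1, x.1, x.2.2.2))
      (fun _ => rfl)) (fun _ => rfl)
    unfold Iv at n1
    linarith

end ZeroCap

section Final

variable {γ U V : Type} [Fintype γ] [Fintype U] [Fintype V]
  {pS : A × B × E → ℝ} {Wch : X → Y × Z → ℝ}
  {q : γ → ℝ} {fu : γ → U} {fv : γ → V} {fa : γ → A} {fb : γ → B} {fe : γ → E} {fy : γ → Y}
  {fz : γ → Z} {xfun : V → A → X}

theorem sys_achievable (hpS : IsPMF pS) (hW : IsKernel Wch) {d : A → A → ℝ} {dmax D Δ : ℝ}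
    (hdmax : 0 ≤ dmax) (hd : ∀ a a', 0 ≤ d a a' ∧ d a a' ≤ dmax) (hD : 0 ≤ D)
    (S : Sys pS Wch q fu fv fa fb fe fy fz xfun) (Ahat : V → B → Y → A)
    (c1 : I2 q fu fa ≤ I2 q fu (fun c => (fb c, fy c)))
    (c2 : Iv q fu fv fa ≤ Iv q fu fv (fun c => (fb c, fy c)))
    (c3 : ∑ c, q c * d (fa c) (Ahat (fv c) (fb c) (fy c)) ≤ D)
    (c4 : Δ * Real.log 2 ≤ Hn q (fun c => (fu c, fa c, fe c, fz c)) -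
      Hn q (fun c => (fu c, fe c, fz c)) -
      max 0 (Iv q fu fv (fun c => (fa c, fe c, fz c)) -
        Iv q fu fv (fun c => (fb c, fy c)))) :
    Achievable pS Wch d 1 D Δ := by
  have hl2 : 0 < Real.log 2 := Real.log_pos (by norm_num)
  by_cases hcap : ∃ x₁ x₂, chY Wch x₁ ≠ chY Wch x₂
  · obtain ⟨x₁, x₂, hx⟩ := hcap
    have : Nonempty X := ⟨x₁⟩
    have hA : Nonempty A := by
      by_contra hcon
      rw [not_nonempty_iff] at hcon
      have := hpS.2
      simp at this
    exact mix_achievable hpS hW hdmax hd hD S (q2_sys hpS hW).1 Ahat (fun _ _ _ => Classical.arbitrary A)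
      c1 c2 c3 c4 (q2_b1 hpS hW) (q2_b2 hpS hW hx)
      (le_of_eq (div_mul_cancel₀ _ hl2.ne'))
  · push Not at hcap
    have hne : Nonempty γ := by
      by_contra hcon
      rw [not_nonempty_iff] at hcon
      have := S.pmf.2
      simp at this
    obtain ⟨c₀⟩ := hne
    exact zero_cap hpS hW S Ahat (chY Wch (xfun (fv c₀) (fa c₀))) (fun x => hcap _ _)
      (fun y => (chY_isKernel hW _).1 y) c1 c2 c3 c4

end Final

/-- **Theorem 3 (Hybrid digital/analog scheme, matched bandwidth).** A tuple
`(1, D, Δ) ∈ ℝ₊³` is achievable whenever there exist finite auxiliary alphabets `𝒰, 𝒱`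
and random variables with joint distribution `p(u|v)·p(v,x|a)·p(a,b,e)·p(y,z|x)`, in which
`X = x(V,A)` is a deterministic function of `(V,A)`, and a function `Â : 𝒱×ℬ×𝒴 → 𝒜`,
satisfying the single-letter inequalities (i)–(iv). -/
theorem hybrid_inner_bound
    (pS : A × B × E → ℝ) (hpS : IsPMF pS)
    (Wch : X → Y × Z → ℝ) (hW : IsKernel Wch)
    (d : A → A → ℝ) (dmax : ℝ) (hdmax : 0 ≤ dmax)
    (hd : ∀ a a', 0 ≤ d a a' ∧ d a a' ≤ dmax)
    (D Δ : ℝ) (hD : 0 ≤ D) (hΔ : 0 ≤ Δ)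
    (hhyb : ∃ (𝒰 𝒱 : Type) (i𝒰 : Fintype 𝒰) (i𝒱 : Fintype 𝒱),
      @HybridCond A B E X Y Z _ _ _ _ _ _ 𝒰 𝒱 i𝒰 i𝒱 pS Wch d D Δ) :
    Achievable pS Wch d 1 D Δ := by
  obtain ⟨𝒰, 𝒱, i𝒰, i𝒱, pU, pVX, xfun, Ahat, hU, hVX, hx, c1, c2, c3, c4⟩ := hhyb
  have hl2 : 0 < Real.log 2 := Real.log_pos (by norm_num)
  obtain ⟨S, -⟩ := hybrid_sys hpS hW hU hVX hx
  set q := hybridJoint pS Wch pU pVX with hq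
  rw [mutInf_eq, mutInf_eq, div_le_div_iff_of_pos_right hl2] at c1
  simp only [condMutInf_eq] at c2 c4
  rw [div_le_div_iff_of_pos_right hl2] at c2
  refine sys_achievable hpS hW hdmax hd hD S Ahat c1 c2 c3 ?_
  have hsupp : ∀ c, q c ≠ 0 → c.2.2.2.2.2.1 = xfun c.2.1 c.2.2.1 := by
    intro c hc
    refine hx _ _ _ fun h0 => hc ?_
    simp [hq, hybridJoint, h0]
  have eX : Iv q (fun w => (w.1, w.2.2.2.2.1)) (fun w => w.2.2.2.2.2.1)
      (fun w => w.2.2.2.2.2.2.2) = Iv q (fun w => (w.1, w.2.2.2.2.1))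
      (fun w => xfun w.2.1 w.2.2.1) (fun w => w.2.2.2.2.2.2.2) := by
    unfold Iv Hn
    rw [pushf_congr_supp q (fun c => ((c.1, c.2.2.2.2.1), c.2.2.2.2.2.1))
        (fun c => ((c.1, c.2.2.2.2.1), xfun c.2.1 c.2.2.1)) (fun c hc => by rw [hsupp c hc]),
      pushf_congr_supp q (fun c => ((c.1, c.2.2.2.2.1), c.2.2.2.2.2.1, c.2.2.2.2.2.2.2))
        (fun c => ((c.1, c.2.2.2.2.1), xfun c.2.1 c.2.2.1, c.2.2.2.2.2.2.2))
        (fun c hc => by rw [hsupp c hc])]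
  have eAZ : Iv q (fun w => w.1) (fun w => w.2.1) (fun w => (w.2.2.1, w.2.2.2.2.2.2.2)) ≤
      Iv q (fun w => w.1) (fun w => w.2.1)
        (fun w => (w.2.2.1, w.2.2.2.2.1, w.2.2.2.2.2.2.2)) := by
    have h := Iv_mono S.pmf.1 (fun w => w.1) (fun w => w.2.1)
      (fun w => (w.2.2.1, w.2.2.2.2.2.2.2)) (fun w => w.2.2.2.2.1)
    rw [Iv_congr_inj q (fun w => w.1) (fun w => w.2.1)
      (fun w => (w.2.2.1, w.2.2.2.2.1, w.2.2.2.2.2.2.2))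
      (fun w => ((w.2.2.1, w.2.2.2.2.2.2.2), w.2.2.2.2.1)) (fun x => ((x.1, x.2.2), x.2.1))
      (Function.LeftInverse.injective (g := fun x => (x.1.1, x.2, x.1.2)) (fun _ => rfl))
      (fun _ => rfl)] at h
    exact h
  have id := S.equiv_id hW
  rw [eX] at c4
  unfold condH at c4
  rw [Hof_eq, Hof_eq, min_div_div_right hl2.le, ← sub_div, ← sub_div, ← sub_div, ← add_div,
    le_div_iff₀ hl2] at c4
  refine c4.trans ?_
  rw [id]
  set i1 := Iv q (fun w => w.1) (fun w => w.2.1)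
        (fun w => (w.2.2.1, w.2.2.2.2.1, w.2.2.2.2.2.2.2))
  set i2 := Iv q (fun w => w.1) (fun w => w.2.1) (fun w => (w.2.2.2.1, w.2.2.2.2.2.2.1))
  have m1 := min_le_left i2
    (Iv q (fun w => w.1) (fun w => w.2.1) (fun w => (w.2.2.1, w.2.2.2.2.2.2.2)))
  have m2 := min_le_right i2
    (Iv q (fun w => w.1) (fun w => w.2.1) (fun w => (w.2.2.1, w.2.2.2.2.2.2.2)))
  rcases max_cases 0 (i1 - i2) with ⟨h, -⟩ | ⟨h, -⟩ <;> rw [h] <;> linarith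


end SecureSC
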